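/- Let Ω ⊂ ℝ^N (N ≥ 2) be a smooth bounded domain, assume (S1), (P1), (μ1) hold, let q ∈ C₊(ℝ^N×ℝ^N) satisfy 2/q(x,y) + μ(x,y)/N = 2 for all (x,y), and let f satisfy (F1) and (F2). Then the problem (−Δ)_{p(·)}^{s(·)} u = (∫_Ω F(y,u(y))/|x−y|^{μ(x,y)} dy) f(x,u(x)) in Ω, u = 0 in ℝ^N∖Ω, admits a nontrivial weak solution; i.e., there exists u ∈ X₀, u ≢ 0, such that for every w ∈ X₀: ∫_{ℝ^N×ℝ^N} |u(x)−u(y)|^{p(x,y)−2}(u(x)−u(y))(w(x)−w(y))/|x−y|^{N+s(x,y)p(x,y)} dx dy = (1/2)∫_Ω∫_Ω F(x,u(x)) f(y,u(y)) w(y)/|x−y|^{μ(x,y)} dx dy. -/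

import Mathlib

open MeasureTheory Set Filter ENNReal

noncomputable section

namespace VarOrderChoquard

variable {N : ℕ}

/-- `ℝ^N` with the Euclidean structure. -/
abbrev RN (N : ℕ) := EuclideanSpace ℝ (Fin N)

/-- `Φ⁻` : infimum of a two-variable real function over `ℝ^N × ℝ^N`. -/
def inf2 (f : RN N → RN N → ℝ) : ℝ := sInf {t | ∃ x y, f x y = t}

/-- `Φ⁺` : supremum of a two-variable real function over `ℝ^N × ℝ^N`. -/
def sup2 (f : RN N → RN N → ℝ) : ℝ := sSup {t | ∃ x y, f x y = t}

/-- `Φ⁻` over a subset `D ⊆ ℝ^N`. -/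
def infOn (D : Set (RN N)) (g : RN N → ℝ) : ℝ := sInf (g '' D)

/-- `Φ⁺` over a subset `D ⊆ ℝ^N`. -/
def supOn (D : Set (RN N)) (g : RN N → ℝ) : ℝ := sSup (g '' D)

/-- `C₊(ℝ^N × ℝ^N)` : continuous with `1 < Φ⁻ ≤ Φ⁺ < ∞`. -/
def CPlus2 (f : RN N → RN N → ℝ) : Prop :=
  Continuous (fun z : RN N × RN N => f z.1 z.2) ∧ 1 < inf2 f ∧
    BddAbove {t | ∃ x y, f x y = t}

/-- `C₊(D)` for `D ⊆ ℝ^N`. -/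
def CPlusOn (D : Set (RN N)) (g : RN N → ℝ) : Prop :=
  ContinuousOn g D ∧ 1 < infOn D g ∧ BddAbove (g '' D)

/-- Condition (S1). -/
def S1 (s : RN N → RN N → ℝ) : Prop :=
  Continuous (fun z : RN N × RN N => s z.1 z.2) ∧ (∀ x y, s x y = s y x) ∧
    BddAbove {t | ∃ x y, s x y = t} ∧ 0 < inf2 s ∧ sup2 s < 1

/-- Condition (P1). -/
def P1 (s p : RN N → RN N → ℝ) : Prop :=
  CPlus2 p ∧ (∀ x y, p x y = p y x) ∧ sup2 s * sup2 p < N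

/-- Condition (μ1). -/
def Mu1 (μ : RN N → RN N → ℝ) : Prop :=
  (∀ x y, μ x y = μ y x) ∧ BddAbove {t | ∃ x y, μ x y = t} ∧
    0 < inf2 μ ∧ sup2 μ < N

/-- The critical exponent `p_s*(x) = N p(x,x) / (N - s(x,x) p(x,x))`. -/
def pstar (s p : RN N → RN N → ℝ) (x : RN N) : ℝ :=
  N * p x x / (N - s x x * p x x)

/-- The class `𝓜` : `p(x,x) ≤ r(x)q⁻ ≤ r(x)q⁺ < p_s*(x)` for all `x`. -/
def MemM (s p q : RN N → RN N → ℝ) (r : RN N → ℝ) : Prop :=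
  ∀ x, p x x ≤ r x * inf2 q ∧ r x * inf2 q ≤ r x * sup2 q ∧
    r x * sup2 q < pstar s p x

/-- Variable-exponent modular `∫_U |u/l|^{γ(x)} dx`. -/
def lmodular (U : Set (RN N)) (γ : RN N → ℝ) (u : RN N → ℝ) (l : ℝ) : ℝ≥0∞ :=
  ∫⁻ x in U, ENNReal.ofReal (|u x| / l) ^ γ x

/-- Membership in the variable-exponent Lebesgue space `L^{γ(x)}(U)`. -/
def MemVarLp (U : Set (RN N)) (γ : RN N → ℝ) (u : RN N → ℝ) : Prop :=
  Measurable u ∧ ∃ l, 0 < l ∧ lmodular U γ u l < ⊤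

/-- Luxemburg norm on `L^{γ(x)}(U)`. -/
def luxNorm (U : Set (RN N)) (γ : RN N → ℝ) (u : RN N → ℝ) : ℝ :=
  sInf {l | 0 < l ∧ lmodular U γ u l ≤ 1}

/-- Membership in the classical Lebesgue space `L^t(U)` (constant exponent `t`). -/
def MemCLp (U : Set (RN N)) (t : ℝ) (g : RN N → ℝ) : Prop :=
  Measurable g ∧ (∫⁻ x in U, ENNReal.ofReal |g x| ^ t) < ⊤

/-- The classical `L^t(U)`-norm. -/
def cLpNorm (U : Set (RN N)) (t : ℝ) (g : RN N → ℝ) : ℝ :=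
  (∫⁻ x in U, ENNReal.ofReal |g x| ^ t).toReal ^ (1 / t)

/-- Gagliardo-type modular
`∫_A (|u(x)-u(y)|/l)^{p(x,y)} / |x-y|^{N+s(x,y)p(x,y)} dx dy`. -/
def gmodular (A : Set (RN N × RN N)) (s p : RN N → RN N → ℝ) (u : RN N → ℝ)
    (l : ℝ) : ℝ≥0∞ :=
  ∫⁻ z in A, ENNReal.ofReal (|u z.1 - u z.2| / l) ^ p z.1 z.2 /
    ENNReal.ofReal (dist z.1 z.2) ^ ((N : ℝ) + s z.1 z.2 * p z.1 z.2)

/-- Membership in `W^{s(x,y),β(x),p(x,y)}(U)`. -/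
def MemW (U : Set (RN N)) (s p : RN N → RN N → ℝ) (β : RN N → ℝ)
    (u : RN N → ℝ) : Prop :=
  MemVarLp U β u ∧ ∃ l, 0 < l ∧ gmodular (U ×ˢ U) s p u l < ⊤

/-- The Gagliardo seminorm `[u]_U^{s,p}`. -/
def wSeminorm (U : Set (RN N)) (s p : RN N → RN N → ℝ) (u : RN N → ℝ) : ℝ :=
  sInf {l | 0 < l ∧ gmodular (U ×ˢ U) s p u l < 1}

/-- The norm on `W`. -/
def wNorm (U : Set (RN N)) (s p : RN N → RN N → ℝ) (β : RN N → ℝ)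
    (u : RN N → ℝ) : ℝ :=
  luxNorm U β u + wSeminorm U s p u

/-- `Q = (ℝ^N × ℝ^N) \ (Ωᶜ × Ωᶜ)`. -/
def Qset (Ω : Set (RN N)) : Set (RN N × RN N) := univ \ (Ωᶜ ×ˢ Ωᶜ)

/-- Membership in `X₀`. -/
def MemX0 (Ω : Set (RN N)) (s p : RN N → RN N → ℝ) (β : RN N → ℝ)
    (u : RN N → ℝ) : Prop :=
  Measurable u ∧ MemVarLp Ω β u ∧ (∃ l, 0 < l ∧ gmodular (Qset Ω) s p u l < ⊤) ∧
    (∀ᵐ x, x ∉ Ω → u x = 0)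

/-- The `X₀`-norm. -/
def x0Norm (s p : RN N → RN N → ℝ) (u : RN N → ℝ) : ℝ :=
  sInf {l | 0 < l ∧ gmodular univ s p u l < 1}

/-- The modular `ρ_{X₀}`. -/
def rhoX0 (s p : RN N → RN N → ℝ) (u : RN N → ℝ) : ℝ≥0∞ :=
  gmodular univ s p u 1

/-- Carathéodory function. -/
def Caratheodory (f : RN N → ℝ → ℝ) : Prop :=
  (∀ t, Measurable fun x => f x t) ∧ ∀ x, Continuous fun t => f x t

/-- `F(x,t) = ∫₀ᵗ f(x,τ) dτ`. -/
def Fant (f : RN N → ℝ → ℝ) (x : RN N) (t : ℝ) : ℝ := ∫ τ in (0:ℝ)..t, f x τ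

/-- Growth condition (F1) (with data `M` and `r`). -/
def F1 (Ω : Set (RN N)) (f : RN N → ℝ → ℝ) (M : ℝ) (r : RN N → ℝ) : Prop :=
  0 < M ∧ ∀ x ∈ Ω, ∀ t : ℝ, |f x t| ≤ M * |t| ^ (r x - 1)

/-- Ambrosetti–Rabinowitz type condition (F2) (with data `Θ`). -/
def F2 (Ω : Set (RN N)) (f : RN N → ℝ → ℝ) (Θ : ℝ) : Prop :=
  ∀ᵐ x, x ∈ Ω → ∀ t : ℝ, t ≠ 0 →
    0 < Θ * Fant f x t ∧ Θ * Fant f x t ≤ 2 * (t * f x t)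

/-- The left-hand side pairing
`∫∫ |u(x)-u(y)|^{p-2}(u(x)-u(y))(w(x)-w(y)) / |x-y|^{N+sp} dx dy`. -/
def energyLHS (s p : RN N → RN N → ℝ) (u w : RN N → ℝ) : ℝ :=
  ∫ z : RN N × RN N,
    |u z.1 - u z.2| ^ (p z.1 z.2 - 2) * (u z.1 - u z.2) * (w z.1 - w z.2) /
      dist z.1 z.2 ^ ((N : ℝ) + s z.1 z.2 * p z.1 z.2)

/-- The Choquard right-hand side `∫_Ω ∫_Ω F(x,u(x)) f(y,u(y)) w(y) / |x-y|^μ`. -/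
def choquardRHS (Ω : Set (RN N)) (μ : RN N → RN N → ℝ) (f : RN N → ℝ → ℝ)
    (u w : RN N → ℝ) : ℝ :=
  ∫ x in Ω, ∫ y in Ω, Fant f x (u x) * f y (u y) * w y / dist x y ^ μ x y

/-- The energy functional `J`. -/
def Jfun (Ω : Set (RN N)) (s p μ : RN N → RN N → ℝ) (f : RN N → ℝ → ℝ)
    (u : RN N → ℝ) : ℝ :=
  (∫ z : RN N × RN N,
    |u z.1 - u z.2| ^ p z.1 z.2 /
      (p z.1 z.2 * dist z.1 z.2 ^ ((N : ℝ) + s z.1 z.2 * p z.1 z.2)))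
  - (1/2) * ∫ x in Ω, ∫ y in Ω,
      Fant f x (u x) * Fant f y (u y) / dist x y ^ μ x y

/-- `⟨J'(u), w⟩`. -/
def Jderiv (Ω : Set (RN N)) (s p μ : RN N → RN N → ℝ) (f : RN N → ℝ → ℝ)
    (u w : RN N → ℝ) : ℝ :=
  energyLHS s p u w - choquardRHS Ω μ f u w

/-- The perturbed functional `J_λ`. -/
def Jlam (Ω : Set (RN N)) (s p μ : RN N → RN N → ℝ) (f : RN N → ℝ → ℝ)
    (α : RN N → ℝ) (lam : ℝ) (u : RN N → ℝ) : ℝ :=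
  Jfun Ω s p μ f u - lam * ∫ x in Ω, |u x| ^ α x / α x

/-- A single gradient step which lowers `j` by a fixed amount on `{a ≤ j ≤ C}` and is the identity
on `{j ≤ a / 2}`, provided `j` has no critical point in the compact set `{a / 2 ≤ j ≤ C}`. -/
theorem exists_descent_map {E : Type*} [NormedAddCommGroup E] [InnerProductSpace ℝ E]
    [FiniteDimensional ℝ E] {j : E → ℝ} {j' : E → E →L[ℝ] ℝ} (hj : ∀ x, HasFDerivAt j (j' x) x)
    (hj' : Continuous j') {a C : ℝ} (ha : 0 < a) (hbd : Bornology.IsBounded {x | 0 ≤ j x})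
    (hcrit : ∀ x, a / 2 ≤ j x → j x ≤ C → j' x ≠ 0) :
    ∃ φ : E → E, Continuous φ ∧ (∀ x, j x ≤ 0 → φ x = x) ∧
      (∀ x, j x ≤ C → j (φ x) ≤ j x) ∧
      ∃ θ > 0, ∀ x, a ≤ j x → j x ≤ C → j (φ x) ≤ j x - θ := by
  have hjc : Continuous j := continuous_iff_continuousAt.2 fun x => (hj x).continuousAt
  set G : E → E := fun x => (InnerProductSpace.toDual ℝ E).symm (j' x) with hG
  have hGc : Continuous G := (InnerProductSpace.toDual ℝ E).symm.continuous.comp hj'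
  have hGapp : ∀ x v, j' x v = inner ℝ (G x) v := by
    intro x v
    rw [hG]
    simp
  set χ : E → ℝ := fun x => max (j x - a / 2) 0 with hχ
  have hχc : Continuous χ := by fun_prop
  set K : Set E := {x | a / 2 ≤ j x ∧ j x ≤ C} with hK
  have hKc : IsCompact K := by
    refine Metric.isCompact_of_isClosed_isBounded ?_ (hbd.subset fun x hx => ?_)
    · exact (isClosed_le continuous_const hjc).inter (isClosed_le hjc continuous_const)
    · exact le_trans (by positivity) hx.1
  obtain ⟨δ, hδ, hδK⟩ : ∃ δ > 0, ∀ x ∈ K, δ ≤ ‖G x‖ := by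
    rcases K.eq_empty_or_nonempty with h | h
    · exact ⟨1, one_pos, by simp [h]⟩
    · obtain ⟨x, hx, hmin⟩ := hKc.exists_isMinOn h hGc.norm.continuousOn
      refine ⟨‖G x‖, ?_, fun y hy => hmin hy⟩
      rw [gt_iff_lt, norm_pos_iff]
      intro h0
      apply hcrit x hx.1 hx.2
      ext v
      rw [hGapp, h0]
      simp
  have hev : ∀ᶠ t in nhds (0 : ℝ), ∀ x ∈ K, ‖G (x - (t * χ x) • G x) - G x‖ < δ / 2 := by
    apply hKc.eventually_forall_of_forall_eventually
    intro x _
    have hcont : Continuous fun q : ℝ × E => ‖G (q.2 - (q.1 * χ q.2) • G q.2) - G q.2‖ := by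
      fun_prop
    have := hcont.tendsto (0, x)
    simp only [zero_mul, zero_smul, sub_zero, sub_self, norm_zero] at this
    exact this.eventually_lt_const (by positivity)
  obtain ⟨ε₀, hε₀, hball⟩ := Metric.eventually_nhds_iff.1 hev
  set ε := ε₀ / 2 with hε
  have hεpos : 0 < ε := by positivity
  have hstep : ∀ x ∈ K, j (x - (ε * χ x) • G x) ≤ j x - ε * χ x * (δ ^ 2 / 2) := by
    intro x hx
    have hχ0 : 0 ≤ χ x := le_max_right _ _
    set g : ℝ → ℝ := fun t => j (x - (t * χ x) • G x) with hg
    have hgd : ∀ t, HasDerivAt g (j' (x - (t * χ x) • G x) (-(χ x • G x))) t := by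
      intro t
      have h1 : HasDerivAt (fun t : ℝ => x - (t * χ x) • G x) (-(χ x • G x)) t := by
        have := (((hasDerivAt_id t).mul_const (χ x)).smul_const (G x)).const_sub x
        simpa using this
      exact (hj _).comp_hasDerivAt t h1
    have hle := Convex.image_sub_le_mul_sub_of_deriv_le (convex_Icc (0 : ℝ) ε)
      (f := g) (C := -(χ x * (δ ^ 2 / 2)))
      (fun t _ => (hgd t).continuousAt.continuousWithinAt)
      (fun t _ => (hgd t).differentiableAt.differentiableWithinAt) (fun t ht => by
        rw [interior_Icc] at ht
        rw [(hgd t).deriv, hGapp]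
        have hb := hball (y := t) (by
          rw [Real.dist_eq, sub_zero, abs_of_pos ht.1]; linarith [ht.2]) x hx
        have hd := hδK x hx
        rw [inner_neg_right, inner_smul_right]
        have h2 : inner ℝ (G (x - (t * χ x) • G x)) (G x) ≥ δ ^ 2 / 2 := by
          have h3 : inner ℝ (G (x - (t * χ x) • G x)) (G x)
              = inner ℝ (G (x - (t * χ x) • G x) - G x) (G x) + ‖G x‖ ^ 2 := by
            rw [inner_sub_left, real_inner_self_eq_norm_sq]; ring
          have h4 := (abs_le.1 (abs_real_inner_le_norm (G (x - (t * χ x) • G x) - G x) (G x))).1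
          rw [h3]
          nlinarith [norm_nonneg (G (x - (t * χ x) • G x) - G x)]
        nlinarith) 0 (by simp [hεpos.le]) ε (by simp [hεpos.le]) hεpos.le
    simp only [hg, zero_mul, zero_smul, sub_zero] at hle
    nlinarith
  have hout : ∀ x, j x ≤ a / 2 → χ x = 0 := fun x hx => max_eq_right (by linarith)
  refine ⟨fun x => x - (ε * χ x) • G x, by fun_prop, fun x hx => ?_, fun x hx => ?_,
    ε * (a / 2) * (δ ^ 2 / 2), by positivity, fun x hx hxC => ?_⟩
  · simp [hout x (by linarith)]
  · by_cases h : j x ≤ a / 2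
    · simp [hout x h]
    · have h1 := hstep x ⟨by linarith, hx⟩
      have : 0 ≤ ε * χ x * (δ ^ 2 / 2) := by
        have : 0 ≤ χ x := le_max_right _ _
        positivity
      linarith
  · have h1 := hstep x ⟨by linarith, hxC⟩
    have h2 : a / 2 ≤ χ x := le_trans (by linarith) (le_max_left _ _)
    have h3 : ε * (a / 2) * (δ ^ 2 / 2) ≤ ε * χ x * (δ ^ 2 / 2) := by gcongr
    linarith

/-- Mountain pass theorem in finite dimension, for a function whose nonnegative superlevel set is
bounded. -/
theorem finiteDimensional_mountain_pass {E : Type*} [NormedAddCommGroup E] [InnerProductSpace ℝ E]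
    [FiniteDimensional ℝ E] {j : E → ℝ} {j' : E → E →L[ℝ] ℝ} (hj : ∀ x, HasFDerivAt j (j' x) x)
    (hj' : Continuous j') {a C : ℝ} (ha : 0 < a) (hbd : Bornology.IsBounded {x | 0 ≤ j x})
    (h0 : j 0 ≤ 0) {e : E} (he : j e ≤ 0) (hseg : ∀ t ∈ Icc (0 : ℝ) 1, j (t • e) ≤ C)
    (hmp : ∀ γ : ℝ → E, Continuous γ → γ 0 = 0 → γ 1 = e → ∃ t ∈ Icc (0 : ℝ) 1, a ≤ j (γ t)) :
    ∃ x, a / 2 ≤ j x ∧ j x ≤ C ∧ j' x = 0 := by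
  by_contra! hcrit
  obtain ⟨φ, hφc, hφ0, hφle, θ, hθ, hφθ⟩ := exists_descent_map hj hj' ha hbd hcrit
  have key : ∀ k : ℕ, ∃ γ : ℝ → E, Continuous γ ∧ γ 0 = 0 ∧ γ 1 = e ∧
      ∀ t ∈ Icc (0 : ℝ) 1, j (γ t) ≤ C ∧ (a ≤ j (γ t) → j (γ t) ≤ C - k * θ) := by
    intro k
    induction k with
    | zero =>
      exact ⟨fun t => t • e, by fun_prop, by simp, by simp,
        fun t ht => ⟨hseg t ht, fun _ => by simpa using hseg t ht⟩⟩
    | succ k ih =>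
      obtain ⟨γ, hγ, hγ0, hγ1, hγC⟩ := ih
      refine ⟨fun t => φ (γ t), hφc.comp hγ, ?_, ?_, fun t ht => ?_⟩
      · simp only [hγ0, hφ0 0 h0]
      · simp only [hγ1, hφ0 e he]
      · obtain ⟨h1, h2⟩ := hγC t ht
        refine ⟨(hφle _ h1).trans h1, fun h => ?_⟩
        have h3 := h.trans (hφle _ h1)
        have h4 := hφθ _ h3 h1
        have h5 := h2 h3
        push_cast
        linarith
  obtain ⟨k, hk⟩ := exists_nat_gt ((C - a) / θ)
  obtain ⟨γ, hγ, hγ0, hγ1, hγC⟩ := key k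
  obtain ⟨t, ht, hat⟩ := hmp γ hγ hγ0 hγ1
  have h1 := (hγC t ht).2 hat
  rw [div_lt_iff₀ hθ] at hk
  linarith

/-- Truncation of `t` to the interval `[-T, T]`. -/
def clip (T t : ℝ) : ℝ := max (-T) (min T t)

theorem abs_clip_le {T : ℝ} (hT : 0 ≤ T) (t : ℝ) : |clip T t| ≤ T := by
  unfold clip
  rw [abs_le]
  exact ⟨le_max_left _ _, max_le (by linarith) (min_le_left _ _)⟩

theorem clip_eq_self {T t : ℝ} (h : |t| ≤ T) : clip T t = t := by
  obtain ⟨h1, h2⟩ := abs_le.1 h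
  unfold clip
  rw [min_eq_right h2, max_eq_right h1]

theorem abs_sub_clip_le {T : ℝ} (hT : 0 ≤ T) (t : ℝ) : |t - clip T t| ≤ max (|t| - T) 0 := by
  by_cases h : |t| ≤ T
  · rw [clip_eq_self h, sub_self, abs_zero]
    exact le_max_right _ _
  · push Not at h
    rw [max_eq_left (by linarith)]
    unfold clip
    rcases le_total 0 t with h0 | h0
    · rw [abs_of_nonneg h0] at h ⊢
      rw [min_eq_left h.le, max_eq_right (by linarith), abs_of_nonneg (by linarith)]
    · rw [abs_of_nonpos h0] at h ⊢
      rw [min_eq_right (by linarith), max_eq_left (by linarith), abs_of_nonpos (by linarith)]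
      linarith

theorem continuous_clip : Continuous fun q : ℝ × ℝ => clip q.1 q.2 := by
  unfold clip
  fun_prop

/-- Dominated convergence with a varying dominating sequence `c * (φ n + ψ)`, where the integrals
of `φ n` are asymptotically at most the integral of the pointwise limit `φ`. -/
theorem tendsto_integral_of_dominated_seq {Z : Type*} [MeasurableSpace Z] {ν : Measure Z}
    {φ : ℕ → Z → ℝ} {φ₀ ψ : Z → ℝ} {ε : ℕ → ℝ} (hφ : ∀ n, Integrable (φ n) ν)
    (hφ₀ : Integrable φ₀ ν) (hψ : Integrable ψ ν) (hφpos : ∀ n z, 0 ≤ φ n z)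
    (hφ₀pos : ∀ z, 0 ≤ φ₀ z) (hψpos : ∀ z, 0 ≤ ψ z)
    (hlim : ∀ᵐ z ∂ν, Tendsto (fun n => φ n z) atTop (nhds (φ₀ z)))
    (hε : Tendsto ε atTop (nhds 0)) (hle : ∀ n, ∫ z, φ n z ∂ν ≤ ∫ z, φ₀ z ∂ν + ε n)
    {c : ℝ} (hc : 0 ≤ c) {g : ℕ → Z → ℝ} {g₀ : Z → ℝ} (hg : ∀ n, AEStronglyMeasurable (g n) ν)
    (hgle : ∀ n z, |g n z| ≤ c * (φ n z + ψ z))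
    (hglim : ∀ᵐ z ∂ν, Tendsto (fun n => g n z) atTop (nhds (g₀ z))) :
    Tendsto (fun n => ∫ z, g n z ∂ν) atTop (nhds (∫ z, g₀ z ∂ν)) := by
  have hminus : Tendsto (fun n => ∫ z, max (φ₀ z - φ n z) 0 ∂ν) atTop (nhds 0) := by
    have := tendsto_integral_of_dominated_convergence (μ := ν)
      (F := fun n z => max (φ₀ z - φ n z) 0) (f := fun _ => (0 : ℝ)) φ₀
      (fun n => ((hφ₀.sub (hφ n)).pos_part).aestronglyMeasurable) hφ₀
      (fun n => .of_forall fun z => by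
        rw [Real.norm_of_nonneg (le_max_right _ _)]
        exact max_le (by linarith [hφpos n z]) (hφ₀pos z))
      (by
        filter_upwards [hlim] with z hz
        have := (tendsto_const_nhds (x := φ₀ z)).sub hz
        rw [sub_self] at this
        simpa using this.max (tendsto_const_nhds (x := (0 : ℝ))))
    simpa using this
  have hplus : Tendsto (fun n => ∫ z, max (φ n z - φ₀ z) 0 ∂ν) atTop (nhds 0) := by
    have hle' : ∀ n, ∫ z, max (φ n z - φ₀ z) 0 ∂ν ≤ ε n + ∫ z, max (φ₀ z - φ n z) 0 ∂ν := by
      intro n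
      have h1 : ∫ z, max (φ n z - φ₀ z) 0 ∂ν
          = ∫ z, ((φ n z - φ₀ z) + max (φ₀ z - φ n z) 0) ∂ν := by
        congr 1
        ext z
        rcases le_total (φ n z) (φ₀ z) with h | h
        · rw [max_eq_right (by linarith), max_eq_left (by linarith)]; ring
        · rw [max_eq_left (by linarith), max_eq_right (by linarith)]; ring
      have h2 : Integrable (fun z => φ n z - φ₀ z) ν := (hφ n).sub hφ₀
      have h3 : Integrable (fun z => max (φ₀ z - φ n z) 0) ν := (hφ₀.sub (hφ n)).pos_part
      rw [h1, integral_add h2 h3, integral_sub (hφ n) hφ₀]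
      linarith [hle n]
    refine squeeze_zero (fun n => integral_nonneg fun z => le_max_right _ _) hle' ?_
    simpa using hε.add hminus
  have hG : ∀ z, 0 ≤ c * (φ₀ z + ψ z) := fun z => mul_nonneg hc (add_nonneg (hφ₀pos z) (hψpos z))
  have hclipm : ∀ n, AEStronglyMeasurable (fun z => clip (c * (φ₀ z + ψ z)) (g n z)) ν := fun n =>
    continuous_clip.comp_aestronglyMeasurable
      (((hφ₀.add hψ).const_mul c).aestronglyMeasurable.prodMk (hg n))
  have hGint : Integrable (fun z => c * (φ₀ z + ψ z)) ν := (hφ₀.add hψ).const_mul c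
  have hclip : Tendsto (fun n => ∫ z, clip (c * (φ₀ z + ψ z)) (g n z) ∂ν) atTop
      (nhds (∫ z, g₀ z ∂ν)) := by
    refine tendsto_integral_of_dominated_convergence (fun z => c * (φ₀ z + ψ z)) hclipm hGint
      (fun n => .of_forall fun z => abs_clip_le (hG z) _) ?_
    filter_upwards [hlim, hglim] with z hz hgz
    have h1 : |g₀ z| ≤ c * (φ₀ z + ψ z) :=
      le_of_tendsto_of_tendsto hgz.abs ((hz.add tendsto_const_nhds).const_mul c)
        (.of_forall fun n => hgle n z)
    have h2 := (continuous_clip.tendsto (c * (φ₀ z + ψ z), g₀ z)).comp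
      ((tendsto_const_nhds (x := c * (φ₀ z + ψ z))).prodMk_nhds hgz)
    simpa only [clip_eq_self h1, Function.comp_def] using h2
  have hdiff : Tendsto (fun n => ∫ z, (g n z - clip (c * (φ₀ z + ψ z)) (g n z)) ∂ν) atTop
      (nhds 0) := by
    refine squeeze_zero_norm (a := fun n => c * ∫ z, max (φ n z - φ₀ z) 0 ∂ν) (fun n => ?_) ?_
    · rw [← integral_const_mul]
      refine norm_integral_le_of_norm_le (((hφ n).sub hφ₀).pos_part.const_mul c)
        (.of_forall fun z => ?_)
      refine (abs_sub_clip_le (hG z) _).trans (max_le ?_ (mul_nonneg hc (le_max_right _ _)))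
      calc |g n z| - c * (φ₀ z + ψ z) ≤ c * (φ n z + ψ z) - c * (φ₀ z + ψ z) := by
            linarith [hgle n z]
        _ = c * (φ n z - φ₀ z) := by ring
        _ ≤ c * max (φ n z - φ₀ z) 0 := by gcongr; exact le_max_left _ _
    · simpa using hplus.const_mul c
  have hgint : ∀ n, Integrable (g n) ν := fun n =>
    (((hφ n).add hψ).const_mul c).mono' (hg n) (.of_forall fun z => hgle n z)
  have hcint : ∀ n, Integrable (fun z => clip (c * (φ₀ z + ψ z)) (g n z)) ν := fun n =>
    hGint.mono' (hclipm n) (.of_forall fun z => abs_clip_le (hG z) _)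
  have := hdiff.add hclip
  rw [zero_add] at this
  refine this.congr fun n => ?_
  rw [integral_sub (hgint n) (hcint n), sub_add_cancel]

/-- On a finite measure space, almost everywhere convergence and boundedness of the moments of
order `c > 1` imply convergence of integrals. -/
theorem tendsto_integral_of_moment_bound {Z : Type*} [MeasurableSpace Z] {ν : Measure Z}
    [IsFiniteMeasure ν] {c Q : ℝ} (hc : 1 < c) {g : ℕ → Z → ℝ} {g₀ : Z → ℝ}
    (hg : ∀ n, AEStronglyMeasurable (g n) ν) (hdom : ∀ n, Integrable (fun z => |g n z| ^ c) ν)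
    (hQ : ∀ n, ∫ z, |g n z| ^ c ∂ν ≤ Q) (hg₀ : Integrable g₀ ν)
    (hglim : ∀ᵐ z ∂ν, Tendsto (fun n => g n z) atTop (nhds (g₀ z))) :
    Tendsto (fun n => ∫ z, g n z ∂ν) atTop (nhds (∫ z, g₀ z ∂ν)) := by
  have hQ0 : 0 ≤ Q := (integral_nonneg fun z => Real.rpow_nonneg (abs_nonneg _) _).trans (hQ 0)
  have hgint : ∀ n, Integrable (g n) ν := fun n => by
    refine ((integrable_const (1 : ℝ)).add (hdom n)).mono' (hg n) (.of_forall fun z => ?_)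
    rw [Real.norm_eq_abs]
    simp only [Pi.add_apply]
    rcases le_total (|g n z|) 1 with h | h
    · linarith [Real.rpow_nonneg (abs_nonneg (g n z)) c]
    · linarith [Real.self_le_rpow_of_one_le h hc.le]
  have hclipm : ∀ T : ℝ, Continuous (clip T) := fun T => by unfold clip; fun_prop
  have hcl : ∀ T : ℝ, 0 ≤ T → ∀ h : Z → ℝ, AEStronglyMeasurable h ν →
      Integrable (fun z => clip T (h z)) ν := fun T hT h hh =>
    (integrable_const T).mono' ((hclipm T).comp_aestronglyMeasurable hh)
      (.of_forall fun z => abs_clip_le hT _)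
  have hpt : ∀ T : ℝ, 0 < T → ∀ t : ℝ, |t - clip T t| ≤ T ^ (1 - c) * |t| ^ c := by
    intro T hT t
    refine (abs_sub_clip_le hT.le t).trans (max_le ?_ (by positivity))
    rcases le_total (|t|) T with h | h
    · have : 0 ≤ T ^ (1 - c) * |t| ^ c := by positivity
      linarith
    · have h0 : 0 < |t| := hT.trans_le h
      calc |t| - T ≤ |t| := by linarith
        _ = |t| ^ (1 - c) * |t| ^ c := by
            rw [← Real.rpow_add h0]; simp
        _ ≤ T ^ (1 - c) * |t| ^ c :=
            mul_le_mul_of_nonneg_right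
              (Real.rpow_le_rpow_of_nonpos hT h (sub_nonpos.2 hc.le)) (by positivity)
  have hdecay : Tendsto (fun T : ℝ => T ^ (1 - c) * Q) atTop (nhds 0) := by
    have := (tendsto_rpow_neg_atTop (y := c - 1) (by linarith)).mul_const Q
    simpa using this
  have hclip₀ : Tendsto (fun T : ℕ => ∫ z, clip T (g₀ z) ∂ν) atTop (nhds (∫ z, g₀ z ∂ν)) := by
    refine tendsto_integral_of_dominated_convergence (fun z => |g₀ z|)
      (fun T => (hcl T (Nat.cast_nonneg T) _ hg₀.1).1) hg₀.abs (fun T => .of_forall fun z => ?_)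
      (.of_forall fun z => ?_)
    · by_cases h : |g₀ z| ≤ T
      · rw [clip_eq_self h, Real.norm_eq_abs]
      · exact (abs_clip_le (Nat.cast_nonneg T) _).trans (not_le.1 h).le
    · obtain ⟨k, hk⟩ := exists_nat_ge |g₀ z|
      refine tendsto_const_nhds.congr' ?_
      filter_upwards [eventually_ge_atTop k] with T hT
      exact (clip_eq_self (hk.trans (by exact_mod_cast hT))).symm
  rw [Metric.tendsto_atTop]
  intro ε hε
  obtain ⟨T, hT1, hT2, hT0⟩ :=
    (((hdecay.comp tendsto_natCast_atTop_atTop).eventually_lt_const (show (0 : ℝ) < ε / 3 by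
      positivity)).and ((Metric.tendsto_nhds.1 hclip₀ (ε / 3) (by positivity)).and
        (eventually_gt_atTop 0))).exists
  have hT : (0 : ℝ) < T := by exact_mod_cast hT0
  have hTn : Tendsto (fun n => ∫ z, clip T (g n z) ∂ν) atTop (nhds (∫ z, clip T (g₀ z) ∂ν)) := by
    refine tendsto_integral_of_dominated_convergence (fun _ => (T : ℝ))
      (fun n => (hcl T hT.le _ (hg n)).1) (integrable_const _)
      (fun n => .of_forall fun z => abs_clip_le hT.le _) ?_
    filter_upwards [hglim] with z hz using ((hclipm T).tendsto _).comp hz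
  obtain ⟨n₀, hn₀⟩ := Metric.tendsto_atTop.1 hTn (ε / 3) (by positivity)
  refine ⟨n₀, fun n hn => ?_⟩
  have h1 : dist (∫ z, g n z ∂ν) (∫ z, clip T (g n z) ∂ν) ≤ T ^ (1 - c) * Q := by
    rw [dist_eq_norm, ← integral_sub (hgint n) (hcl T hT.le _ (hg n))]
    refine (norm_integral_le_of_norm_le ((hdom n).const_mul _)
      (.of_forall fun z => hpt T hT (g n z))).trans ?_
    rw [integral_const_mul]
    gcongr
    exact hQ n
  have h2 := hn₀ n hn
  simp only [Function.comp] at hT1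
  have h3 := dist_triangle4 (∫ z, g n z ∂ν) (∫ z, clip T (g n z) ∂ν) (∫ z, clip T (g₀ z) ∂ν)
    (∫ z, g₀ z ∂ν)
  linarith

/-- Differentiation under the integral sign for a `C¹` family with locally uniform domination. -/
theorem hasFDerivAt_integral_of_locally_dominated {Z : Type*} [MeasurableSpace Z] {ν : Measure Z}
    {E : Type*} [NormedAddCommGroup E] [NormedSpace ℝ E] [FiniteDimensional ℝ E] {h : E → Z → ℝ}
    {h' : E → Z → E →L[ℝ] ℝ} (hm : ∀ ξ, AEStronglyMeasurable (h ξ) ν)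
    (hm' : ∀ ξ, AEStronglyMeasurable (h' ξ) ν) (hi : ∀ ξ, Integrable (h ξ) ν)
    (hd : ∀ᵐ z ∂ν, ∀ ξ, HasFDerivAt (fun ξ => h ξ z) (h' ξ z) ξ)
    (hc : ∀ᵐ z ∂ν, Continuous fun ξ => h' ξ z) {bound : ℝ → Z → ℝ}
    (hb : ∀ R, Integrable (bound R) ν)
    (hle : ∀ᵐ z ∂ν, ∀ R ξ, ‖ξ‖ ≤ R → ‖h' ξ z‖ ≤ bound R z) :
    (∀ ξ, HasFDerivAt (fun ξ => ∫ z, h ξ z ∂ν) (∫ z, h' ξ z ∂ν) ξ) ∧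
      Continuous (fun ξ => ∫ z, h' ξ z ∂ν) ∧ ∀ ξ, Integrable (h' ξ) ν := by
  refine ⟨fun ξ => ?_, continuous_iff_continuousAt.2 fun ξ => ?_, fun ξ => ?_⟩
  · refine hasFDerivAt_integral_of_dominated_of_fderiv_le (s := Metric.ball ξ 1)
      (bound := bound (‖ξ‖ + 1)) (Metric.ball_mem_nhds _ one_pos) (.of_forall hm) (hi ξ) (hm' ξ)
      ?_ (hb _) ?_
    · filter_upwards [hle] with z hz η hη
      exact hz _ _ (norm_le_norm_add_const_of_dist_le (Metric.mem_ball.1 hη).le)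
    · filter_upwards [hd] with z hz η _ using hz η
  · refine continuousAt_of_dominated (bound := bound (‖ξ‖ + 1)) (.of_forall hm') ?_ (hb _) ?_
    · filter_upwards [Metric.ball_mem_nhds ξ one_pos] with η hη
      filter_upwards [hle] with z hz
      exact hz _ _ (norm_le_norm_add_const_of_dist_le (Metric.mem_ball.1 hη).le)
    · filter_upwards [hc] with z hz using hz.continuousAt
  · refine (hb ‖ξ‖).mono' (hm' ξ) ?_
    filter_upwards [hle] with z hz using hz _ _ le_rfl

/-- Quantitative form of the standing assumptions on the exponents `s` and `p`. -/
structure Exponents (s p : RN N → RN N → ℝ) (s0 s1 p1 p2 : ℝ) : Prop where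
  dim_pos : 0 < N
  s_cont : Continuous fun z : RN N × RN N => s z.1 z.2
  p_cont : Continuous fun z : RN N × RN N => p z.1 z.2
  s0_pos : 0 < s0
  s0_le : ∀ x y, s0 ≤ s x y
  le_s1 : ∀ x y, s x y ≤ s1
  s1_lt : s1 < 1
  p1_gt : 1 < p1
  p1_le : ∀ x y, p1 ≤ p x y
  le_p2 : ∀ x y, p x y ≤ p2
  sub : s1 * p2 < N

/-- The singular kernel `|x - y|^{-(N + s(x,y) p(x,y))}`. -/
def kern (s p : RN N → RN N → ℝ) (z : RN N × RN N) : ℝ :=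
  (dist z.1 z.2 ^ ((N : ℝ) + s z.1 z.2 * p z.1 z.2))⁻¹

/-- The Gagliardo energy density. -/
def gdens (s p : RN N → RN N → ℝ) (u : RN N → ℝ) (z : RN N × RN N) : ℝ :=
  |u z.1 - u z.2| ^ p z.1 z.2 * kern s p z

/-- The Gagliardo modular. -/
def gmod (s p : RN N → RN N → ℝ) (u : RN N → ℝ) : ℝ≥0∞ :=
  ∫⁻ z, ENNReal.ofReal (gdens s p u z)

/-- The inner integral of the Gagliardo modular. -/
def gfun (s p : RN N → RN N → ℝ) (u : RN N → ℝ) (x : RN N) : ℝ≥0∞ :=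
  ∫⁻ y, ENNReal.ofReal (gdens s p u (x, y))

/-- Measurable functions vanishing off `Ω` with finite Gagliardo modular. -/
structure FinMod (Ω : Set (RN N)) (s p : RN N → RN N → ℝ) (u : RN N → ℝ) : Prop where
  meas : Measurable u
  zero : ∀ᵐ x, x ∉ Ω → u x = 0
  fin : gmod s p u < ⊤

section

variable {s p : RN N → RN N → ℝ} {s0 s1 p1 p2 : ℝ} {u : RN N → ℝ}

theorem kern_nonneg (z : RN N × RN N) : 0 ≤ kern s p z := by
  unfold kern; positivity

theorem gdens_nonneg (z : RN N × RN N) : 0 ≤ gdens s p u z :=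
  mul_nonneg (by positivity) (kern_nonneg z)

namespace Exponents

variable (h : Exponents s p s0 s1 p1 p2)
include h

theorem s_pos (x y : RN N) : 0 < s x y := h.s0_pos.trans_le (h.s0_le x y)

theorem p_gt (x y : RN N) : 1 < p x y := h.p1_gt.trans_le (h.p1_le x y)

theorem p_pos (x y : RN N) : 0 < p x y := one_pos.trans (h.p_gt x y)

theorem p2_gt : 1 < p2 := (h.p_gt 0 0).trans_le (h.le_p2 0 0)

theorem dim_pos' : (0 : ℝ) < N := by exact_mod_cast h.dim_pos

theorem one_le_dim : (1 : ℝ) ≤ N := by exact_mod_cast h.dim_pos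

theorem exponent_pos (x y : RN N) : 0 < (N : ℝ) + s x y * p x y :=
  add_pos h.dim_pos' (mul_pos (h.s_pos x y) (h.p_pos x y))

theorem sp_le (x y : RN N) : s x y * p x y ≤ s1 * p2 :=
  mul_le_mul (h.le_s1 x y) (h.le_p2 x y) (h.p_pos x y).le
    (h.s0_pos.le.trans ((h.s0_le x y).trans (h.le_s1 x y)))

theorem measurable_kern : Measurable (kern s p) := by
  have h1 := h.s_cont.measurable
  have h2 := h.p_cont.measurable
  unfold kern
  fun_prop

theorem measurable_gdens (hu : Measurable u) : Measurable (gdens s p u) := by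
  have h2 := h.p_cont.measurable
  have h3 := h.measurable_kern
  unfold gdens
  fun_prop

theorem measurable_gfun (hu : Measurable u) : Measurable (gfun s p u) :=
  (h.measurable_gdens hu).ennreal_ofReal.lintegral_prod_right'

theorem gmod_eq (hu : Measurable u) : gmod s p u = ∫⁻ x, gfun s p u x :=
  lintegral_prod _ (h.measurable_gdens hu).ennreal_ofReal.aemeasurable

end Exponents

end

/-- An `L¹` average bound from a bound on a power, without Jensen's inequality. -/
theorem integral_le_of_rpow_le {α : Type*} [MeasurableSpace α] {m : Measure α} [IsFiniteMeasure m]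
    (hV : 0 < m.real univ) {D φ : α → ℝ} {P K : ℝ} (hP : 1 ≤ P) (hD0 : ∀ y, 0 ≤ D y)
    (hD : AEStronglyMeasurable D m) (hφ : Integrable φ m) (hφ0 : ∀ y, 0 ≤ φ y)
    (hle : ∀ᵐ y ∂m, D y ^ P ≤ 1 + φ y) (hK : ∫ y, φ y ∂m ≤ K) :
    Integrable D m ∧ ∫ y, D y ∂m ≤ m.real univ * (2 * (1 + K / m.real univ) ^ (1 / P)) := by
  set V := m.real univ
  have hK0 : 0 ≤ K := (integral_nonneg hφ0).trans hK
  set l := (1 + K / V) ^ (1 / P) with hl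
  have hbase : 0 < 1 + K / V := by positivity
  have hl0 : 0 < l := Real.rpow_pos_of_pos hbase _
  have hlP : l ^ P = 1 + K / V := by
    rw [hl, ← Real.rpow_mul hbase.le, one_div_mul_cancel (by linarith), Real.rpow_one]
  have hlP1 : l ^ (1 - P) * (1 + K / V) = l := by
    rw [← hlP, ← Real.rpow_add hl0]; simp
  have hpt : ∀ᵐ y ∂m, D y ≤ l + l ^ (1 - P) * (1 + φ y) := by
    filter_upwards [hle] with y hy
    rcases le_total (D y) l with h1 | h1
    · have : 0 ≤ l ^ (1 - P) * (1 + φ y) := by have := hφ0 y; positivity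
      linarith
    · have hDy : 0 < D y := hl0.trans_le h1
      calc D y = D y ^ (1 - P) * D y ^ P := by rw [← Real.rpow_add hDy]; simp
        _ ≤ l ^ (1 - P) * (1 + φ y) :=
          mul_le_mul (Real.rpow_le_rpow_of_nonpos hl0 h1 (by linarith)) hy
            (Real.rpow_nonneg (hD0 y) _) (by positivity)
        _ ≤ _ := by linarith
  have hdom : Integrable (fun y => l + l ^ (1 - P) * (1 + φ y)) m := by fun_prop
  refine ⟨hdom.mono' hD ?_, ?_⟩
  · filter_upwards [hpt] with y hy
    rwa [Real.norm_eq_abs, abs_of_nonneg (hD0 y)]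
  · have hD' : Integrable D m := hdom.mono' hD (by
      filter_upwards [hpt] with y hy
      rwa [Real.norm_eq_abs, abs_of_nonneg (hD0 y)])
    calc ∫ y, D y ∂m ≤ ∫ y, (l + l ^ (1 - P) * (1 + φ y)) ∂m := integral_mono_ae hD' hdom hpt
      _ = l * V + l ^ (1 - P) * (V + ∫ y, φ y ∂m) := by
        rw [integral_add (integrable_const _) (by fun_prop), integral_const, integral_const_mul,
          integral_add (integrable_const _) hφ, integral_const]
        simp [V, mul_comm]
      _ ≤ l * V + l ^ (1 - P) * (V + K) := by gcongr
      _ = l * V + l ^ (1 - P) * (1 + K / V) * V := by field_simp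
      _ = _ := by rw [hlP1]; ring

/-- The volume of the unit ball. -/
def unitVol (N : ℕ) : ℝ := volume.real (Metric.ball (0 : RN N) 1)

theorem unitVol_pos : 0 < unitVol N :=
  ENNReal.toReal_pos (Metric.measure_ball_pos _ _ one_pos).ne' measure_ball_lt_top.ne

theorem volume_ball (x : RN N) {t : ℝ} (ht : 0 < t) :
    volume.real (Metric.ball x t) = t ^ N * unitVol N := by
  unfold unitVol Measure.real
  rw [Measure.addHaar_ball_of_pos _ _ ht, ENNReal.toReal_mul, finrank_euclideanSpace_fin,
    ENNReal.toReal_ofReal (by positivity)]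

section

variable {s p : RN N → RN N → ℝ} {s0 s1 p1 p2 : ℝ} {u : RN N → ℝ}

theorem Exponents.integrable_gdens_right (h : Exponents s p s0 s1 p1 p2) (hu : Measurable u)
    {x : RN N} (hx : gfun s p u x < ⊤) :
    Integrable (fun y => gdens s p u (x, y)) ∧
      ∫ y, gdens s p u (x, y) = (gfun s p u x).toReal := by
  have hm : Measurable fun y => gdens s p u (x, y) :=
    (h.measurable_gdens hu).comp measurable_prodMk_left
  refine ⟨⟨hm.aestronglyMeasurable, ?_⟩, ?_⟩
  · rwa [hasFiniteIntegral_iff_ofReal (.of_forall fun y => gdens_nonneg _)]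
  · rw [integral_eq_lintegral_of_nonneg_ae (.of_forall fun y => gdens_nonneg _)
      hm.aestronglyMeasurable]
    rfl

theorem rpow_le_one_add_rpow {a b c : ℝ} (ha : 0 ≤ a) (hb : 0 ≤ b) (hbc : b ≤ c) :
    a ^ b ≤ 1 + a ^ c := by
  rcases le_total a 1 with h | h
  · linarith [Real.rpow_le_one ha h hb, Real.rpow_nonneg ha c]
  · linarith [Real.rpow_le_rpow_of_exponent_le h hbc]

theorem Exponents.mean_osc_le (h : Exponents s p s0 s1 p1 p2) (hu : Measurable u) {x : RN N}
    (hx : gfun s p u x < ⊤) {t S P : ℝ} (ht : 0 < t) (ht1 : t ≤ 1) (hP : 1 ≤ P)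
    (hPp : ∀ y ∈ Metric.ball x t, P ≤ p x y) (hSs : ∀ y ∈ Metric.ball x t, S ≤ s x y) :
    IntegrableOn (fun y => |u x - u y|) (Metric.ball x t) ∧
    ∫ y in Metric.ball x t, |u x - u y| ≤ volume.real (Metric.ball x t) *
      (t ^ S * (2 * (1 + (gfun s p u x).toReal / unitVol N) ^ (1 / P))) := by
  obtain ⟨hgi, hge⟩ := h.integrable_gdens_right hu hx
  have hV := volume_ball x ht
  have hV0 : 0 < volume.real (Metric.ball x t) := by rw [hV]; have := unitVol_pos (N := N); positivity
  have : IsFiniteMeasure (volume.restrict (Metric.ball x t)) :=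
    ⟨by simpa using measure_ball_lt_top⟩
  have hVr : (volume.restrict (Metric.ball x t)).real univ = volume.real (Metric.ball x t) := by
    simp [Measure.real]
  have key := integral_le_of_rpow_le (m := volume.restrict (Metric.ball x t)) (P := P)
    (D := fun y => t ^ (-S) * |u x - u y|) (φ := fun y => t ^ N * gdens s p u (x, y))
    (K := t ^ N * (gfun s p u x).toReal) (by rwa [hVr]) hP (fun y => by positivity)
    (by fun_prop) ((hgi.const_mul _).restrict) (fun y => mul_nonneg (by positivity) (gdens_nonneg _))
    ?_ ?_
  · rw [hVr, hV] at key
    have h2 : t ^ N * (gfun s p u x).toReal / (t ^ N * unitVol N)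
        = (gfun s p u x).toReal / unitVol N := by
      have := unitVol_pos (N := N); field_simp
    rw [h2, integral_const_mul] at key
    have h3 : t ^ S * t ^ (-S) = 1 := by rw [← Real.rpow_add ht]; simp
    refine ⟨?_, ?_⟩
    · have := key.1.const_mul (t ^ S)
      unfold IntegrableOn
      simpa only [← mul_assoc, h3, one_mul] using this
    · have := mul_le_mul_of_nonneg_left key.2 (Real.rpow_nonneg ht.le S)
      rw [← mul_assoc, h3, one_mul] at this
      rw [hV]
      linarith
  · refine (ae_restrict_iff' measurableSet_ball).2 (.of_forall fun y hy => ?_)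
    rcases eq_or_ne y x with rfl | hne
    · simp only [sub_self, abs_zero, mul_zero]
      rw [Real.zero_rpow (by linarith)]
      have := gdens_nonneg (s := s) (p := p) (u := u) (y, y)
      positivity
    have hd : 0 < dist x y := dist_pos.2 hne.symm
    have hdt : dist x y ≤ t := by rw [dist_comm]; exact (Metric.mem_ball.1 hy).le
    have hle : t ^ (-S) ≤ dist x y ^ (-s x y) := by
      calc t ^ (-S) ≤ t ^ (-s x y) :=
            Real.rpow_le_rpow_of_exponent_ge ht ht1 (neg_le_neg (hSs y hy))
        _ ≤ _ := Real.rpow_le_rpow_of_nonpos hd hdt (by linarith [h.s_pos x y])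
    calc (t ^ (-S) * |u x - u y|) ^ P ≤ (dist x y ^ (-s x y) * |u x - u y|) ^ P := by gcongr
      _ ≤ 1 + (dist x y ^ (-s x y) * |u x - u y|) ^ p x y :=
          rpow_le_one_add_rpow (by positivity) (by linarith) (hPp y hy)
      _ = 1 + dist x y ^ N * gdens s p u (x, y) := by
          rw [Real.mul_rpow (by positivity) (by positivity), ← Real.rpow_mul hd.le]
          unfold gdens kern
          simp only
          rw [Real.rpow_add hd, Real.rpow_natCast, neg_mul, Real.rpow_neg hd.le, mul_inv]
          field_simp
      _ ≤ _ := by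
          have := gdens_nonneg (s := s) (p := p) (u := u) (x, y)
          gcongr
  · rw [integral_const_mul]
    gcongr
    rw [← hge]
    exact setIntegral_le_integral hgi (.of_forall fun y => gdens_nonneg _)

end

section

variable {Ω : Set (RN N)} {s p : RN N → RN N → ℝ} {s0 s1 p1 p2 : ℝ} {u : RN N → ℝ}

theorem mean_abs_le (hu : Measurable u) {γ : RN N → ℝ} {A : ℝ}
    (hγ : Integrable (fun y => |u y| ^ γ y)) (hA : ∫ y, |u y| ^ γ y ≤ A) (x : RN N)
    {t g : ℝ} (ht : 0 < t) (ht1 : t ≤ 1) (hg : 1 ≤ g)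
    (hgγ : ∀ y ∈ Metric.ball x t, g ≤ γ y) :
    IntegrableOn (fun y => |u y|) (Metric.ball x t) ∧
    ∫ y in Metric.ball x t, |u y| ≤ volume.real (Metric.ball x t) *
      (2 * (t ^ (-(N : ℝ) / g) * (1 + A / unitVol N))) := by
  have hV := volume_ball x ht
  have hc := unitVol_pos (N := N)
  have hA0 : 0 ≤ A := (integral_nonneg fun y => by positivity).trans hA
  have hV0 : 0 < volume.real (Metric.ball x t) := by rw [hV]; positivity
  have : IsFiniteMeasure (volume.restrict (Metric.ball x t)) :=
    ⟨by simpa using measure_ball_lt_top⟩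
  have hVr : (volume.restrict (Metric.ball x t)).real univ = volume.real (Metric.ball x t) := by
    simp [Measure.real]
  have key := integral_le_of_rpow_le (m := volume.restrict (Metric.ball x t)) (P := g)
    (D := fun y => |u y|) (φ := fun y => |u y| ^ γ y) (K := A) (by rwa [hVr]) hg
    (fun y => by positivity) (by fun_prop) hγ.restrict (fun y => by positivity)
    ((ae_restrict_iff' measurableSet_ball).2 (.of_forall fun y hy =>
      rpow_le_one_add_rpow (abs_nonneg _) (by linarith) (hgγ y hy)))
    ((setIntegral_le_integral hγ (.of_forall fun y => by positivity)).trans hA)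
  refine ⟨key.1, key.2.trans ?_⟩
  rw [hVr]
  gcongr
  have htN : 1 ≤ (t ^ N)⁻¹ := (one_le_inv₀ (by positivity)).2 (pow_le_one₀ ht.le ht1)
  calc (1 + A / volume.real (Metric.ball x t)) ^ (1 / g)
      ≤ ((t ^ N)⁻¹ * (1 + A / unitVol N)) ^ (1 / g) := by
        rw [hV]
        refine Real.rpow_le_rpow (by positivity) ?_ (by positivity)
        rw [mul_add, mul_one]
        have : A / (t ^ N * unitVol N) = (t ^ N)⁻¹ * (A / unitVol N) := by field_simp
        linarith
    _ = t ^ (-(N : ℝ) / g) * (1 + A / unitVol N) ^ (1 / g) := by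
        rw [Real.mul_rpow (by positivity) (by positivity), ← Real.rpow_natCast,
          ← Real.rpow_neg ht.le, ← Real.rpow_mul ht.le]
        congr 2
        ring
    _ ≤ t ^ (-(N : ℝ) / g) * (1 + A / unitVol N) := by
        gcongr
        have h1 : 1 ≤ 1 + A / unitVol N := by
          have : 0 ≤ A / unitVol N := by positivity
          linarith
        calc (1 + A / unitVol N) ^ (1 / g) ≤ (1 + A / unitVol N) ^ (1 : ℝ) :=
              Real.rpow_le_rpow_of_exponent_le h1 ((div_le_one (by linarith)).2 hg)
          _ = _ := Real.rpow_one _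

/-- Pointwise interpolation between the Gagliardo energy at `x` and an integral bound. -/
theorem Exponents.abs_rpow_le (h : Exponents s p s0 s1 p1 p2) (hu : Measurable u) {x : RN N}
    (hx : gfun s p u x < ⊤) {γ : RN N → ℝ} {A : ℝ}
    (hγ : Integrable (fun y => |u y| ^ γ y)) (hA : ∫ y, |u y| ^ γ y ≤ A)
    {δ S P g : ℝ} (hδ : 0 < δ) (hδ1 : δ ≤ 1) (hS : 0 < S) (hP : 1 ≤ P) (hg : 1 ≤ g)
    (hPp : ∀ y ∈ Metric.ball x δ, P ≤ p x y) (hSs : ∀ y ∈ Metric.ball x δ, S ≤ s x y)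
    (hgγ : ∀ y ∈ Metric.ball x δ, g ≤ γ y) :
    |u x| ^ (P * (1 + S * g / N)) ≤
      (2 + 2 * (δ ^ (-(N : ℝ)) * (1 + A / unitVol N))) ^ (P * (1 + S * g / N)) *
        (1 + (gfun s p u x).toReal / unitVol N) := by
  have hc := unitVol_pos (N := N)
  have hN := h.dim_pos'
  have hA0 : 0 ≤ A := (integral_nonneg fun y => by positivity).trans hA
  set G := 1 + (gfun s p u x).toReal / unitVol N with hG
  have hG1 : 1 ≤ G := by
    have : 0 ≤ (gfun s p u x).toReal / unitVol N := by positivity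
    linarith
  have hG0 : 0 < G := by linarith
  set H := G ^ (1 / P) with hH
  have hH1 : 1 ≤ H := Real.one_le_rpow hG1 (by positivity)
  have hH0 : 0 < H := by linarith
  set e := S + N / g with he
  have hNg : 0 < N / g := by positivity
  have he0 : 0 < e := by positivity
  set t := δ * H ^ (-1 / e) with htdef
  have ht : 0 < t := by positivity
  have htδ : t ≤ δ := by
    have : H ^ (-1 / e) ≤ 1 := Real.rpow_le_one_of_one_le_of_nonpos hH1
      (div_nonpos_of_nonpos_of_nonneg (by norm_num) he0.le)
    exact mul_le_of_le_one_right hδ.le this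
  have hsub : Metric.ball x t ⊆ Metric.ball x δ := Metric.ball_subset_ball htδ
  obtain ⟨i1, k1⟩ := h.mean_osc_le hu hx ht (htδ.trans hδ1) hP (fun y hy => hPp y (hsub hy))
    (fun y hy => hSs y (hsub hy))
  obtain ⟨i2, k2⟩ := mean_abs_le hu hγ hA x ht (htδ.trans hδ1) hg (fun y hy => hgγ y (hsub hy))
  have hV0 : 0 < volume.real (Metric.ball x t) := by rw [volume_ball x ht]; positivity
  have hux : |u x| ≤ t ^ S * (2 * H) + 2 * (t ^ (-(N : ℝ) / g) * (1 + A / unitVol N)) := by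
    have h1 : volume.real (Metric.ball x t) * |u x| ≤
        ∫ y in Metric.ball x t, (|u x - u y| + |u y|) := by
      rw [← smul_eq_mul, ← setIntegral_const]
      refine setIntegral_mono (integrableOn_const measure_ball_lt_top.ne) (i1.add i2) fun y => ?_
      calc |u x| = |(u x - u y) + u y| := by ring_nf
        _ ≤ _ := abs_add_le _ _
    rw [integral_add i1 i2] at h1
    refine le_of_mul_le_mul_left (h1.trans ((add_le_add k1 k2).trans_eq ?_)) hV0
    ring
  set θ := N / g / e with hθ
  have e1 : t ^ S * H ≤ H ^ θ := by
    calc t ^ S * H = δ ^ S * (H ^ (-1 / e * S) * H ^ (1 : ℝ)) := by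
          rw [htdef, Real.mul_rpow hδ.le (by positivity), ← Real.rpow_mul hH0.le, Real.rpow_one]
          ring
      _ = δ ^ S * H ^ θ := by
          rw [← Real.rpow_add hH0]
          congr 2
          rw [hθ, he]; field_simp; ring
      _ ≤ 1 * H ^ θ := by
          gcongr
          exact Real.rpow_le_one hδ.le hδ1 hS.le
      _ = _ := one_mul _
  have e2 : t ^ (-(N : ℝ) / g) ≤ δ ^ (-(N : ℝ)) * H ^ θ := by
    rw [htdef, Real.mul_rpow hδ.le (by positivity), ← Real.rpow_mul hH0.le]
    have : -1 / e * (-(N : ℝ) / g) = θ := by rw [hθ]; field_simp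
    rw [this]
    refine mul_le_mul_of_nonneg_right (Real.rpow_le_rpow_of_exponent_ge hδ hδ1 ?_) (by positivity)
    rw [neg_div]
    exact neg_le_neg (div_le_self hN.le hg)
  have hfin : |u x| ≤ (2 + 2 * (δ ^ (-(N : ℝ)) * (1 + A / unitVol N))) * H ^ θ := by
    have hAc : 0 ≤ 1 + A / unitVol N := by positivity
    calc |u x| ≤ _ := hux
      _ = 2 * (t ^ S * H) + 2 * (t ^ (-(N : ℝ) / g) * (1 + A / unitVol N)) := by ring
      _ ≤ 2 * H ^ θ + 2 * ((δ ^ (-(N : ℝ)) * H ^ θ) * (1 + A / unitVol N)) := by gcongr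
      _ = _ := by ring
  have hexp : H ^ θ = G ^ (1 / (P * (1 + S * g / N))) := by
    rw [hH, ← Real.rpow_mul hG0.le]
    congr 1
    rw [hθ, he]; field_simp; ring
  calc |u x| ^ (P * (1 + S * g / N))
      ≤ ((2 + 2 * (δ ^ (-(N : ℝ)) * (1 + A / unitVol N))) * H ^ θ) ^ (P * (1 + S * g / N)) :=
        Real.rpow_le_rpow (abs_nonneg _) hfin (by positivity)
    _ = _ := by
        rw [Real.mul_rpow (by positivity) (by positivity), hexp, ← Real.rpow_mul hG0.le,
          one_div_mul_cancel (by positivity), Real.rpow_one]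

theorem exists_uniform_lower {H : RN N → RN N → ℝ}
    (hH : Continuous fun z : RN N × RN N => H z.1 z.2) (hΩ : Bornology.IsBounded Ω) {ε : ℝ}
    (hε : 0 < ε) : ∃ δ, 0 < δ ∧ δ ≤ 1 ∧ ∀ x ∈ Ω, ∀ y ∈ Metric.ball x δ, H x x - ε ≤ H x y := by
  obtain ⟨R, hR⟩ := hΩ.subset_closedBall (0 : RN N)
  have hK : IsCompact (Metric.closedBall (0 : RN N) (R + 1) ×ˢ Metric.closedBall (0 : RN N) (R + 1)) :=
    (isCompact_closedBall _ _).prod (isCompact_closedBall _ _)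
  obtain ⟨δ, hδ, h⟩ := Metric.uniformContinuousOn_iff.1
    (hK.uniformContinuousOn_of_continuous hH.continuousOn) ε hε
  refine ⟨min δ 1, by positivity, min_le_right _ _, fun x hx y hy => ?_⟩
  have hxR : dist x 0 ≤ R := hR hx
  have hyx : dist y x < min δ 1 := hy
  have hy1 : dist y x < 1 := hyx.trans_le (min_le_right _ _)
  have hyR : dist y 0 ≤ R + 1 := by linarith [dist_triangle y x 0]
  have := h (x, x) ⟨by simpa using hxR.trans (by linarith), by simpa using hxR.trans (by linarith)⟩
    (x, y) ⟨by simpa using hxR.trans (by linarith), by simpa using hyR⟩ (by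
      rw [Prod.dist_eq, dist_self, dist_comm]
      exact max_lt hδ (hyx.trans_le (min_le_left _ _)))
  rw [Real.dist_eq] at this
  simp only at this
  linarith [(abs_lt.1 this).2]

theorem setIntegral_one_add (hΩ : volume Ω ≠ ⊤) {φ : RN N → ℝ} (hφ : IntegrableOn φ Ω) :
    ∫ x in Ω, (1 + φ x) = volume.real Ω + ∫ x in Ω, φ x := by
  have h1 : Integrable (fun _ : RN N => (1 : ℝ)) (volume.restrict Ω) := integrableOn_const hΩ
  rw [integral_add h1 hφ]
  simp

/-- `∫_Ω |u|^γ` is bounded on sets of bounded Gagliardo modular. -/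
def PowerBounded (Ω : Set (RN N)) (s p : RN N → RN N → ℝ) (γ : RN N → ℝ) : Prop :=
  ∀ R : ℝ, ∃ C : ℝ, ∀ u : RN N → ℝ, FinMod Ω s p u → gmod s p u ≤ ENNReal.ofReal R →
    IntegrableOn (fun x => |u x| ^ γ x) Ω ∧ ∫ x in Ω, |u x| ^ γ x ≤ C

theorem Exponents.gfun_facts (h : Exponents s p s0 s1 p1 p2) (hu : FinMod Ω s p u) :
    (∀ᵐ x, gfun s p u x < ⊤) ∧ Integrable (fun x => (gfun s p u x).toReal) ∧
      ∫ x, (gfun s p u x).toReal = (gmod s p u).toReal := by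
  have hm := h.measurable_gfun hu.meas
  have hfin : ∫⁻ x, gfun s p u x ≠ ⊤ := by
    rw [← h.gmod_eq hu.meas]; exact hu.fin.ne
  have hae := ae_lt_top hm hfin
  exact ⟨hae, integrable_toReal_of_lintegral_ne_top hm.aemeasurable hfin,
    by rw [integral_toReal hm.aemeasurable hae, h.gmod_eq hu.meas]⟩

theorem Exponents.powerBounded_of_pointwise (h : Exponents s p s0 s1 p1 p2) (hΩm : MeasurableSet Ω)
    (hΩ : Bornology.IsBounded Ω) {γ : RN N → ℝ} (hγ : Measurable γ)
    (hpt : ∀ R : ℝ, ∃ C : ℝ, 0 ≤ C ∧ ∀ u : RN N → ℝ, FinMod Ω s p u → gmod s p u ≤ ENNReal.ofReal R →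
      ∀ x ∈ Ω, gfun s p u x < ⊤ → |u x| ^ γ x ≤ C * (1 + (gfun s p u x).toReal)) :
    PowerBounded Ω s p γ := by
  intro R
  obtain ⟨C, hC, hb⟩ := hpt R
  refine ⟨C * (volume.real Ω + max R 0), fun u hu hR => ?_⟩
  obtain ⟨hae, hgi, hge⟩ := h.gfun_facts hu
  have hΩf : volume Ω ≠ ⊤ := hΩ.measure_lt_top.ne
  have hle : ∀ᵐ x ∂(volume.restrict Ω), |u x| ^ γ x ≤ C * (1 + (gfun s p u x).toReal) := by
    rw [ae_restrict_iff' hΩm]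
    filter_upwards [hae] with x hx hxΩ using hb u hu hR x hxΩ hx
  have hI : IntegrableOn (fun x => C * (1 + (gfun s p u x).toReal)) Ω :=
    ((integrableOn_const hΩf).add hgi.integrableOn).const_mul C
  have hI' : IntegrableOn (fun x => |u x| ^ γ x) Ω := by
    have := hu.meas
    have hm : Measurable fun x => |u x| ^ γ x := by fun_prop
    refine hI.mono' hm.aestronglyMeasurable ?_
    filter_upwards [hle] with x hx
    rwa [Real.norm_eq_abs, abs_of_nonneg (by positivity)]
  refine ⟨hI', ?_⟩
  calc ∫ x in Ω, |u x| ^ γ x ≤ ∫ x in Ω, C * (1 + (gfun s p u x).toReal) :=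
        integral_mono_ae hI' hI hle
    _ = C * (volume.real Ω + ∫ x in Ω, (gfun s p u x).toReal) := by
        rw [integral_const_mul, setIntegral_one_add hΩf hgi.integrableOn]
    _ ≤ _ := by
        gcongr
        refine (setIntegral_le_integral hgi (.of_forall fun x => ENNReal.toReal_nonneg)).trans ?_
        rw [hge, ← ENNReal.toReal_ofReal' ]
        exact ENNReal.toReal_mono ENNReal.ofReal_ne_top hR

theorem PowerBounded.mono {γ γ' : RN N → ℝ} (h : PowerBounded Ω s p γ') (hΩm : MeasurableSet Ω)
    (hΩ : Bornology.IsBounded Ω) (hγ : Measurable γ)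
    (h0 : ∀ x ∈ Ω, 0 ≤ γ x) (hle : ∀ x ∈ Ω, γ x ≤ γ' x) : PowerBounded Ω s p γ := by
  intro R
  obtain ⟨C, hC⟩ := h R
  have hΩf : volume Ω ≠ ⊤ := hΩ.measure_lt_top.ne
  refine ⟨volume.real Ω + C, fun u hu hR => ?_⟩
  obtain ⟨hi, hb⟩ := hC u hu hR
  have hpt : ∀ x ∈ Ω, |u x| ^ γ x ≤ 1 + |u x| ^ γ' x := fun x hx =>
    rpow_le_one_add_rpow (abs_nonneg _) (h0 x hx) (hle x hx)
  have hI : IntegrableOn (fun x => 1 + |u x| ^ γ' x) Ω := (integrableOn_const hΩf).add hi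
  have hI' : IntegrableOn (fun x => |u x| ^ γ x) Ω := by
    have := hu.meas
    have hm : Measurable fun x => |u x| ^ γ x := by fun_prop
    refine hI.mono' hm.aestronglyMeasurable ?_
    filter_upwards [ae_restrict_mem hΩm] with x hx
    rw [Real.norm_eq_abs, abs_of_nonneg (by positivity)]
    exact hpt x hx
  refine ⟨hI', (setIntegral_mono_on hI' hI hΩm hpt).trans ?_⟩
  rw [setIntegral_one_add hΩf hi]
  gcongr

end

section

variable {Ω : Set (RN N)} {s p : RN N → RN N → ℝ} {s0 s1 p1 p2 : ℝ} {u : RN N → ℝ}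

theorem Exponents.powerBounded_one (h : Exponents s p s0 s1 p1 p2) (hΩm : MeasurableSet Ω)
    (hΩ : Bornology.IsBounded Ω) : PowerBounded Ω s p (fun _ => 1) := by
  refine h.powerBounded_of_pointwise hΩm hΩ measurable_const fun R => ?_
  have : Nonempty (Fin N) := ⟨⟨0, h.dim_pos⟩⟩
  obtain ⟨R₀, hR₀⟩ := hΩ.subset_closedBall (0 : RN N)
  obtain ⟨z, hz⟩ := exists_norm_eq (RN N) (c := max R₀ 0 + 2) (by positivity)
  set E := Metric.ball z 1
  set D := 2 * max R₀ 0 + 3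
  have hD : 1 ≤ D := by have := le_max_right R₀ 0; simp only [D]; linarith
  set K := D ^ ((N : ℝ) + N)
  have hV : 0 < volume.real E := by rw [volume_ball z one_pos]; simpa using unitVol_pos
  refine ⟨1 + K / volume.real E, by positivity, fun u hu hR x hx hG => ?_⟩
  obtain ⟨hgi, hge⟩ := h.integrable_gdens_right hu.meas hG
  have hpt : ∀ᵐ y ∂(volume.restrict E), |u x| ≤ 1 + K * gdens s p u (x, y) := by
    rw [ae_restrict_iff' measurableSet_ball]
    filter_upwards [hu.zero] with y hy0 hy
    have hx0 : ‖x‖ ≤ max R₀ 0 := by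
      have := hR₀ hx
      rw [mem_closedBall_zero_iff] at this
      exact this.trans (le_max_left _ _)
    have hyz : ‖y - z‖ < 1 := by rw [← dist_eq_norm]; exact hy
    have hyl : max R₀ 0 + 1 < ‖y‖ := by
      have := norm_sub_norm_le z y
      rw [norm_sub_rev] at this
      linarith
    have hyu : ‖y‖ < max R₀ 0 + 3 := by
      have := norm_sub_norm_le y z
      linarith
    have hyΩ : y ∉ Ω := fun hyΩ => by
      have := hR₀ hyΩ
      rw [mem_closedBall_zero_iff] at this
      linarith [le_max_left R₀ 0]
    have hd0 : 0 < dist x y := by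
      refine dist_pos.2 ?_
      rintro rfl
      exact hyΩ hx
    have hdD : dist x y ≤ D := by
      rw [dist_eq_norm]
      have := norm_sub_le x y
      simp only [D]; linarith
    have hdK : dist x y ^ ((N : ℝ) + s x y * p x y) ≤ K := by
      refine (Real.rpow_le_rpow hd0.le hdD (h.exponent_pos x y).le).trans ?_
      refine Real.rpow_le_rpow_of_exponent_le hD ?_
      linarith [h.sp_le x y, h.sub]
    have hk : 1 ≤ K * kern s p (x, y) := by
      unfold kern
      rw [← div_eq_mul_inv, one_le_div (by positivity)]
      exact hdK
    calc |u x| = |u x| ^ (1 : ℝ) := (Real.rpow_one _).symm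
      _ ≤ 1 + |u x| ^ p x y := rpow_le_one_add_rpow (abs_nonneg _) zero_le_one (h.p_gt x y).le
      _ ≤ 1 + |u x| ^ p x y * (K * kern s p (x, y)) := by
          gcongr
          exact le_mul_of_one_le_right (by positivity) hk
      _ = _ := by
          unfold gdens
          simp only [hy0 hyΩ, sub_zero]
          ring
  have hEf : volume E ≠ ⊤ := measure_ball_lt_top.ne
  have hI : Integrable (fun y => K * gdens s p u (x, y)) := hgi.const_mul K
  have h1 : volume.real E * |u x| ≤ volume.real E + K * (gfun s p u x).toReal := by
    calc volume.real E * |u x| = ∫ y in E, |u x| := by simp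
      _ ≤ ∫ y in E, (1 + K * gdens s p u (x, y)) :=
        integral_mono_ae (integrableOn_const hEf)
          ((integrableOn_const hEf (C := (1 : ℝ))).add hI.integrableOn) hpt
      _ = volume.real E + ∫ y in E, K * gdens s p u (x, y) :=
        setIntegral_one_add hEf hI.integrableOn
      _ ≤ volume.real E + K * (gfun s p u x).toReal := by
        rw [integral_const_mul, ← hge]
        have := setIntegral_le_integral (s := E) hgi (.of_forall fun y => gdens_nonneg (x, y))
        gcongr
  simp only [Real.rpow_one]
  have hG0 : 0 ≤ (gfun s p u x).toReal := ENNReal.toReal_nonneg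
  have h2 : |u x| ≤ 1 + K / volume.real E * (gfun s p u x).toReal := by
    refine le_of_mul_le_mul_left (h1.trans_eq ?_) hV
    field_simp
  have h3 : 0 ≤ K / volume.real E := by positivity
  nlinarith

set_option maxHeartbeats 1000000 in
theorem Exponents.powerBounded_step (h : Exponents s p s0 s1 p1 p2) (hΩm : MeasurableSet Ω)
    (hΩ : Bornology.IsBounded Ω) {γ γ' : RN N → ℝ} {Γ η : ℝ} (hγ : Continuous γ)
    (hγ' : Measurable γ') (h1 : ∀ x, 1 ≤ γ x) (hΓ : ∀ x, γ x ≤ Γ) (hη : 0 < η)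
    (h0 : ∀ x ∈ Ω, 0 ≤ γ' x) (hle : ∀ x ∈ Ω, γ' x + η ≤ p x x * (1 + s x x * γ x / N))
    (hb : PowerBounded Ω s p γ) : PowerBounded Ω s p γ' := by
  have hN := h.dim_pos'
  have hN1 := h.one_le_dim
  have hc := unitVol_pos (N := N)
  have hΓ1 : 1 ≤ Γ := (h1 0).trans (hΓ 0)
  have hp2 := h.p2_gt
  set ε := min (min (s0 / 2) ((p1 - 1) / 2)) (η / ((1 + Γ) * (1 + p2))) with hε
  have hp1 := h.p1_gt
  have hs0 := h.s0_pos
  have hε0 : 0 < ε := by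
    have : 0 < p1 - 1 := by linarith
    positivity
  have hεs : ε ≤ s0 / 2 := (min_le_left _ _).trans (min_le_left _ _)
  have hεp : ε ≤ (p1 - 1) / 2 := (min_le_left _ _).trans (min_le_right _ _)
  have hεη : ε * ((1 + Γ) * (1 + p2)) ≤ η := by
    rw [← le_div_iff₀ (by positivity)]; exact min_le_right _ _
  obtain ⟨δ₁, hδ₁, hδ₁1, hP⟩ := exists_uniform_lower h.p_cont hΩ hε0
  obtain ⟨δ₂, hδ₂, hδ₂1, hS⟩ := exists_uniform_lower h.s_cont hΩ hε0
  obtain ⟨δ₃, hδ₃, hδ₃1, hg⟩ := exists_uniform_lower (H := fun _ y => γ y)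
    (hγ.comp continuous_snd) hΩ hε0
  set δ := min δ₁ (min δ₂ δ₃)
  have hδ : 0 < δ := by positivity
  have hδ1 : δ ≤ 1 := (min_le_left _ _).trans hδ₁1
  refine h.powerBounded_of_pointwise hΩm hΩ hγ' fun R => ?_
  obtain ⟨A, hA⟩ := hb R
  set A' := max A 0
  set B := 2 + 2 * (δ ^ (-(N : ℝ)) * (1 + A' / unitVol N)) with hB
  have hB1 : 1 ≤ B := by
    have : 0 ≤ δ ^ (-(N : ℝ)) * (1 + A' / unitVol N) := by positivity
    linarith
  set B' := B ^ (p2 * (1 + Γ))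
  have hB'0 : 0 < B' := by positivity
  refine ⟨1 + B' * (1 + 1 / unitVol N), by positivity, fun u hu hR x hx hG => ?_⟩
  obtain ⟨hi, hiA⟩ := hA u hu hR
  have hz : ∀ᵐ y, y ∉ Ω → |u y| ^ γ y = 0 := by
    filter_upwards [hu.zero] with y hy hyΩ
    rw [hy hyΩ, abs_zero, Real.zero_rpow (by linarith [h1 y])]
  have hI : Integrable (fun y => |u y| ^ γ y) := hi.integrable_of_ae_notMem_eq_zero hz
  have hIA : ∫ y, |u y| ^ γ y ≤ A' := by
    rw [← setIntegral_eq_integral_of_ae_compl_eq_zero hz]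
    exact hiA.trans (le_max_left _ _)
  have hsx := h.s0_le x x
  have hsx1 := (h.le_s1 x x).trans h.s1_lt.le
  have hpx := h.p1_le x x
  have hpx2 := h.le_p2 x x
  set g := max 1 (γ x - ε) with hgdef
  have hg1 : 1 ≤ g := le_max_left _ _
  have hgγ : g ≤ γ x := max_le (h1 x) (by linarith)
  have hgΓ : g ≤ Γ := hgγ.trans (hΓ x)
  have key := h.abs_rpow_le hu.meas hG hI hIA hδ hδ1 (S := s x x - ε) (P := p x x - ε) (g := g)
    (by linarith) (by linarith) hg1
    (fun y hy => hP x hx y (Metric.ball_subset_ball (min_le_left _ _) hy))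
    (fun y hy => hS x hx y (Metric.ball_subset_ball
      ((min_le_right _ _).trans (min_le_left _ _)) hy))
    (fun y hy => max_le (h1 y) (hg x hx y (Metric.ball_subset_ball
      ((min_le_right _ _).trans (min_le_right _ _)) hy)))
  set e := (p x x - ε) * (1 + (s x x - ε) * g / N) with hedef
  have hsg0 : 0 ≤ (s x x - ε) * g / N := by
    have : 0 ≤ s x x - ε := by linarith
    positivity
  have hsgΓ : (s x x - ε) * g / N ≤ Γ := by
    calc (s x x - ε) * g / N ≤ (s x x - ε) * g :=
          div_le_self (mul_nonneg (by linarith) (by linarith)) hN1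
      _ ≤ 1 * Γ := mul_le_mul (by linarith) hgΓ (by linarith) one_pos.le
      _ = Γ := one_mul _
  have hepos : e ≤ p2 * (1 + Γ) :=
    mul_le_mul (by linarith) (by linarith) (by linarith) (by linarith)
  have hγe : γ' x ≤ e := by
    have hX : 1 + s x x * γ x / N ≤ 1 + Γ := by
      have : s x x * γ x / N ≤ 1 * Γ := by
        refine (div_le_self (mul_nonneg (by linarith) (by linarith [h1 x])) hN1).trans ?_
        exact mul_le_mul hsx1 (hΓ x) (by linarith [h1 x]) one_pos.le
      linarith
    have hX' : 1 + s x x * γ x / N - ε * (1 + Γ) ≤ 1 + (s x x - ε) * g / N := by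
      have h5 : s x x * γ x - (s x x - ε) * g ≤ ε * (1 + Γ) := by
        have : γ x - ε ≤ g := le_max_right _ _
        have h6 : s x x * (γ x - g) ≤ 1 * ε :=
          mul_le_mul hsx1 (by linarith) (by linarith) one_pos.le
        nlinarith
      have h6 : (s x x * γ x - (s x x - ε) * g) / N ≤ ε * (1 + Γ) := by
        rw [div_le_iff₀ hN]
        have : 0 ≤ ε * (1 + Γ) := by positivity
        nlinarith
      rw [sub_div] at h6
      linarith
    have h7 : p x x * (1 + s x x * γ x / N) - ε * (1 + Γ) * (1 + p2) ≤ e := by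
      have h8 : p x x * (1 + s x x * γ x / N - ε * (1 + Γ)) ≤ p x x * (1 + (s x x - ε) * g / N) :=
        mul_le_mul_of_nonneg_left hX' (by linarith)
      have h9 : ε * (1 + (s x x - ε) * g / N) ≤ ε * (1 + Γ) := by gcongr
      have h10 : p x x * (ε * (1 + Γ)) ≤ p2 * (ε * (1 + Γ)) :=
        mul_le_mul_of_nonneg_right hpx2 (by positivity)
      rw [hedef]
      linarith
    linarith [hle x hx]
  have hG0 : 0 ≤ (gfun s p u x).toReal := ENNReal.toReal_nonneg
  calc |u x| ^ γ' x ≤ 1 + |u x| ^ e := rpow_le_one_add_rpow (abs_nonneg _) (h0 x hx) hγe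
    _ ≤ 1 + B ^ e * (1 + (gfun s p u x).toReal / unitVol N) := by gcongr
    _ ≤ 1 + B' * (1 + (gfun s p u x).toReal / unitVol N) := by
        gcongr
        exact Real.rpow_le_rpow_of_exponent_le hB1 hepos
    _ ≤ _ := by
        have h11 : (0 : ℝ) < 1 / unitVol N := by positivity
        have h12 : (gfun s p u x).toReal / unitVol N = 1 / unitVol N * (gfun s p u x).toReal := by
          ring
        rw [h12]
        have h13 : 0 ≤ B' * (gfun s p u x).toReal := by positivity
        have h14 : 0 ≤ B' * (1 / unitVol N) := by positivity
        nlinarith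

theorem Exponents.pstar_facts (h : Exponents s p s0 s1 p1 p2) :
    Continuous (pstar s p) ∧ (∀ x, 1 < pstar s p x) ∧
      ∀ x, pstar s p x ≤ N * p2 / (N - s1 * p2) := by
  have hN := h.dim_pos'
  have hpos : ∀ x, 0 < (N : ℝ) - s x x * p x x := fun x => by linarith [h.sp_le x x, h.sub]
  have hsc : Continuous fun x => s x x := h.s_cont.comp (continuous_id.prodMk continuous_id)
  have hpc : Continuous fun x => p x x := h.p_cont.comp (continuous_id.prodMk continuous_id)
  refine ⟨?_, fun x => ?_, fun x => ?_⟩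
  · unfold pstar
    exact (continuous_const.mul hpc).div (continuous_const.sub (hsc.mul hpc)) fun x => (hpos x).ne'
  · unfold pstar
    rw [lt_div_iff₀ (hpos x)]
    have := mul_pos (h.s_pos x x) (h.p_pos x x)
    nlinarith [h.p_gt x x]
  · unfold pstar
    have := h.sub
    have := h.p_pos x x
    exact div_le_div₀ (by nlinarith [h.p2_gt]) (by nlinarith [h.le_p2 x x]) (by linarith)
      (by linarith [h.sp_le x x])

/-- Subcritical fractional Sobolev embedding with variable exponents. -/
theorem Exponents.powerBounded_subcritical (h : Exponents s p s0 s1 p1 p2) (hΩm : MeasurableSet Ω)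
    (hΩ : Bornology.IsBounded Ω) {γ : RN N → ℝ} (hγ : Measurable γ) {l : ℝ} (hl : l < 1)
    (h0 : ∀ x ∈ Ω, 0 ≤ γ x) (hle : ∀ x ∈ Ω, γ x ≤ l * pstar s p x) : PowerBounded Ω s p γ := by
  obtain ⟨hpsc, hps1, hps2⟩ := h.pstar_facts
  have hN := h.dim_pos'
  have hsub := h.sub
  have hp2 := h.p2_gt
  set κm := s1 * p2 / N with hκm
  have hκm1 : κm < 1 := by rw [hκm, div_lt_one hN]; exact hsub
  have hκm0 : 0 < κm := by
    have : 0 < s1 := (h.s_pos 0 0).trans_le (h.le_s1 0 0)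
    positivity
  set κ := (1 + κm) / 2 with hκ
  have hκ0 : 0 < κ := by positivity
  have hκ1 : κ < 1 := by linarith
  have hiter : ∀ k : ℕ, PowerBounded Ω s p (fun x => max 1 ((1 - κ ^ k) * pstar s p x)) := by
    intro k
    induction k with
    | zero => simpa using h.powerBounded_one hΩm hΩ
    | succ k ih =>
      have hκk : 0 < κ ^ k := by positivity
      have hκk1 : κ ^ k ≤ 1 := pow_le_one₀ hκ0.le hκ1.le
      have hη1 : 0 < (κ - κm) * κ ^ k := mul_pos (by linarith) hκk
      have hp1 : 0 < p1 - 1 := by linarith [h.p1_gt]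
      refine h.powerBounded_step hΩm hΩ (Γ := max 1 (N * p2 / (N - s1 * p2)))
        (η := min (p1 - 1) ((κ - κm) * κ ^ k)) (by fun_prop)
        (by fun_prop) (fun x => le_max_left _ _) (fun x => ?_) (by positivity)
        (fun x _ => by positivity) (fun x _ => ?_) ih
      · refine max_le_max le_rfl ((mul_le_of_le_one_left ?_ ?_).trans (hps2 x))
        · linarith [hps1 x]
        · linarith
      · set m := max 1 ((1 - κ ^ k) * pstar s p x)
        have hsx := h.s_pos x x
        have hpx := h.p_pos x x
        rw [max_add]
        refine max_le ?_ ?_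
        · have h2 : 0 ≤ p x x * (s x x * m / N) := by positivity
          linarith [min_le_left (p1 - 1) ((κ - κm) * κ ^ k), h.p1_le x x]
        · have hps : pstar s p x * (N - s x x * p x x) = N * p x x := by
            unfold pstar
            rw [div_mul_cancel₀]
            linarith [h.sp_le x x]
          have hm : (1 - κ ^ k) * pstar s p x ≤ m := le_max_right _ _
          have hk : s x x * p x x / N ≤ κm := by
            rw [hκm]; exact div_le_div_of_nonneg_right (h.sp_le x x) hN.le
          have hps1x := hps1 x
          have hrw : p x x * (1 + s x x * ((1 - κ ^ k) * pstar s p x) / N)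
              = pstar s p x * (1 - s x x * p x x / N * κ ^ k) := by
            have : p x x = pstar s p x * (1 - s x x * p x x / N) := by
              field_simp; linarith
            calc _ = p x x + s x x * p x x / N * ((1 - κ ^ k) * pstar s p x) := by ring
              _ = pstar s p x * (1 - s x x * p x x / N)
                + s x x * p x x / N * ((1 - κ ^ k) * pstar s p x) := by rw [← this]
              _ = _ := by ring
          have hstep : p x x * (1 + s x x * ((1 - κ ^ k) * pstar s p x) / N)
              ≤ p x x * (1 + s x x * m / N) := by gcongr
          refine le_trans ?_ hstep
          rw [hrw, pow_succ]
          have h3 := min_le_right (p1 - 1) ((κ - κm) * κ ^ k)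
          have h4 : (κ - κm) * κ ^ k ≤ pstar s p x * ((κ - s x x * p x x / N) * κ ^ k) := by
            have : (κ - κm) * κ ^ k ≤ (κ - s x x * p x x / N) * κ ^ k := by gcongr
            nlinarith
          nlinarith
  obtain ⟨k, hk⟩ := exists_pow_lt_of_lt_one (show 0 < 1 - l by linarith) hκ1
  refine (hiter k).mono hΩm hΩ hγ h0 fun x hx => (hle x hx).trans (le_max_of_le_right ?_)
  exact mul_le_mul_of_nonneg_right (by linarith) (by linarith [hps1 x])

end

theorem totallyBounded_range_of_finite_data {X ι : Type*} [PseudoMetricSpace X] (U : ι → X)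
    (H : ∀ ε > 0, ∃ (κ : Type) (_ : Fintype κ) (a : ι → κ → ℝ), Bornology.IsBounded (range a) ∧
      ∃ δ > 0, ∀ i j, dist (a i) (a j) < δ → dist (U i) (U j) < ε) :
    TotallyBounded (range U) := by
  rw [Metric.totallyBounded_iff]
  intro ε hε
  obtain ⟨κ, _, a, hb, δ, hδ, h⟩ := H ε hε
  have ht : TotallyBounded (range a) :=
    hb.isCompact_closure.totallyBounded.subset subset_closure
  obtain ⟨t, hta, htf, htc⟩ := Metric.finite_approx_of_totallyBounded ht δ hδ
  choose g hg using fun y : t => hta y.2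
  have : Finite t := htf
  refine ⟨range fun y => U (g y), finite_range _, ?_⟩
  rintro _ ⟨i, rfl⟩
  obtain ⟨y, hy, hiy⟩ := mem_iUnion₂.1 (htc (mem_range_self i))
  refine mem_iUnion₂.2 ⟨_, mem_range_self (⟨y, hy⟩ : t), h _ _ ?_⟩
  rw [hg]
  exact hiy

section

variable {Ω : Set (RN N)} {s p : RN N → RN N → ℝ} {s0 s1 p1 p2 : ℝ} {u : RN N → ℝ}

theorem ae_prod_of_ae {P : RN N → Prop} (h : ∀ᵐ x, P x) :
    ∀ᵐ z : RN N × RN N, P z.1 ∧ P z.2 :=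
  (Measure.quasiMeasurePreserving_fst.ae h).and (Measure.quasiMeasurePreserving_snd.ae h)

theorem Exponents.tendsto_gdens (h : Exponents s p s0 s1 p1 p2) {u : ℕ → RN N → ℝ} {v : RN N → ℝ}
    (hlim : ∀ᵐ x, Tendsto (fun n => u n x) atTop (nhds (v x))) :
    ∀ᵐ z, Tendsto (fun n => gdens s p (u n) z) atTop (nhds (gdens s p v z)) := by
  filter_upwards [ae_prod_of_ae hlim] with z hz
  exact ((hz.1.sub hz.2).abs.rpow_const (.inr (h.p_pos _ _).le)).mul_const _

theorem Exponents.finMod_of_tendsto (h : Exponents s p s0 s1 p1 p2) {R : ℝ} {u : ℕ → RN N → ℝ}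
    {v : RN N → ℝ} (hv : Measurable v) (hu : ∀ n, FinMod Ω s p (u n))
    (hR : ∀ n, gmod s p (u n) ≤ ENNReal.ofReal R)
    (hlim : ∀ᵐ x, Tendsto (fun n => u n x) atTop (nhds (v x))) :
    FinMod Ω s p v ∧ gmod s p v ≤ ENNReal.ofReal R := by
  have hle : gmod s p v ≤ ENNReal.ofReal R := by
    calc gmod s p v ≤ ∫⁻ z, liminf (fun n => ENNReal.ofReal (gdens s p (u n) z)) atTop := by
          refine lintegral_mono_ae ?_
          filter_upwards [h.tendsto_gdens hlim] with z hz
          rw [(ENNReal.tendsto_ofReal hz).liminf_eq]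
      _ ≤ liminf (fun n => ∫⁻ z, ENNReal.ofReal (gdens s p (u n) z)) atTop :=
          lintegral_liminf_le fun n => (h.measurable_gdens (hu n).meas).ennreal_ofReal
      _ ≤ liminf (fun _ : ℕ => ENNReal.ofReal R) atTop :=
          liminf_le_liminf (.of_forall fun n => hR n)
      _ = ENNReal.ofReal R := by simp
  refine ⟨⟨hv, ?_, hle.trans_lt ENNReal.ofReal_lt_top⟩, hle⟩
  filter_upwards [hlim, ae_all_iff.2 fun n => (hu n).zero] with x hx h0 hxΩ
  refine tendsto_nhds_unique hx ?_
  simp [h0 _ hxΩ]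

theorem Exponents.exists_integral_bound (h : Exponents s p s0 s1 p1 p2) (hΩm : MeasurableSet Ω)
    (hΩ : Bornology.IsBounded Ω) (R : ℝ) : ∃ C, ∀ u : RN N → ℝ, FinMod Ω s p u →
      gmod s p u ≤ ENNReal.ofReal R → Integrable u ∧ ∫ x, |u x| ≤ C := by
  obtain ⟨C, hC⟩ := h.powerBounded_one hΩm hΩ R
  refine ⟨C, fun u hu hR => ?_⟩
  obtain ⟨hi, hb⟩ := hC u hu hR
  simp only [Real.rpow_one] at hi hb
  have hz : ∀ᵐ y, y ∉ Ω → |u y| = 0 := by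
    filter_upwards [hu.zero] with y hy hyΩ
    rw [hy hyΩ, abs_zero]
  refine ⟨(integrable_norm_iff hu.meas.aestronglyMeasurable).1
    (hi.integrable_of_ae_notMem_eq_zero hz), ?_⟩
  rwa [← setIntegral_eq_integral_of_ae_compl_eq_zero hz]

/-- The mean of `u` over a ball. -/
def ballMean (u : RN N → ℝ) (t : ℝ) (y : RN N) : ℝ :=
  (volume.real (Metric.ball y t))⁻¹ * ∫ x in Metric.ball y t, u x

theorem Exponents.abs_sub_ballMean_le (h : Exponents s p s0 s1 p1 p2) (hu : Measurable u)
    {x y : RN N} (hx : gfun s p u x < ⊤) (hui : Integrable u) {t : ℝ} (ht : 0 < t)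
    (ht1 : 2 * t ≤ 1) (hxy : x ∈ Metric.ball y t) :
    |u x - ballMean u t y| ≤
      2 ^ N * ((2 * t) ^ s0 * (2 * (1 + (gfun s p u x).toReal / unitVol N))) := by
  have hc := unitVol_pos (N := N)
  obtain ⟨hi, hb⟩ := h.mean_osc_le hu hx (t := 2 * t) (S := s0) (P := 1) (by positivity) ht1 le_rfl
    (fun y _ => (h.p_gt x y).le) (fun y _ => h.s0_le x y)
  have hV := volume_ball y ht
  have hV0 : 0 < volume.real (Metric.ball y t) := by rw [hV]; positivity
  have hf : volume (Metric.ball y t) ≠ ⊤ := measure_ball_lt_top.ne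
  have heq : u x - ballMean u t y
      = (volume.real (Metric.ball y t))⁻¹ * ∫ y in Metric.ball y t, (u x - u y) := by
    have h1 : Integrable (fun _ : RN N => u x) (volume.restrict (Metric.ball y t)) :=
      integrableOn_const hf
    rw [integral_sub h1 hui.restrict, setIntegral_const, smul_eq_mul, ballMean]
    field_simp
  have hsub : Metric.ball y t ⊆ Metric.ball x (2 * t) := by
    intro w hw
    rw [Metric.mem_ball] at *
    linarith [dist_triangle_right w x y]
  rw [heq, abs_mul, abs_of_pos (inv_pos.2 hV0), inv_mul_le_iff₀ hV0]
  calc |∫ y in Metric.ball y t, (u x - u y)| ≤ ∫ y in Metric.ball y t, |u x - u y| :=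
        abs_integral_le_integral_abs
    _ ≤ ∫ y in Metric.ball x (2 * t), |u x - u y| :=
        setIntegral_mono_set hi (.of_forall fun y => abs_nonneg _) hsub.eventuallyLE
    _ ≤ _ := hb
    _ = _ := by
        rw [volume_ball x (by positivity), hV, div_one, Real.rpow_one, mul_pow]
        ring

theorem Exponents.totallyBounded_range_toL1 (h : Exponents s p s0 s1 p1 p2) (hΩm : MeasurableSet Ω)
    (hΩ : Bornology.IsBounded Ω) {ι : Type*} {R : ℝ} {u : ι → RN N → ℝ}
    (hu : ∀ i, FinMod Ω s p (u i)) (hR : ∀ i, gmod s p (u i) ≤ ENNReal.ofReal R)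
    (hi : ∀ i, Integrable (u i)) :
    TotallyBounded (range fun i => (hi i).toL1 (u i)) := by
  obtain ⟨C, hC⟩ := h.exists_integral_bound hΩm hΩ R
  have hc := unitVol_pos (N := N)
  have hs0 := h.s0_pos
  have hΩf : volume Ω ≠ ⊤ := hΩ.measure_lt_top.ne
  refine totallyBounded_range_of_finite_data _ fun ε hε => ?_
  set R' := max R 0
  set L := 2 * (volume.real Ω + R' / unitVol N) with hL
  have hL0 : 0 ≤ L := by positivity
  obtain ⟨τ, hτ, hτε⟩ : ∃ τ, 0 < τ ∧ τ * L + τ * volume.real Ω < ε := by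
    refine ⟨ε / 2 / (L + volume.real Ω + 1), by positivity, ?_⟩
    have h1 : (0 : ℝ) < L + volume.real Ω + 1 := by positivity
    rw [← mul_add, div_mul_eq_mul_div, div_lt_iff₀ h1]
    nlinarith [measureReal_nonneg (μ := (volume : Measure (RN N))) (s := Ω)]
  set t := min 1 ((τ / (2 ^ N * 2)) ^ (1 / s0)) / 2 with htdef
  have ht : 0 < t := by positivity
  have ht1 : 2 * t ≤ 1 := by
    have := min_le_left 1 ((τ / (2 ^ N * 2)) ^ (1 / s0))
    linarith
  have htτ : 2 ^ N * ((2 * t) ^ s0 * 2) ≤ τ := by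
    have h1 : 2 * t ≤ (τ / (2 ^ N * 2)) ^ (1 / s0) := by
      have := min_le_right 1 ((τ / (2 ^ N * 2)) ^ (1 / s0))
      linarith
    have h2 : (2 * t) ^ s0 ≤ τ / (2 ^ N * 2) := by
      calc (2 * t) ^ s0 ≤ ((τ / (2 ^ N * 2)) ^ (1 / s0)) ^ s0 := by gcongr
        _ = _ := by
          rw [← Real.rpow_mul (by positivity), one_div_mul_cancel hs0.ne', Real.rpow_one]
    rw [le_div_iff₀ (by positivity)] at h2
    linarith
  have hΩt : TotallyBounded Ω := hΩ.isCompact_closure.totallyBounded.subset subset_closure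
  obtain ⟨c, hcf, hcov⟩ := Metric.totallyBounded_iff.1 hΩt t ht
  have hVt : 0 < t ^ N * unitVol N := by positivity
  refine ⟨Fin hcf.toFinset.card, inferInstance,
    fun i k => ballMean (u i) t (hcf.toFinset.equivFin.symm k : RN N), ?_, τ, hτ, fun i j hij => ?_⟩
  · refine isBounded_iff_forall_norm_le.2 ⟨(t ^ N * unitVol N)⁻¹ * max C 0, ?_⟩
    rintro _ ⟨i, rfl⟩
    refine (pi_norm_le_iff_of_nonneg (by positivity)).2 fun k => ?_
    obtain ⟨hui, hub⟩ := hC (u i) (hu i) (hR i)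
    simp only [ballMean]
    rw [volume_ball _ ht, norm_mul, Real.norm_of_nonneg (by positivity)]
    gcongr
    calc ‖∫ x in Metric.ball _ t, u i x‖ ≤ ∫ x in Metric.ball _ t, |u i x| :=
          abs_integral_le_integral_abs
      _ ≤ ∫ x, |u i x| := setIntegral_le_integral hui.abs (.of_forall fun _ => abs_nonneg _)
      _ ≤ _ := hub.trans (le_max_left _ _)
  · obtain ⟨ai, gi, ei⟩ := h.gfun_facts (hu i)
    obtain ⟨aj, gj, ej⟩ := h.gfun_facts (hu j)
    have hdist : dist ((hi i).toL1 (u i)) ((hi j).toL1 (u j)) = ∫ x, |u i x - u j x| := by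
      have hmi := (hu i).meas
      have hmj := (hu j).meas
      rw [dist_edist, Integrable.edist_toL1_toL1, integral_eq_lintegral_of_nonneg_ae
        (f := fun x => |u i x - u j x|) (.of_forall fun _ => abs_nonneg _) (by fun_prop)]
      simp only [edist_dist, Real.dist_eq]
    rw [hdist]
    have hz : ∀ᵐ x, x ∉ Ω → |u i x - u j x| = 0 := by
      filter_upwards [(hu i).zero, (hu j).zero] with x h1 h2 hx
      rw [h1 hx, h2 hx, sub_zero, abs_zero]
    rw [← setIntegral_eq_integral_of_ae_compl_eq_zero hz]
    set g : RN N → ℝ := fun x => (gfun s p (u i) x).toReal + (gfun s p (u j) x).toReal with hg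
    have hgI : Integrable g := gi.add gj
    have hpt : ∀ᵐ x ∂(volume.restrict Ω), |u i x - u j x| ≤
        3 * τ + τ / unitVol N * g x := by
      rw [ae_restrict_iff' hΩm]
      filter_upwards [ai, aj] with x hxi hxj hx
      obtain ⟨y, hyc, hxy⟩ := mem_iUnion₂.1 (hcov hx)
      have b1 := h.abs_sub_ballMean_le (hu i).meas hxi (hi i) ht ht1 hxy
      have b2 := h.abs_sub_ballMean_le (hu j).meas hxj (hi j) ht ht1 hxy
      have b3 : |ballMean (u i) t y - ballMean (u j) t y| < τ := by
        have := (dist_pi_lt_iff hτ).1 hij (hcf.toFinset.equivFin ⟨y, by simpa using hyc⟩)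
        simpa [Real.dist_eq] using this
      have e1 : ∀ G : ℝ, 0 ≤ G →
          2 ^ N * ((2 * t) ^ s0 * (2 * (1 + G / unitVol N))) ≤ τ + τ / unitVol N * G := by
        intro G hG
        have : 0 ≤ 1 + G / unitVol N := by positivity
        calc _ = 2 ^ N * ((2 * t) ^ s0 * 2) * (1 + G / unitVol N) := by ring
          _ ≤ τ * (1 + G / unitVol N) := by gcongr
          _ = _ := by ring
      have b1' := b1.trans (e1 _ ENNReal.toReal_nonneg)
      have b2' := b2.trans (e1 _ ENNReal.toReal_nonneg)
      have htri : |u i x - u j x| ≤ |u i x - ballMean (u i) t y|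
          + |ballMean (u i) t y - ballMean (u j) t y| + |u j x - ballMean (u j) t y| := by
        rw [abs_sub_comm (u j x)]
        have := abs_sub_le (u i x) (ballMean (u i) t y) (u j x)
        have := abs_sub_le (ballMean (u i) t y) (ballMean (u j) t y) (u j x)
        linarith
      simp only [hg]
      linarith
    have hI1 : Integrable (fun _ : RN N => 3 * τ) (volume.restrict Ω) := integrableOn_const hΩf
    have hI2 : Integrable (fun x => τ / unitVol N * g x) (volume.restrict Ω) :=
      (hgI.const_mul _).restrict
    have hgR : ∫ x, g x ≤ 2 * R' := by
      have hRR : ∀ i, (gmod s p (u i)).toReal ≤ R' := fun i => by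
        have := ENNReal.toReal_mono ENNReal.ofReal_ne_top (hR i)
        rwa [ENNReal.toReal_ofReal'] at this
      rw [hg, integral_add gi gj, ei, ej]
      linarith [hRR i, hRR j]
    calc ∫ x in Ω, |u i x - u j x| ≤ ∫ x in Ω, (3 * τ + τ / unitVol N * g x) :=
          integral_mono_ae ((hi i).sub (hi j)).abs.restrict (hI1.add hI2) hpt
      _ = 3 * τ * volume.real Ω + τ / unitVol N * ∫ x in Ω, g x := by
          rw [integral_add hI1 hI2, setIntegral_const, integral_const_mul, smul_eq_mul, mul_comm]
      _ ≤ 3 * τ * volume.real Ω + τ / unitVol N * (2 * R') := by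
          gcongr
          exact (setIntegral_le_integral hgI (.of_forall fun _ => by
            simp only [hg]; positivity)).trans hgR
      _ = τ * L + τ * volume.real Ω := by rw [hL]; ring
      _ < ε := hτε

/-- A net with bounded Gagliardo modular has an `L¹` cluster point. -/
theorem Exponents.exists_cluster (h : Exponents s p s0 s1 p1 p2) (hΩm : MeasurableSet Ω)
    (hΩ : Bornology.IsBounded Ω) {ι : Type*} [Preorder ι] [IsDirectedOrder ι] [Nonempty ι] {R : ℝ}
    {u : ι → RN N → ℝ} (hu : ∀ i, FinMod Ω s p (u i))
    (hR : ∀ i, gmod s p (u i) ≤ ENNReal.ofReal R) :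
    ∃ v, FinMod Ω s p v ∧ gmod s p v ≤ ENNReal.ofReal R ∧
      ∀ i : ℕ → ι, ∃ j : ℕ → ι, (∀ n, i n ≤ j n) ∧
        ∀ᵐ x, Tendsto (fun n => u (j n) x) atTop (nhds (v x)) := by
  obtain ⟨C, hC⟩ := h.exists_integral_bound hΩm hΩ R
  have hi : ∀ i, Integrable (u i) := fun i => (hC _ (hu i) (hR i)).1
  have hcpt : IsCompact (closure (range fun i => (hi i).toL1 (u i))) :=
    (h.totallyBounded_range_toL1 hΩm hΩ hu hR hi).closure.isCompact_of_isClosed isClosed_closure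
  obtain ⟨v, -, hv⟩ := hcpt.exists_clusterPt (f := map (fun i => (hi i).toL1 (u i)) atTop) (by
    rw [le_principal_iff, mem_map]
    exact Filter.univ_mem' fun i => subset_closure (mem_range_self i))
  have hfreq := mapClusterPt_iff_frequently.1 hv
  have hvm : Measurable v := (Lp.stronglyMeasurable v).measurable
  have hseq : ∀ i : ℕ → ι, ∃ j : ℕ → ι, (∀ n, i n ≤ j n) ∧
      ∀ᵐ x, Tendsto (fun n => u (j n) x) atTop (nhds (v x)) := by
    intro i
    have hex : ∀ (k : ι) (n : ℕ), ∃ j, k ≤ j ∧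
        dist ((hi j).toL1 (u j)) v < 1 / ((n : ℝ) + 1) := fun k n => by
      obtain ⟨j, hkj, hj⟩ := (frequently_atTop.1 (hfreq (Metric.ball v (1 / ((n : ℝ) + 1)))
        (Metric.ball_mem_nhds _ (by positivity)))) k
      exact ⟨j, hkj, hj⟩
    obtain ⟨i', hi'⟩ : ∃ i' : ℕ → ι, ∀ n m, m ≤ n → i m ≤ i' n := by
      have : ∀ n, ∃ k, ∀ m, m ≤ n → i m ≤ k := fun n => by
        classical
        obtain ⟨k, hk⟩ := (Finset.range (n + 1)).image i |>.exists_le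
        exact ⟨k, fun m hm => hk _ (Finset.mem_image_of_mem _ (by simpa using Nat.lt_succ_of_le hm))⟩
      choose i' hi' using this
      exact ⟨i', hi'⟩
    choose j hj1 hj2 using fun n => hex (i' n) n
    have hT : Tendsto (fun n => eLpNorm (u (j n) - (v : RN N → ℝ)) 1 volume) atTop (nhds 0) := by
      have h1 : ∀ n, eLpNorm (u (j n) - (v : RN N → ℝ)) 1 volume = edist ((hi (j n)).toL1 (u (j n))) v := by
        intro n
        rw [Lp.edist_def]
        exact eLpNorm_congr_ae ((hi (j n)).coeFn_toL1.symm.sub (ae_eq_refl _))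
      simp only [h1]
      rw [← tendsto_iff_edist_tendsto_0, tendsto_iff_dist_tendsto_zero]
      exact squeeze_zero (fun _ => dist_nonneg) (fun n => (hj2 n).le)
        tendsto_one_div_add_atTop_nhds_zero_nat
    obtain ⟨ns, hns, hae⟩ := (tendstoInMeasure_of_tendsto_eLpNorm one_ne_zero
      (fun n => (hu (j n)).meas.aestronglyMeasurable) hvm.aestronglyMeasurable
      hT).exists_seq_tendsto_ae
    exact ⟨fun n => j (ns n), fun n => (hi' _ _ (hns.le_apply)).trans (hj1 _), hae⟩
  obtain ⟨j, -, hj⟩ := hseq fun _ => Classical.arbitrary ι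
  obtain ⟨h1, h2⟩ := h.finMod_of_tendsto hvm (fun n => hu (j n)) (fun n => hR (j n)) hj
  exact ⟨v, h1, h2, hseq⟩

end

/-- A kernel with uniformly bounded row integrals acts boundedly on `L¹`. -/
theorem integrable_mul_kernel {α : Type*} [MeasurableSpace α] {m : Measure α} [SFinite m]
    {φ : α → ℝ} {κ : α × α → ℝ} {K : ℝ} (hK : 0 ≤ K) (hφm : Measurable φ) (hφ0 : ∀ x, 0 ≤ φ x)
    (hφ : Integrable φ m) (hκm : Measurable κ) (hκ0 : ∀ z, 0 ≤ κ z)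
    (hκ : ∀ x, ∫⁻ y, ENNReal.ofReal (κ (x, y)) ∂m ≤ ENNReal.ofReal K) :
    Integrable (fun z : α × α => φ z.1 * κ z) (m.prod m) ∧
      ∫ z, φ z.1 * κ z ∂m.prod m ≤ K * ∫ x, φ x ∂m := by
  have hm : Measurable fun z : α × α => φ z.1 * κ z := by fun_prop
  have h0 : ∀ z : α × α, 0 ≤ φ z.1 * κ z := fun z => mul_nonneg (hφ0 _) (hκ0 _)
  have key : ∫⁻ z, ENNReal.ofReal (φ z.1 * κ z) ∂m.prod m
      ≤ ENNReal.ofReal (K * ∫ x, φ x ∂m) := by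
    rw [lintegral_prod _ (by fun_prop), ENNReal.ofReal_mul hK,
      ofReal_integral_eq_lintegral_ofReal hφ (ae_of_all _ hφ0), mul_comm,
      ← lintegral_mul_const _ (by fun_prop)]
    refine lintegral_mono fun x => ?_
    simp only [ENNReal.ofReal_mul (hφ0 _)]
    rw [lintegral_const_mul _ (by fun_prop)]
    gcongr
    exact hκ x
  have hi : Integrable (fun z : α × α => φ z.1 * κ z) (m.prod m) := by
    refine ⟨hm.aestronglyMeasurable, ?_⟩
    rw [hasFiniteIntegral_iff_ofReal (ae_of_all _ h0)]
    exact key.trans_lt ENNReal.ofReal_lt_top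
  refine ⟨hi, ?_⟩
  rw [← ofReal_integral_eq_lintegral_ofReal hi (ae_of_all _ h0)] at key
  exact (ENNReal.ofReal_le_ofReal_iff (mul_nonneg hK (integral_nonneg hφ0))).1 key

/-- A non-sharp Hardy–Littlewood–Sobolev inequality obtained from Young's inequality. -/
theorem integrable_mul_mul_kernel {α : Type*} [MeasurableSpace α] {m : Measure α}
    [IsFiniteMeasure m] {X Y : α → ℝ} {κ : α × α → ℝ} {K a : ℝ} (hK : 0 ≤ K) (ha1 : 1 < a)
    (ha2 : a < 2) (hXm : Measurable X) (hYm : Measurable Y) (hX0 : ∀ x, 0 ≤ X x)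
    (hY0 : ∀ x, 0 ≤ Y x) (hX : Integrable (fun x => X x ^ a) m)
    (hY : Integrable (fun x => Y x ^ a) m) (hκm : Measurable κ) (hκ0 : ∀ z, 0 ≤ κ z)
    (hκ1 : ∀ x, ∫⁻ y, ENNReal.ofReal (κ (x, y) ^ (a / (2 * (a - 1)))) ∂m ≤ ENNReal.ofReal K)
    (hκ2 : ∀ y, ∫⁻ x, ENNReal.ofReal (κ (x, y) ^ (a / (2 * (a - 1)))) ∂m ≤ ENNReal.ofReal K) :
    Integrable (fun z : α × α => X z.1 * Y z.2 * κ z) (m.prod m) ∧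
      ∫ z, X z.1 * Y z.2 * κ z ∂m.prod m ≤
        K * ((∫ x, X x ^ a ∂m) + ∫ x, Y x ^ a ∂m) + (∫ x, X x ^ a ∂m) * ∫ x, Y x ^ a ∂m := by
  set t := a / (2 * (a - 1)) with ht
  have ha0 : 0 < a := by linarith
  have ha1' : 0 < a - 1 := by linarith
  obtain ⟨i1, b1⟩ := integrable_mul_kernel (κ := fun z => κ z ^ t) hK (by fun_prop)
    (fun x => by have := hX0 x; positivity) hX (by fun_prop)
    (fun z => by have := hκ0 z; positivity) hκ1
  obtain ⟨i2, b2⟩ := integrable_mul_kernel (κ := fun z => κ z.swap ^ t) hK (by fun_prop)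
    (fun x => by have := hY0 x; positivity) hY
    ((hκm.comp measurable_swap).pow_const _)
    (fun z => by have := hκ0 z.swap; positivity) hκ2
  have i2' := i2.swap
  have b2' : ∫ z : α × α, Y z.2 ^ a * κ z ^ t ∂m.prod m ≤ K * ∫ x, Y x ^ a ∂m := by
    rw [← integral_prod_swap]; exact b2
  have i2'' : Integrable (fun z : α × α => Y z.2 ^ a * κ z ^ t) (m.prod m) := i2'
  have i3 := hX.mul_prod hY
  have b3 := integral_prod_mul (μ := m) (ν := m) (fun x => X x ^ a) fun x => Y x ^ a
  have hpt : ∀ z : α × α, X z.1 * Y z.2 * κ z ≤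
      X z.1 ^ a * κ z ^ t + Y z.2 ^ a * κ z ^ t + X z.1 ^ a * Y z.2 ^ a := by
    intro z
    have hx := hX0 z.1
    have hy := hY0 z.2
    have hk := hκ0 z
    have e1 : 0 ≤ (a - 1) / a := by positivity
    have e2 : 0 ≤ 2 / a - 1 := by
      rw [sub_nonneg, le_div_iff₀ ha0]; linarith
    have y3 := Real.geom_mean_le_arith_mean3_weighted e1 e1 e2
      (show 0 ≤ X z.1 ^ a * κ z ^ t by positivity) (show 0 ≤ Y z.2 ^ a * κ z ^ t by positivity)
      (show 0 ≤ X z.1 ^ a * Y z.2 ^ a by positivity) (by field_simp; ring)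
    have hid : (X z.1 ^ a * κ z ^ t) ^ ((a - 1) / a) * (Y z.2 ^ a * κ z ^ t) ^ ((a - 1) / a)
        * (X z.1 ^ a * Y z.2 ^ a) ^ (2 / a - 1) = X z.1 * Y z.2 * κ z := by
      have q1 : ∀ w : ℝ, 0 ≤ w → (w ^ a) ^ ((a - 1) / a) * (w ^ a) ^ (2 / a - 1) = w := by
        intro w hw
        rw [← Real.rpow_mul hw, ← Real.rpow_mul hw, ← Real.rpow_add_of_nonneg hw]
        · rw [show a * ((a - 1) / a) + a * (2 / a - 1) = 1 by field_simp; ring, Real.rpow_one]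
        · positivity
        · exact mul_nonneg ha0.le e2
      have q2 : (κ z ^ t) ^ ((a - 1) / a) * (κ z ^ t) ^ ((a - 1) / a) = κ z := by
        have ht0 : 0 ≤ t := by positivity
        rw [← Real.rpow_mul hk, ← Real.rpow_add_of_nonneg hk (by positivity) (by positivity)]
        rw [show t * ((a - 1) / a) + t * ((a - 1) / a) = 1 by rw [ht]; field_simp; ring,
          Real.rpow_one]
      rw [Real.mul_rpow (by positivity) (by positivity), Real.mul_rpow (by positivity)
        (by positivity), Real.mul_rpow (by positivity) (by positivity)]
      calc _ = ((X z.1 ^ a) ^ ((a - 1) / a) * (X z.1 ^ a) ^ (2 / a - 1)) *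
            ((Y z.2 ^ a) ^ ((a - 1) / a) * (Y z.2 ^ a) ^ (2 / a - 1)) *
            ((κ z ^ t) ^ ((a - 1) / a) * (κ z ^ t) ^ ((a - 1) / a)) := by ring
        _ = _ := by rw [q1 _ hx, q1 _ hy, q2]
    rw [hid] at y3
    have f1 : (a - 1) / a ≤ 1 := by rw [div_le_one ha0]; linarith
    have f2 : 2 / a - 1 ≤ 1 := by
      rw [sub_le_iff_le_add, div_le_iff₀ ha0]; linarith
    refine y3.trans ?_
    gcongr ?_ + ?_ + ?_
    · exact mul_le_of_le_one_left (by positivity) f1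
    · exact mul_le_of_le_one_left (by positivity) f1
    · exact mul_le_of_le_one_left (by positivity) f2
  have hm : Measurable fun z : α × α => X z.1 * Y z.2 * κ z := by fun_prop
  have hdom := (i1.add i2'').add i3
  have hi : Integrable (fun z : α × α => X z.1 * Y z.2 * κ z) (m.prod m) := by
    refine hdom.mono' hm.aestronglyMeasurable (ae_of_all _ fun z => ?_)
    rw [Real.norm_eq_abs, abs_of_nonneg (mul_nonneg (mul_nonneg (hX0 _) (hY0 _)) (hκ0 _))]
    exact hpt z
  refine ⟨hi, (integral_mono hi hdom hpt).trans ?_⟩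
  rw [integral_add' (i1.add i2'') i3, integral_add' i1 i2'', b3]
  linarith

/-- Local integrability of the truncated power `‖h‖^{-m}`, `m < N`. -/
theorem integrableOn_ball_norm_rpow (hN : 0 < N) {m : ℝ} (hm : m < N) :
    IntegrableOn (fun h : RN N => ‖h‖ ^ (-m)) (Metric.ball 0 1) := by
  have : Nonempty (Fin N) := ⟨⟨0, hN⟩⟩
  have : Nontrivial (RN N) := inferInstance
  rw [integrableOn_fun_norm_addHaar volume (f := fun t => t ^ (-m)) (r := 1)]
  have : IntegrableOn (fun y : ℝ => y ^ ((N : ℝ) - 1 - m)) (Ioo 0 1) := by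
    rw [intervalIntegral.integrableOn_Ioo_rpow_iff one_pos]; linarith
  refine this.congr_fun (fun y hy => ?_) measurableSet_Ioo
  have hy0 : 0 < y := hy.1
  simp only [finrank_euclideanSpace, Fintype.card_fin, smul_eq_mul]
  rw [← Real.rpow_natCast, ← Real.rpow_add hy0]
  congr 1
  have : ((N - 1 : ℕ) : ℝ) = (N : ℝ) - 1 := by
    rw [Nat.cast_sub (by omega)]; simp
  rw [this]; ring

/-- The Riesz kernel `|x - y|^{-μ(x,y)}`. -/
def riesz (μ : RN N → RN N → ℝ) (z : RN N × RN N) : ℝ := (dist z.1 z.2 ^ μ z.1 z.2)⁻¹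

theorem riesz_nonneg (μ : RN N → RN N → ℝ) (z : RN N × RN N) : 0 ≤ riesz μ z := by
  unfold riesz; positivity

/-- A power of the Riesz kernel with a subcritical exponent has bounded row integrals. -/
theorem lintegral_riesz_le (hN : 0 < N) {m : ℝ} (hm : m < N) {Ω : Set (RN N)}
    (hΩ : volume Ω ≠ ⊤) :
    ∃ K : ℝ, 0 ≤ K ∧ ∀ (μ : RN N → RN N → ℝ), ∀ e : ℝ, 0 ≤ e → (∀ x y, 0 < μ x y) →
      (∀ x y, μ x y * e ≤ m) →
      (∀ x, ∫⁻ y in Ω, ENNReal.ofReal (riesz μ (x, y) ^ e) ≤ ENNReal.ofReal K) ∧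
      (∀ y, ∫⁻ x in Ω, ENNReal.ofReal (riesz μ (x, y) ^ e) ≤ ENNReal.ofReal K) := by
  set w : RN N → ℝ≥0∞ := fun h =>
    (Metric.ball 0 1).indicator (fun h => ENNReal.ofReal (‖h‖ ^ (-m))) h with hw
  have hwm : Measurable w := by
    refine Measurable.indicator ?_ measurableSet_ball
    fun_prop
  have hwi : ∫⁻ h, w h < ⊤ := by
    rw [hw, lintegral_indicator measurableSet_ball]
    have := (integrableOn_ball_norm_rpow hN hm).hasFiniteIntegral
    rwa [hasFiniteIntegral_iff_ofReal (ae_of_all _ fun h => by positivity)] at this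
  refine ⟨(volume Ω + ∫⁻ h, w h).toReal, ENNReal.toReal_nonneg, fun μ e he hμ hμe => ?_⟩
  have hb : ∀ x y : RN N, ENNReal.ofReal (riesz μ (x, y) ^ e) ≤ 1 + w (x - y) := by
    intro x y
    unfold riesz
    simp only
    have hme : 0 ≤ μ x y * e := mul_nonneg (hμ x y).le he
    rw [dist_eq_norm]
    by_cases h0 : x = y
    · subst h0
      simp only [sub_self, norm_zero]
      rw [Real.zero_rpow (hμ x x).ne', _root_.inv_zero]
      calc ENNReal.ofReal ((0:ℝ) ^ e) ≤ ENNReal.ofReal 1 := by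
            gcongr
            exact Real.rpow_le_one le_rfl zero_le_one he
        _ ≤ _ := by simp
    have hd : 0 < ‖x - y‖ := norm_pos_iff.2 (sub_ne_zero.2 h0)
    rw [← Real.rpow_neg hd.le, ← Real.rpow_mul hd.le]
    by_cases h1 : ‖x - y‖ < 1
    · have : w (x - y) = ENNReal.ofReal (‖x - y‖ ^ (-m)) := by
        rw [hw]; exact indicator_of_mem (by simpa using h1) _
      rw [this]
      refine le_add_left (ENNReal.ofReal_le_ofReal ?_)
      exact Real.rpow_le_rpow_of_exponent_ge hd h1.le (by linarith [hμe x y])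
    · refine le_add_right ?_
      rw [← ENNReal.ofReal_one]
      refine ENNReal.ofReal_le_ofReal ?_
      exact Real.rpow_le_one_of_one_le_of_nonpos (not_lt.1 h1) (by linarith)
  have htop : volume Ω + ∫⁻ h, w h ≠ ⊤ := ENNReal.add_ne_top.2 ⟨hΩ, hwi.ne⟩
  rw [ENNReal.ofReal_toReal htop]
  constructor
  · intro x
    calc _ ≤ ∫⁻ y in Ω, (1 + w (x - y)) := lintegral_mono fun y => hb x y
      _ = volume Ω + ∫⁻ y in Ω, w (x - y) := by
        rw [lintegral_add_left measurable_const]; simp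
      _ ≤ volume Ω + ∫⁻ y, w (x - y) := by gcongr; exact Measure.restrict_le_self
      _ = _ := by rw [lintegral_sub_left_eq_self]
  · intro y
    calc _ ≤ ∫⁻ x in Ω, (1 + w (x - y)) := lintegral_mono fun x => hb x y
      _ = volume Ω + ∫⁻ x in Ω, w (x - y) := by
        rw [lintegral_add_left measurable_const]; simp
      _ ≤ volume Ω + ∫⁻ x, w (x - y) := by gcongr; exact Measure.restrict_le_self
      _ = _ := by rw [lintegral_sub_right_eq_self]

section Antiderivative

variable {f : RN N → ℝ → ℝ} {Ω : Set (RN N)} {M Θ : ℝ} {r : RN N → ℝ}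

theorem Caratheodory.measurable (hf : Caratheodory f) :
    Measurable fun z : RN N × ℝ => f z.1 z.2 :=
  (measurable_uncurry_of_continuous_of_measurable (u := fun t x => f x t) hf.2 hf.1).comp
    measurable_swap

theorem Caratheodory.measurable_comp (hf : Caratheodory f) {u : RN N → ℝ} (hu : Measurable u) :
    Measurable fun x => f x (u x) :=
  hf.measurable.comp (measurable_id.prodMk hu)

theorem Caratheodory.hasDerivAt_Fant (hf : Caratheodory f) (x : RN N) (t : ℝ) :
    HasDerivAt (Fant f x) (f x t) t :=
  intervalIntegral.integral_hasDerivAt_right ((hf.2 x).intervalIntegrable _ _)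
    (hf.2 x).aestronglyMeasurable.stronglyMeasurableAtFilter (hf.2 x).continuousAt

theorem Caratheodory.continuous_Fant (hf : Caratheodory f) (x : RN N) :
    Continuous (Fant f x) :=
  continuous_iff_continuousAt.2 fun t => (hf.hasDerivAt_Fant x t).continuousAt

theorem Caratheodory.measurable_Fant (hf : Caratheodory f) :
    Measurable fun z : RN N × ℝ => Fant f z.1 z.2 := by
  refine (measurable_uncurry_of_continuous_of_measurable (u := fun t x => Fant f x t)
    hf.continuous_Fant fun t => ?_).comp measurable_swap
  have h1 : StronglyMeasurable (Function.uncurry f) := hf.measurable.stronglyMeasurable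
  unfold Fant intervalIntegral
  exact (h1.integral_prod_right.sub h1.integral_prod_right).measurable

theorem Caratheodory.measurable_Fant_comp (hf : Caratheodory f) {u : RN N → ℝ}
    (hu : Measurable u) : Measurable fun x => Fant f x (u x) :=
  hf.measurable_Fant.comp (measurable_id.prodMk hu)

theorem Fant_zero (x : RN N) : Fant f x 0 = 0 := intervalIntegral.integral_same

theorem F1.abs_Fant_le (h : F1 Ω f M r) {x : RN N} (hx : x ∈ Ω) (hr : 1 < r x) (t : ℝ) :
    |Fant f x t| ≤ M * |t| ^ r x := by
  have := intervalIntegral.norm_integral_le_of_norm_le_const (a := 0) (b := t) (f := f x)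
    (C := M * |t| ^ (r x - 1)) fun τ hτ => by
      refine (h.2 x hx τ).trans ?_
      have h1 : |τ| ≤ |t| := by
        rcases le_total 0 t with h0 | h0
        · rw [uIoc_of_le h0] at hτ
          rw [abs_of_pos hτ.1, abs_of_nonneg h0]; exact hτ.2
        · rw [uIoc_of_ge h0] at hτ
          rw [abs_of_nonpos hτ.2, abs_of_nonpos h0]; linarith [hτ.1]
      have := h.1
      gcongr
  refine this.trans_eq ?_
  rw [sub_zero, mul_assoc, ← Real.rpow_add_one' (abs_nonneg t) (by linarith)]
  norm_num

theorem F2.Fant_pos (h : F2 Ω f Θ) (hΘ : 0 < Θ) :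
    ∀ᵐ x, x ∈ Ω → ∀ t, t ≠ 0 → 0 < Fant f x t := by
  filter_upwards [h] with x hx hxΩ t ht
  exact pos_of_mul_pos_right (hx hxΩ t ht).1 hΘ.le

/-- Superhomogeneity of the antiderivative along rays. -/
theorem F2.rpow_mul_Fant_le (h : F2 Ω f Θ) (hf : Caratheodory f) :
    ∀ᵐ x, x ∈ Ω → ∀ t τ : ℝ, 1 ≤ τ → τ ^ (Θ / 2) * Fant f x t ≤ Fant f x (τ * t) := by
  filter_upwards [h] with x hx hxΩ t τ hτ
  rcases eq_or_ne t 0 with rfl | ht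
  · simp [Fant_zero]
  set g : ℝ → ℝ := fun σ => σ ^ (-(Θ / 2)) * Fant f x (σ * t)
  have hd : ∀ σ : ℝ, 0 < σ → HasDerivAt g
      (-(Θ / 2) * σ ^ (-(Θ / 2) - 1) * Fant f x (σ * t) +
        σ ^ (-(Θ / 2)) * (f x (σ * t) * t)) σ := by
    intro σ hσ
    have h1 : HasDerivAt (fun σ : ℝ => σ ^ (-(Θ / 2))) (-(Θ / 2) * σ ^ (-(Θ / 2) - 1)) σ :=
      Real.hasDerivAt_rpow_const (Or.inl hσ.ne')
    have h2 : HasDerivAt (fun σ : ℝ => Fant f x (σ * t)) (f x (σ * t) * t) σ := by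
      have := (hf.hasDerivAt_Fant x (σ * t)).comp σ ((hasDerivAt_id σ).mul_const t)
      simpa [Function.comp_def] using this
    exact h1.mul h2
  have hmono : MonotoneOn g (Icc 1 τ) := by
    refine monotoneOn_of_deriv_nonneg (convex_Icc _ _) ?_ ?_ ?_
    · exact fun σ hσ => (hd σ (one_pos.trans_le hσ.1)).continuousAt.continuousWithinAt
    · rw [interior_Icc]
      exact fun σ hσ => (hd σ (one_pos.trans hσ.1)).differentiableAt.differentiableWithinAt
    · rw [interior_Icc]
      intro σ hσ
      have hσ0 : 0 < σ := one_pos.trans hσ.1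
      rw [(hd σ hσ0).deriv, Real.rpow_sub_one hσ0.ne']
      have h3 := (hx hxΩ (σ * t) (mul_ne_zero hσ0.ne' ht)).2
      have h4 : 0 ≤ σ ^ (-(Θ / 2)) / σ := by positivity
      have : -(Θ / 2) * (σ ^ (-(Θ / 2)) / σ) * Fant f x (σ * t)
          + σ ^ (-(Θ / 2)) * (f x (σ * t) * t) = (σ ^ (-(Θ / 2)) / σ) *
          ((2 * (σ * t * f x (σ * t)) - Θ * Fant f x (σ * t)) / 2) := by
        field_simp; ring
      rw [this]
      exact mul_nonneg h4 (by linarith)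
  have := hmono (left_mem_Icc.2 hτ) (right_mem_Icc.2 hτ) hτ
  simp only [g, Real.one_rpow, one_mul] at this
  have hτ0 : 0 < τ := by linarith
  calc τ ^ (Θ / 2) * Fant f x t ≤ τ ^ (Θ / 2) * (τ ^ (-(Θ / 2)) * Fant f x (τ * t)) := by gcongr
    _ = _ := by rw [← mul_assoc, ← Real.rpow_add hτ0]; simp

end Antiderivative

/-- The bilinear Choquard form `∫_Ω ∫_Ω φ(x) ψ(y) |x - y|^{-μ(x,y)} dx dy`. -/
def bil (Ω : Set (RN N)) (μ : RN N → RN N → ℝ) (φ ψ : RN N → ℝ) : ℝ :=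
  ∫ z, φ z.1 * ψ z.2 * riesz μ z ∂((volume.restrict Ω).prod (volume.restrict Ω))

/-- The standing assumptions on the nonlocal nonlinearity, in the form used by the variational
argument: `b` is a power controlled by the energy and `c` a power gained over integrability. -/
structure Choquard (Ω : Set (RN N)) (s p μ : RN N → RN N → ℝ) (f : RN N → ℝ → ℝ)
    (M Θ : ℝ) (r : RN N → ℝ) (b c K : ℝ) : Prop where
  meas_dom : MeasurableSet Ω
  vol : volume Ω ≠ ⊤
  car : Caratheodory f
  growth : F1 Ω f M r
  ar : F2 Ω f Θ
  Θ_pos : 0 < Θ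
  r_meas : Measurable r
  r_gt : ∀ x, 1 < r x
  c_gt : 1 < c
  b_pos : 0 < b
  K_nonneg : 0 ≤ K
  meas_riesz : Measurable (riesz μ)
  symm : ∀ x y, μ x y = μ y x
  power : PowerBounded Ω s p fun x => r x * b
  hls : ∀ φ ψ : RN N → ℝ, Measurable φ → Measurable ψ →
    IntegrableOn (fun x => |φ x| ^ b) Ω → IntegrableOn (fun x => |ψ x| ^ b) Ω →
    Integrable (fun z => |φ z.1 * ψ z.2 * riesz μ z| ^ c)
      ((volume.restrict Ω).prod (volume.restrict Ω)) ∧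
    ∫ z, |φ z.1 * ψ z.2 * riesz μ z| ^ c ∂((volume.restrict Ω).prod (volume.restrict Ω)) ≤
      K * ((∫ x in Ω, |φ x| ^ b) + ∫ x in Ω, |ψ x| ^ b) +
        (∫ x in Ω, |φ x| ^ b) * ∫ x in Ω, |ψ x| ^ b

/-- Transfer of an almost everywhere statement on a domain to its square. -/
theorem ae_restrict_prod_of_ae {Ω : Set (RN N)} (hΩ : MeasurableSet Ω) {P : RN N → Prop}
    (h : ∀ᵐ x, x ∈ Ω → P x) :
    ∀ᵐ z ∂((volume.restrict Ω).prod (volume.restrict Ω)), P z.1 ∧ P z.2 := by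
  have h' : ∀ᵐ x ∂(volume.restrict Ω), P x := (ae_restrict_iff' hΩ).2 h
  filter_upwards [Measure.quasiMeasurePreserving_fst.ae h',
    Measure.quasiMeasurePreserving_snd.ae h'] with z h1 h2 using ⟨h1, h2⟩

namespace Choquard

variable {Ω : Set (RN N)} {s p μ : RN N → RN N → ℝ} {f : RN N → ℝ → ℝ} {M Θ : ℝ}
  {r : RN N → ℝ} {b c K : ℝ} (H : Choquard Ω s p μ f M Θ r b c K)
include H

theorem isFiniteMeasure : IsFiniteMeasure (volume.restrict Ω) :=
  ⟨by rw [Measure.restrict_apply_univ]; exact lt_top_iff_ne_top.2 H.vol⟩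

theorem measurable_integrand {φ ψ : RN N → ℝ} (hφ : Measurable φ) (hψ : Measurable ψ) :
    Measurable fun z : RN N × RN N => φ z.1 * ψ z.2 * riesz μ z := by
  have := H.meas_riesz
  fun_prop

theorem integrable {φ ψ : RN N → ℝ} (hφ : Measurable φ) (hψ : Measurable ψ)
    (hφi : IntegrableOn (fun x => |φ x| ^ b) Ω) (hψi : IntegrableOn (fun x => |ψ x| ^ b) Ω) :
    Integrable (fun z => φ z.1 * ψ z.2 * riesz μ z)
      ((volume.restrict Ω).prod (volume.restrict Ω)) := by
  have := H.isFiniteMeasure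
  refine ((integrable_const (1 : ℝ)).add (H.hls φ ψ hφ hψ hφi hψi).1).mono'
    (H.measurable_integrand hφ hψ).aestronglyMeasurable (ae_of_all _ fun z => ?_)
  rw [Real.norm_eq_abs]
  have := rpow_le_one_add_rpow (abs_nonneg (φ z.1 * ψ z.2 * riesz μ z)) zero_le_one H.c_gt.le
  rwa [Real.rpow_one] at this

theorem bil_comm (φ ψ : RN N → ℝ) : bil Ω μ φ ψ = bil Ω μ ψ φ := by
  unfold bil
  rw [← integral_prod_swap]
  refine integral_congr_ae (ae_of_all _ fun z => ?_)
  simp only [riesz, Prod.fst_swap, Prod.snd_swap, dist_comm z.2 z.1, H.symm z.2 z.1]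
  ring

/-- Continuity of the Choquard form under almost everywhere convergence with bounded moments. -/
theorem tendsto_bil {φ ψ : ℕ → RN N → ℝ} {φ₀ ψ₀ : RN N → ℝ} {C : ℝ}
    (hφ : ∀ n, Measurable (φ n)) (hψ : ∀ n, Measurable (ψ n))
    (hφi : ∀ n, IntegrableOn (fun x => |φ n x| ^ b) Ω ∧ ∫ x in Ω, |φ n x| ^ b ≤ C)
    (hψi : ∀ n, IntegrableOn (fun x => |ψ n x| ^ b) Ω ∧ ∫ x in Ω, |ψ n x| ^ b ≤ C)
    (hφ₀ : Measurable φ₀) (hψ₀ : Measurable ψ₀)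
    (hφ₀i : IntegrableOn (fun x => |φ₀ x| ^ b) Ω) (hψ₀i : IntegrableOn (fun x => |ψ₀ x| ^ b) Ω)
    (hφl : ∀ᵐ x, x ∈ Ω → Tendsto (fun n => φ n x) atTop (nhds (φ₀ x)))
    (hψl : ∀ᵐ x, x ∈ Ω → Tendsto (fun n => ψ n x) atTop (nhds (ψ₀ x))) :
    Tendsto (fun n => bil Ω μ (φ n) (ψ n)) atTop (nhds (bil Ω μ φ₀ ψ₀)) := by
  have := H.isFiniteMeasure
  refine tendsto_integral_of_moment_bound H.c_gt (Q := K * (C + C) + C * C)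
    (fun n => (H.measurable_integrand (hφ n) (hψ n)).aestronglyMeasurable)
    (fun n => (H.hls _ _ (hφ n) (hψ n) (hφi n).1 (hψi n).1).1) (fun n => ?_)
    (H.integrable hφ₀ hψ₀ hφ₀i hψ₀i) ?_
  · refine (H.hls _ _ (hφ n) (hψ n) (hφi n).1 (hψi n).1).2.trans ?_
    have h1 : 0 ≤ ∫ x in Ω, |φ n x| ^ b := integral_nonneg fun x => by positivity
    have h2 : 0 ≤ ∫ x in Ω, |ψ n x| ^ b := integral_nonneg fun x => by positivity
    have := H.K_nonneg
    have h3 := (hφi n).2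
    have h4 := (hψi n).2
    gcongr
    exact h1.trans h3
  · filter_upwards [ae_restrict_prod_of_ae H.meas_dom hφl,
      ae_restrict_prod_of_ae H.meas_dom hψl] with z h1 h2
    exact (h1.1.mul h2.2).mul_const _

/-- Uniform moments of the nonlinear terms on sets of bounded energy. -/
theorem exists_moment_bound (R : ℝ) : ∃ C, ∀ u, FinMod Ω s p u → gmod s p u ≤ ENNReal.ofReal R →
    (IntegrableOn (fun x => |Fant f x (u x)| ^ b) Ω ∧ ∫ x in Ω, |Fant f x (u x)| ^ b ≤ C) ∧
    ∀ w, FinMod Ω s p w → gmod s p w ≤ ENNReal.ofReal R →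
      IntegrableOn (fun x => |f x (u x) * w x| ^ b) Ω ∧
        ∫ x in Ω, |f x (u x) * w x| ^ b ≤ C := by
  obtain ⟨C, hC⟩ := H.power R
  have hM := H.growth.1
  have hr := H.r_meas
  have hb := H.b_pos
  refine ⟨M ^ b * (C + C), fun u hu huR => ⟨?_, fun w hw hwR => ?_⟩⟩
  · obtain ⟨h1, h2⟩ := hC u hu huR
    have h0 : 0 ≤ ∫ x in Ω, |u x| ^ (r x * b) := integral_nonneg fun x => by positivity
    have hle : ∀ x ∈ Ω, |Fant f x (u x)| ^ b ≤ M ^ b * |u x| ^ (r x * b) := by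
      intro x hx
      rw [Real.rpow_mul (abs_nonneg _), ← Real.mul_rpow hM.le (by positivity)]
      exact Real.rpow_le_rpow (abs_nonneg _) (H.growth.abs_Fant_le hx (H.r_gt x) _) hb.le
    have hFm := H.car.measurable_Fant_comp hu.meas
    have hm : Measurable fun x => |Fant f x (u x)| ^ b := by fun_prop
    have hi : IntegrableOn (fun x => |Fant f x (u x)| ^ b) Ω := by
      refine (h1.const_mul (M ^ b)).mono' hm.aestronglyMeasurable ?_
      filter_upwards [ae_restrict_mem H.meas_dom] with x hx
      rw [Real.norm_eq_abs, abs_of_nonneg (by positivity)]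
      exact hle x hx
    refine ⟨hi, ?_⟩
    calc _ ≤ ∫ x in Ω, M ^ b * |u x| ^ (r x * b) :=
          setIntegral_mono_on hi (h1.const_mul _) H.meas_dom hle
      _ = M ^ b * ∫ x in Ω, |u x| ^ (r x * b) := integral_const_mul _ _
      _ ≤ _ := by gcongr; linarith
  · obtain ⟨h1, h2⟩ := hC u hu huR
    obtain ⟨h3, h4⟩ := hC w hw hwR
    have hle : ∀ x ∈ Ω, |f x (u x) * w x| ^ b ≤
        M ^ b * (|u x| ^ (r x * b) + |w x| ^ (r x * b)) := by
      intro x hx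
      have hr1 := H.r_gt x
      have k1 : |f x (u x) * w x| ≤ M * max |u x| |w x| ^ r x := by
        rw [abs_mul]
        calc |f x (u x)| * |w x| ≤ (M * |u x| ^ (r x - 1)) * |w x| := by
              gcongr; exact H.growth.2 x hx _
          _ ≤ (M * max |u x| |w x| ^ (r x - 1)) * max |u x| |w x| := by
              gcongr
              · exact le_max_left _ _
              · exact le_max_right _ _
          _ = _ := by
            rw [mul_assoc, ← Real.rpow_add_one' (by positivity) (by linarith)]; norm_num
      calc |f x (u x) * w x| ^ b ≤ (M * max |u x| |w x| ^ r x) ^ b := by gcongr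
        _ = M ^ b * max |u x| |w x| ^ (r x * b) := by
          rw [Real.mul_rpow hM.le (by positivity), ← Real.rpow_mul (by positivity)]
        _ ≤ _ := by
          gcongr
          rcases max_cases |u x| |w x| with ⟨he, -⟩ | ⟨he, -⟩ <;> rw [he]
          · exact le_add_of_nonneg_right (by positivity)
          · exact le_add_of_nonneg_left (by positivity)
    have hFm := H.car.measurable_comp hu.meas
    have hwm := hw.meas
    have hm : Measurable fun x => |f x (u x) * w x| ^ b := (hFm.mul hwm).norm.pow_const b
    have hi : IntegrableOn (fun x => |f x (u x) * w x| ^ b) Ω := by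
      refine ((h1.add h3).const_mul (M ^ b)).mono' hm.aestronglyMeasurable ?_
      filter_upwards [ae_restrict_mem H.meas_dom] with x hx
      rw [Real.norm_eq_abs, abs_of_nonneg (by positivity)]
      exact hle x hx
    refine ⟨hi, ?_⟩
    calc _ ≤ ∫ x in Ω, M ^ b * (|u x| ^ (r x * b) + |w x| ^ (r x * b)) :=
          setIntegral_mono_on hi ((h1.add h3).const_mul _) H.meas_dom hle
      _ = M ^ b * ((∫ x in Ω, |u x| ^ (r x * b)) + ∫ x in Ω, |w x| ^ (r x * b)) := by
          rw [integral_const_mul, integral_add h1 h3]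
      _ ≤ _ := by gcongr

end Choquard

theorem inf2_le {g : RN N → RN N → ℝ} (h : 0 < inf2 g) (x y : RN N) : inf2 g ≤ g x y := by
  refine csInf_le ?_ ⟨x, y, rfl⟩
  by_contra hb
  rw [inf2, Real.sInf_of_not_bddBelow hb] at h
  exact lt_irrefl _ h

theorem le_sup2 {g : RN N → RN N → ℝ} (h : BddAbove {t | ∃ x y, g x y = t}) (x y : RN N) :
    g x y ≤ sup2 g := le_csSup h ⟨x, y, rfl⟩

theorem infOn_univ_le {g : RN N → ℝ} (h : 0 < infOn univ g) (x : RN N) : infOn univ g ≤ g x := by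
  refine csInf_le ?_ ⟨x, mem_univ x, rfl⟩
  by_contra hb
  rw [infOn, Real.sInf_of_not_bddBelow hb] at h
  exact lt_irrefl _ h

/-- The hypotheses of the existence theorem provide a `Choquard` structure. -/
theorem Exponents.exists_choquard {s p μ q : RN N → RN N → ℝ} {s0 s1 p1 p2 : ℝ}
    (h : Exponents s p s0 s1 p1 p2) {Ω : Set (RN N)} {f : RN N → ℝ → ℝ} {M Θ : ℝ} {r : RN N → ℝ}
    (hΩo : IsOpen Ω) (hΩb : Bornology.IsBounded Ω) (hμ : Mu1 μ) (hq : CPlus2 q)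
    (hqμ : ∀ x y, 2 / q x y + μ x y / (N : ℝ) = 2) (hf : Caratheodory f)
    (hr : CPlusOn univ r) (hrM : MemM s p q r) (hf1 : F1 Ω f M r) (hΘ : 0 < Θ)
    (hf2 : F2 Ω f Θ) :
    ∃ b c K, Choquard Ω s p μ f M Θ r b c K ∧ PowerBounded Ω s p fun x => p x x := by
  have hN := h.dim_pos'
  obtain ⟨hqc, hq1, hqb⟩ := hq
  obtain ⟨hμs, hμb, hμ0, hμN⟩ := hμ
  have hrc : Continuous r := continuousOn_univ.1 hr.1
  have hr1 : ∀ x, 1 < r x := fun x =>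
    hr.2.1.trans_le (infOn_univ_le (one_pos.trans hr.2.1) x)
  have hqgt : ∀ x y, 1 < q x y := fun x y => hq1.trans_le (inf2_le (one_pos.trans hq1) x y)
  have hμpos : ∀ x y, 0 < μ x y := fun x y => hμ0.trans_le (inf2_le hμ0 x y)
  have hμeq : ∀ x y, μ x y = N * (2 - 2 / q x y) := by
    intro x y
    have h1 := hqμ x y
    rw [show 2 - 2 / q x y = μ x y / N by linarith]
    field_simp
  set Q := sup2 q with hQ
  have hqQ : ∀ x y, q x y ≤ Q := le_sup2 hqb
  have hQ1 : 1 < Q := (hqgt 0 0).trans_le (hqQ 0 0)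
  have hQ2 : Q < 2 := by
    have hd : 0 < 2 - sup2 μ / N := by
      have : sup2 μ / N < 1 := (div_lt_one hN).2 hμN
      linarith
    have hle : Q ≤ 2 / (2 - sup2 μ / N) := by
      refine csSup_le ⟨q 0 0, 0, 0, rfl⟩ ?_
      rintro _ ⟨x, y, rfl⟩
      have h1 := hqμ x y
      have h2 := le_sup2 hμb x y
      have hq0 : 0 < q x y := one_pos.trans (hqgt x y)
      rw [le_div_iff₀ hd]
      have h3 : μ x y / N ≤ sup2 μ / N := by gcongr
      have h4 : q x y * (2 - μ x y / N) = 2 := by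
        rw [show 2 - μ x y / N = 2 / q x y by linarith]; field_simp
      nlinarith
    refine hle.trans_lt ?_
    rw [div_lt_iff₀ hd]
    have : sup2 μ / N < 1 := (div_lt_one hN).2 hμN
    linarith
  obtain ⟨hpc, hpgt, -⟩ := h.pstar_facts
  have hratio : Continuous fun x => r x * Q / pstar s p x :=
    (hrc.mul continuous_const).div hpc fun x => (one_pos.trans (hpgt x)).ne'
  obtain ⟨l, hl0, hl1, hl⟩ : ∃ l, 0 < l ∧ l < 1 ∧ ∀ x ∈ Ω, r x * Q / pstar s p x ≤ l := by
    rcases Ω.eq_empty_or_nonempty with rfl | hne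
    · exact ⟨1 / 2, by norm_num, by norm_num, by simp⟩
    obtain ⟨x0, -, hx0⟩ := hΩb.isCompact_closure.exists_isMaxOn (hne.mono subset_closure)
      hratio.continuousOn
    have hp0 := one_pos.trans (hpgt x0)
    have hr0 := one_pos.trans (hr1 x0)
    exact ⟨_, by positivity, (div_lt_one hp0).2 (hrM x0).2.2, fun x hx => hx0 (subset_closure hx)⟩
  set l' := (1 + l) / 2 with hl'
  have hl'l : l < l' := by rw [hl']; linarith
  set b0 := Q * l' / l with hb0
  have hQb0 : Q < b0 := by
    rw [hb0, lt_div_iff₀ hl0]; gcongr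
  set a := (Q + min 2 b0) / 2 with ha
  have hm1 : Q < min 2 b0 := lt_min hQ2 hQb0
  have hQa : Q < a := by rw [ha]; linarith
  have ha2 : a < 2 := by rw [ha]; linarith [min_le_left 2 b0]
  have hab : a < b0 := by rw [ha]; linarith [min_le_right 2 b0]
  have ha1 : 1 < a := hQ1.trans hQa
  have ha0 : 0 < a := by linarith
  have ha1' : 0 < a - 1 := by linarith
  set t := a / (2 * (a - 1)) with ht
  have ht0 : 0 < t := by positivity
  set d := N * (2 - 2 / Q) * t with hd
  have hQ0 : 0 < Q := by linarith
  have hdN : d < N := by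
    have : (2 - 2 / Q) * t < 1 := by
      rw [ht, ← mul_div_assoc, div_lt_one (by positivity)]
      have : (2 - 2 / Q) * a = 2 * (a * (Q - 1)) / Q := by field_simp
      rw [this, div_lt_iff₀ hQ0]
      nlinarith
    rw [hd, mul_assoc]
    exact mul_lt_of_lt_one_right hN this
  have hd0 : 0 < d := by
    have : 2 / Q < 2 := by rw [div_lt_iff₀ hQ0]; linarith
    have : 0 < 2 - 2 / Q := by linarith
    positivity
  set c := min (b0 / a) ((1 + N / d) / 2) with hc
  have hc1 : 1 < c := by
    refine lt_min ((one_lt_div ha0).2 hab) ?_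
    have := (one_lt_div hd0).2 hdN
    linarith
  have hc0 : 0 < c := by linarith
  have hac : a * c ≤ b0 := by
    calc a * c ≤ a * (b0 / a) := by gcongr; exact min_le_left _ _
      _ = b0 := by field_simp
  set m0 := (d + N) / 2 with hm0
  have hdc : d * c ≤ m0 := by
    calc d * c ≤ d * ((1 + N / d) / 2) := by gcongr; exact min_le_right _ _
      _ = m0 := by rw [hm0]; field_simp
  have hm0N : m0 < N := by rw [hm0]; linarith
  have hvol : volume Ω ≠ ⊤ := hΩb.measure_lt_top.ne
  obtain ⟨K, hK0, hK⟩ := lintegral_riesz_le h.dim_pos hm0N hvol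
  have hμt : ∀ x y, μ x y * (c * t) ≤ m0 := by
    intro x y
    have hq0 : 0 < q x y := one_pos.trans (hqgt x y)
    calc μ x y * (c * t) ≤ (N * (2 - 2 / Q)) * (c * t) := by
          rw [hμeq]
          gcongr
          exact hqQ x y
      _ = d * c := by rw [hd]; ring
      _ ≤ m0 := hdc
  obtain ⟨hk1, hk2⟩ := hK μ (c * t) (by positivity) hμpos hμt
  have hriesz : Measurable (riesz μ) := by
    have hqm := hqc.measurable
    have hμm : Measurable fun z : RN N × RN N => μ z.1 z.2 := by
      simp only [hμeq]; fun_prop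
    unfold riesz
    fun_prop
  have hpow : PowerBounded Ω s p fun x => r x * (a * c) := by
    have hrm := hrc.measurable
    refine h.powerBounded_subcritical hΩo.measurableSet hΩb (by fun_prop) (l := l')
      (by rw [hl']; linarith) (fun x _ => ?_) fun x hx => ?_
    · have := hr1 x; positivity
    · have hp0 := one_pos.trans (hpgt x)
      have h1 := hl x hx
      rw [div_le_iff₀ hp0] at h1
      have hr0 := hr1 x
      calc r x * (a * c) ≤ r x * b0 := by gcongr
        _ = (r x * Q) * (l' / l) := by rw [hb0]; ring
        _ ≤ (l * pstar s p x) * (l' / l) := by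
          gcongr
        _ = l' * pstar s p x := by field_simp
  refine ⟨a * c, c, K, ⟨hΩo.measurableSet, hvol, hf, hf1, hf2, hΘ, hrc.measurable, hr1, hc1,
    by positivity, hK0, hriesz, hμs, hpow, ?_⟩, ?_⟩
  · intro φ ψ hφ hψ hφi hψi
    have : IsFiniteMeasure (volume.restrict Ω) :=
      ⟨by rw [Measure.restrict_apply_univ]; exact lt_top_iff_ne_top.2 hvol⟩
    have e1 : ∀ (g : RN N → ℝ) x, (|g x| ^ c) ^ a = |g x| ^ (a * c) := fun g x => by
      rw [← Real.rpow_mul (abs_nonneg _), mul_comm c a]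
    have e2 : ∀ z : RN N × RN N, (riesz μ z ^ c) ^ t = riesz μ z ^ (c * t) := fun z => by
      rw [← Real.rpow_mul (riesz_nonneg μ z)]
    have e3 : ∀ z : RN N × RN N, |φ z.1 * ψ z.2 * riesz μ z| ^ c =
        |φ z.1| ^ c * |ψ z.2| ^ c * riesz μ z ^ c := fun z => by
      have := riesz_nonneg μ z
      rw [abs_mul, abs_mul, abs_of_nonneg this, Real.mul_rpow (by positivity) this,
        Real.mul_rpow (by positivity) (by positivity)]
    have key := integrable_mul_mul_kernel (m := volume.restrict Ω) (X := fun x => |φ x| ^ c)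
      (Y := fun x => |ψ x| ^ c) (κ := fun z => riesz μ z ^ c) hK0 ha1 ha2 (by fun_prop)
      (by fun_prop) (fun x => by positivity) (fun x => by positivity)
      (by simpa only [e1, IntegrableOn] using hφi)
      (by simpa only [e1, IntegrableOn] using hψi) (by fun_prop)
      (fun z => by have := riesz_nonneg μ z; positivity) (by simpa only [← ht, e2] using hk1)
      (by simpa only [← ht, e2] using hk2)
    simp only [e1] at key
    simp only [e3]
    exact key
  · refine hpow.mono hΩo.measurableSet hΩb ?_ (fun x _ => (h.p_pos x x).le) fun x _ => ?_
    · exact (h.p_cont.comp (continuous_id.prodMk continuous_id)).measurable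
    · have h1 := hrM x
      have hr0 := hr1 x
      calc p x x ≤ r x * Q := h1.1.trans h1.2.1
        _ ≤ r x * (a * c) := by
          gcongr
          nlinarith

section Pointwise

variable {a b p p2 : ℝ}

theorem abs_add_rpow_le (hp : 0 ≤ p) (hp2 : p ≤ p2) (a b : ℝ) :
    |a + b| ^ p ≤ 2 ^ p2 * (|a| ^ p + |b| ^ p) := by
  have h1 : |a + b| ≤ 2 * max |a| |b| := by
    have := abs_add_le a b
    have := le_max_left |a| |b|
    have := le_max_right |a| |b|
    linarith
  calc |a + b| ^ p ≤ (2 * max |a| |b|) ^ p := by gcongr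
    _ = 2 ^ p * max |a| |b| ^ p := Real.mul_rpow (by norm_num) (by positivity)
    _ ≤ 2 ^ p2 * (|a| ^ p + |b| ^ p) := by
      gcongr
      · norm_num
      · rcases max_cases |a| |b| with ⟨he, -⟩ | ⟨he, -⟩ <;> rw [he]
        · exact le_add_of_nonneg_right (by positivity)
        · exact le_add_of_nonneg_left (by positivity)

theorem abs_mul_rpow_le (hp : 0 ≤ p) (hp2 : p ≤ p2) (c a : ℝ) :
    |c * a| ^ p ≤ max 1 (|c| ^ p2) * |a| ^ p := by
  rw [abs_mul, Real.mul_rpow (abs_nonneg _) (abs_nonneg _)]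
  gcongr
  rcases le_total |c| 1 with h | h
  · exact (Real.rpow_le_one (abs_nonneg _) h hp).trans (le_max_left _ _)
  · exact (Real.rpow_le_rpow_of_exponent_le h hp2).trans (le_max_right _ _)

theorem abs_rpow_sub_two_mul_self_mul (hp : 1 < p) (a b : ℝ) :
    |(|a| ^ (p - 2) * a * b)| = |a| ^ (p - 1) * |b| := by
  rw [abs_mul, abs_mul, abs_of_nonneg (by positivity : 0 ≤ |a| ^ (p - 2)),
    ← Real.rpow_add_one' (abs_nonneg a) (by linarith)]
  congr 2; ring

theorem abs_pairing_le (hp : 1 < p) (a b : ℝ) :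
    |(|a| ^ (p - 2) * a * b)| ≤ |a| ^ p + |b| ^ p := by
  rw [abs_rpow_sub_two_mul_self_mul hp]
  calc |a| ^ (p - 1) * |b| ≤ max |a| |b| ^ (p - 1) * max |a| |b| := by
        gcongr
        · exact le_max_left _ _
        · exact le_max_right _ _
    _ = max |a| |b| ^ p := by
      rw [← Real.rpow_add_one' (by positivity) (by linarith)]; norm_num
    _ ≤ _ := by
      rcases max_cases |a| |b| with ⟨he, -⟩ | ⟨he, -⟩ <;> rw [he]
      · exact le_add_of_nonneg_right (by positivity)
      · exact le_add_of_nonneg_left (by positivity)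

theorem abs_rpow_sub_two_mul_self_mul_self (hp : 1 < p) (a : ℝ) :
    |a| ^ (p - 2) * a * a = |a| ^ p := by
  rcases eq_or_ne a 0 with rfl | ha
  · simp [Real.zero_rpow (by linarith : p ≠ 0)]
  · have : 0 < |a| := abs_pos.2 ha
    rw [mul_assoc, ← abs_mul_abs_self a, ← pow_two, ← Real.rpow_natCast |a| 2,
      ← Real.rpow_add this]
    norm_num

/-- The subgradient inequality for `|·|^p / p`. -/
theorem rpow_subgradient (hp : 1 < p) (a b : ℝ) :
    |a| ^ (p - 2) * a * (b - a) ≤ |b| ^ p / p - |a| ^ p / p := by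
  have hp0 : 0 < p := by linarith
  have h1 : |a| ^ (p - 2) * a * b ≤ |a| ^ (p - 1) * |b| :=
    (le_abs_self _).trans_eq (abs_rpow_sub_two_mul_self_mul hp a b)
  have hc : p.HolderConjugate (p / (p - 1)) := Real.HolderConjugate.conjExponent hp
  have h2 := Real.young_inequality_of_nonneg (by positivity : 0 ≤ |b|)
    (by positivity : 0 ≤ |a| ^ (p - 1)) hc
  rw [← Real.rpow_mul (abs_nonneg a)] at h2
  have hp1 : p - 1 ≠ 0 := by linarith
  rw [show (p - 1) * (p / (p - 1)) = p by field_simp] at h2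
  have h3 : |a| ^ p / (p / (p - 1)) = |a| ^ p - |a| ^ p / p := by field_simp
  rw [mul_sub, abs_rpow_sub_two_mul_self_mul_self hp]
  linarith

theorem hasDerivAt_abs_rpow_div (hp : 1 < p) (t : ℝ) :
    HasDerivAt (fun t : ℝ => |t| ^ p / p) (|t| ^ (p - 2) * t) t := by
  have := (hasDerivAt_abs_rpow t hp).div_const p
  refine this.congr_deriv ?_
  field_simp

theorem continuous_abs_rpow_sub_two_mul (hp : 1 < p) :
    Continuous fun t : ℝ => |t| ^ (p - 2) * t := by
  refine continuous_iff_continuousAt.2 fun t => ?_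
  rcases eq_or_ne t 0 with rfl | ht
  · have h0 : Tendsto (fun t : ℝ => |t| ^ (p - 1)) (nhds 0) (nhds 0) := by
      have : Continuous fun t : ℝ => |t| ^ (p - 1) :=
        continuous_abs.rpow_const fun _ => Or.inr (by linarith)
      have h := this.tendsto 0
      rwa [abs_zero, Real.zero_rpow (by linarith)] at h
    have hz : |(0 : ℝ)| ^ (p - 2) * 0 = 0 := mul_zero _
    unfold ContinuousAt
    simp only [hz]
    refine squeeze_zero_norm (fun t => ?_) h0
    have := abs_rpow_sub_two_mul_self_mul hp t 1
    rw [mul_one, abs_one, mul_one] at this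
    exact this.le
  · exact (continuousAt_id.abs.rpow_const (Or.inl (abs_ne_zero.2 ht))).mul continuousAt_id

end Pointwise

/-- The density of the energy pairing. -/
def pairDens (s p : RN N → RN N → ℝ) (u w : RN N → ℝ) (z : RN N × RN N) : ℝ :=
  |u z.1 - u z.2| ^ (p z.1 z.2 - 2) * (u z.1 - u z.2) * (w z.1 - w z.2) * kern s p z

/-- The energy `∫ |u(x) - u(y)|^p / (p |x - y|^{N + s p})`. -/
def energy (s p : RN N → RN N → ℝ) (u : RN N → ℝ) : ℝ :=
  ∫ z : RN N × RN N, gdens s p u z / p z.1 z.2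

section Energy

variable {Ω : Set (RN N)} {s p : RN N → RN N → ℝ} {s0 s1 p1 p2 : ℝ} {u v w : RN N → ℝ}

theorem energyLHS_eq (u w : RN N → ℝ) : energyLHS s p u w = ∫ z, pairDens s p u w z := rfl

namespace Exponents

variable (h : Exponents s p s0 s1 p1 p2)
include h

theorem gmod_le_of_le {c : ℝ} (hc : 0 ≤ c) (hu : Measurable u)
    (hle : ∀ z, gdens s p v z ≤ c * gdens s p u z) :
    gmod s p v ≤ ENNReal.ofReal c * gmod s p u := by
  unfold gmod
  have := (h.measurable_gdens hu).ennreal_ofReal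
  rw [← lintegral_const_mul _ this]
  refine lintegral_mono fun z => ?_
  rw [← ENNReal.ofReal_mul hc]
  exact ENNReal.ofReal_le_ofReal (hle z)

theorem gmod_const_mul_le (hu : Measurable u) (c : ℝ) :
    gmod s p (fun x => c * u x) ≤ ENNReal.ofReal (max 1 (|c| ^ p2)) * gmod s p u := by
  refine h.gmod_le_of_le (by positivity) hu fun z => ?_
  unfold gdens
  rw [← mul_assoc, ← mul_sub]
  have := kern_nonneg (s := s) (p := p) z
  gcongr
  exact abs_mul_rpow_le (h.p_pos _ _).le (h.le_p2 _ _) _ _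

theorem finMod_zero : FinMod Ω s p fun _ => 0 := by
  refine ⟨measurable_const, ae_of_all _ fun _ _ => rfl, ?_⟩
  have : ∀ z : RN N × RN N, (0 : ℝ) ^ p z.1 z.2 = 0 := fun z => Real.zero_rpow (h.p_pos _ _).ne'
  simp [gmod, gdens, this]

theorem finMod_const_mul (hu : FinMod Ω s p u) (c : ℝ) : FinMod Ω s p fun x => c * u x := by
  refine ⟨hu.meas.const_mul c, ?_, ?_⟩
  · filter_upwards [hu.zero] with x hx hxΩ
    rw [hx hxΩ, mul_zero]
  · exact (h.gmod_const_mul_le hu.meas c).trans_lt (ENNReal.mul_lt_top ENNReal.ofReal_lt_top hu.fin)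

theorem finMod_abs (hu : FinMod Ω s p u) : FinMod Ω s p fun x => |u x| := by
  have hum := hu.meas
  refine ⟨by fun_prop, ?_, ?_⟩
  · filter_upwards [hu.zero] with x hx hxΩ
    rw [hx hxΩ, abs_zero]
  · refine lt_of_le_of_lt (lintegral_mono fun z => ENNReal.ofReal_le_ofReal ?_) hu.fin
    unfold gdens
    exact mul_le_mul_of_nonneg_right (Real.rpow_le_rpow (abs_nonneg _)
      (abs_abs_sub_abs_le_abs_sub (u z.1) (u z.2)) (h.p_pos z.1 z.2).le) (kern_nonneg z)

theorem gdens_add_le (u v : RN N → ℝ) (z : RN N × RN N) :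
    gdens s p (fun x => u x + v x) z ≤ 2 ^ p2 * (gdens s p u z + gdens s p v z) := by
  unfold gdens
  have := kern_nonneg (s := s) (p := p) z
  rw [← add_mul, ← mul_assoc, show u z.1 + v z.1 - (u z.2 + v z.2) =
    (u z.1 - u z.2) + (v z.1 - v z.2) by ring]
  gcongr
  exact abs_add_rpow_le (h.p_pos _ _).le (h.le_p2 _ _) _ _

theorem finMod_add (hu : FinMod Ω s p u) (hv : FinMod Ω s p v) :
    FinMod Ω s p fun x => u x + v x := by
  refine ⟨hu.meas.add hv.meas, ?_, ?_⟩
  · filter_upwards [hu.zero, hv.zero] with x hx hx' hxΩ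
    rw [hx hxΩ, hx' hxΩ, add_zero]
  · calc gmod s p (fun x => u x + v x)
        ≤ ∫⁻ z, ENNReal.ofReal (2 ^ p2) *
          (ENNReal.ofReal (gdens s p u z) + ENNReal.ofReal (gdens s p v z)) := by
          refine lintegral_mono fun z => ?_
          rw [← ENNReal.ofReal_add (gdens_nonneg z) (gdens_nonneg z),
            ← ENNReal.ofReal_mul (by positivity)]
          exact ENNReal.ofReal_le_ofReal (h.gdens_add_le u v z)
      _ = ENNReal.ofReal (2 ^ p2) * (gmod s p u + gmod s p v) := by
          have h1 := (h.measurable_gdens hu.meas).ennreal_ofReal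
          have h2 := (h.measurable_gdens hv.meas).ennreal_ofReal
          unfold gmod
          rw [← lintegral_add_left h1, ← lintegral_const_mul _ (by fun_prop)]
      _ < ⊤ := ENNReal.mul_lt_top ENNReal.ofReal_lt_top (ENNReal.add_lt_top.2 ⟨hu.fin, hv.fin⟩)

theorem finMod_sum {ι : Type*} (t : Finset ι) {e : ι → RN N → ℝ}
    (he : ∀ i, FinMod Ω s p (e i)) : FinMod Ω s p fun x => ∑ i ∈ t, e i x := by
  classical
  induction t using Finset.induction_on with
  | empty => simpa using h.finMod_zero
  | insert i t hi ih =>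
    simp only [Finset.sum_insert hi]
    exact h.finMod_add (he i) ih

theorem integrable_gdens (hu : FinMod Ω s p u) : Integrable (gdens s p u) := by
  refine ⟨(h.measurable_gdens hu.meas).aestronglyMeasurable, ?_⟩
  rw [hasFiniteIntegral_iff_ofReal (ae_of_all _ gdens_nonneg)]
  exact hu.fin

theorem integral_gdens (hu : FinMod Ω s p u) :
    ENNReal.ofReal (∫ z, gdens s p u z) = gmod s p u :=
  ofReal_integral_eq_lintegral_ofReal (h.integrable_gdens hu) (ae_of_all _ gdens_nonneg)

theorem measurable_p : Measurable fun z : RN N × RN N => p z.1 z.2 := h.p_cont.measurable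

theorem gdens_div_le (u : RN N → ℝ) (z : RN N × RN N) :
    gdens s p u z / p z.1 z.2 ≤ gdens s p u z :=
  div_le_self (gdens_nonneg z) (h.p_gt _ _).le

theorem le_gdens_div (u : RN N → ℝ) (z : RN N × RN N) :
    gdens s p u z ≤ p2 * (gdens s p u z / p z.1 z.2) := by
  have h1 := h.p_pos z.1 z.2
  have h2 := h.le_p2 z.1 z.2
  have h3 := gdens_nonneg (s := s) (p := p) (u := u) z
  rw [← mul_div_assoc, le_div_iff₀ h1, mul_comm]
  gcongr

theorem gdens_div_nonneg (u : RN N → ℝ) (z : RN N × RN N) : 0 ≤ gdens s p u z / p z.1 z.2 :=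
  div_nonneg (gdens_nonneg z) (h.p_pos _ _).le

theorem integrable_gdens_div (hu : FinMod Ω s p u) :
    Integrable fun z : RN N × RN N => gdens s p u z / p z.1 z.2 := by
  have h1 := h.measurable_gdens hu.meas
  have h2 := h.measurable_p
  have hm : Measurable fun z : RN N × RN N => gdens s p u z / p z.1 z.2 := by fun_prop
  refine (h.integrable_gdens hu).mono' hm.aestronglyMeasurable (ae_of_all _ fun z => ?_)
  rw [Real.norm_eq_abs, abs_of_nonneg (h.gdens_div_nonneg u z)]
  exact h.gdens_div_le u z

theorem energy_nonneg (u : RN N → ℝ) : 0 ≤ energy s p u :=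
  integral_nonneg (h.gdens_div_nonneg u)

theorem integral_gdens_le (hu : FinMod Ω s p u) : ∫ z, gdens s p u z ≤ p2 * energy s p u := by
  unfold energy
  rw [← integral_const_mul]
  exact integral_mono (h.integrable_gdens hu) ((h.integrable_gdens_div hu).const_mul _)
    (h.le_gdens_div u)

theorem gmod_le_energy (hu : FinMod Ω s p u) :
    gmod s p u ≤ ENNReal.ofReal (p2 * energy s p u) := by
  rw [← h.integral_gdens hu]
  exact ENNReal.ofReal_le_ofReal (h.integral_gdens_le hu)

theorem energy_const_mul_le (hu : FinMod Ω s p u) (c : ℝ) :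
    energy s p (fun x => c * u x) ≤ max 1 (|c| ^ p2) * energy s p u := by
  unfold energy
  rw [← integral_const_mul]
  refine integral_mono (h.integrable_gdens_div (h.finMod_const_mul hu c))
    ((h.integrable_gdens_div hu).const_mul _) fun z => ?_
  have hk := kern_nonneg (s := s) (p := p) z
  have hp := h.p_pos z.1 z.2
  simp only [gdens]
  rw [← mul_sub, ← mul_div_assoc, ← mul_assoc]
  gcongr
  exact abs_mul_rpow_le hp.le (h.le_p2 _ _) _ _

theorem measurable_pairDens (hu : Measurable u) (hw : Measurable w) :
    Measurable (pairDens s p u w) := by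
  have h2 := h.p_cont.measurable
  have h3 := h.measurable_kern
  unfold pairDens
  fun_prop

theorem abs_pairDens_le (u w : RN N → ℝ) (z : RN N × RN N) :
    |pairDens s p u w z| ≤ gdens s p u z + gdens s p w z := by
  have hk := kern_nonneg (s := s) (p := p) z
  unfold pairDens gdens
  rw [abs_mul, abs_of_nonneg hk, ← add_mul]
  gcongr
  exact abs_pairing_le (h.p_gt _ _) _ _

theorem integrable_pairDens (hu : FinMod Ω s p u) (hw : FinMod Ω s p w) :
    Integrable (pairDens s p u w) :=
  ((h.integrable_gdens hu).add (h.integrable_gdens hw)).mono'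
    (h.measurable_pairDens hu.meas hw.meas).aestronglyMeasurable
    (ae_of_all _ (h.abs_pairDens_le u w))

theorem pairDens_self (u : RN N → ℝ) (z : RN N × RN N) :
    pairDens s p u u z = gdens s p u z := by
  unfold pairDens gdens
  rw [abs_rpow_sub_two_mul_self_mul_self (h.p_gt _ _)]

/-- Convexity of the energy: the subgradient inequality. -/
theorem energy_le_add (hu : FinMod Ω s p u) (hv : FinMod Ω s p v) :
    energy s p u ≤ energy s p v + (energyLHS s p u u - energyLHS s p u v) := by
  simp only [energyLHS_eq, energy]
  have hadd := integral_add' (h.integrable_gdens_div hv)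
      ((h.integrable_pairDens hu hu).sub (h.integrable_pairDens hu hv))
  rw [integral_sub' (h.integrable_pairDens hu hu) (h.integrable_pairDens hu hv)] at hadd
  rw [← hadd]
  refine integral_mono (h.integrable_gdens_div hu) ((h.integrable_gdens_div hv).add
      ((h.integrable_pairDens hu hu).sub (h.integrable_pairDens hu hv))) fun z => ?_
  have hk := kern_nonneg (s := s) (p := p) z
  have := mul_le_mul_of_nonneg_right
    (rpow_subgradient (h.p_gt z.1 z.2) (u z.1 - u z.2) (v z.1 - v z.2)) hk
  simp only [pairDens, gdens, Pi.add_apply, Pi.sub_apply]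
  ring_nf at this ⊢
  linarith

end Exponents

end Energy

section Convergence

variable {Ω : Set (RN N)} {s p : RN N → RN N → ℝ} {s0 s1 p1 p2 : ℝ}

/-- Convergence of the energy and of its derivative along a sequence converging almost everywhere
without loss of energy. -/
theorem Exponents.tendsto_energy (h : Exponents s p s0 s1 p1 p2) {u : ℕ → RN N → ℝ}
    {v : RN N → ℝ} (hu : ∀ n, FinMod Ω s p (u n)) (hv : FinMod Ω s p v)
    (hlim : ∀ᵐ x, Tendsto (fun n => u n x) atTop (nhds (v x))) {ε : ℕ → ℝ}
    (hε : Tendsto ε atTop (nhds 0)) (hle : ∀ n, energy s p (u n) ≤ energy s p v + ε n) :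
    Tendsto (fun n => energy s p (u n)) atTop (nhds (energy s p v)) ∧
      ∀ w, FinMod Ω s p w →
        Tendsto (fun n => energyLHS s p (u n) w) atTop (nhds (energyLHS s p v w)) := by
  have hl : ∀ᵐ z, Tendsto (fun n => gdens s p (u n) z / p z.1 z.2) atTop
      (nhds (gdens s p v z / p z.1 z.2)) := by
    filter_upwards [h.tendsto_gdens hlim] with z hz using hz.div_const _
  constructor
  · refine tendsto_integral_of_dominated_seq (ψ := fun _ => 0)
      (fun n => h.integrable_gdens_div (hu n)) (h.integrable_gdens_div hv) (integrable_zero _ _ _)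
      (fun n => h.gdens_div_nonneg (u n)) (h.gdens_div_nonneg v) (fun _ => le_rfl) hl hε hle
      zero_le_one (fun n => (h.integrable_gdens_div (hu n)).aestronglyMeasurable)
      (fun n z => ?_) hl
    rw [abs_of_nonneg (h.gdens_div_nonneg _ z)]; simp
  · intro w hw
    have hp2 : 1 < p2 := h.p2_gt
    refine tendsto_integral_of_dominated_seq (c := p2)
      (fun n => h.integrable_gdens_div (hu n)) (h.integrable_gdens_div hv)
      (h.integrable_gdens hw) (fun n => h.gdens_div_nonneg (u n)) (h.gdens_div_nonneg v)
      gdens_nonneg hl hε hle (by linarith)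
      (fun n => (h.integrable_pairDens (hu n) hw).aestronglyMeasurable) (fun n z => ?_) ?_
    · refine (h.abs_pairDens_le (u n) w z).trans ?_
      rw [mul_add]
      have h1 := h.le_gdens_div (u n) z
      have h2 := gdens_nonneg (s := s) (p := p) (u := w) z
      nlinarith
    · filter_upwards [ae_prod_of_ae hlim] with z hz
      have := ((continuous_abs_rpow_sub_two_mul (h.p_gt z.1 z.2)).tendsto _).comp (hz.1.sub hz.2)
      exact (this.mul_const _).mul_const _

end Convergence

section Membership

variable {Ω : Set (RN N)} {s p : RN N → RN N → ℝ} {s0 s1 p1 p2 : ℝ} {u : RN N → ℝ}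

theorem Exponents.gmodular_integrand (h : Exponents s p s0 s1 p1 p2) {l : ℝ} (hl : 0 < l)
    (z : RN N × RN N) :
    ENNReal.ofReal (|u z.1 - u z.2| / l) ^ p z.1 z.2 /
      ENNReal.ofReal (dist z.1 z.2) ^ ((N : ℝ) + s z.1 z.2 * p z.1 z.2) =
    ENNReal.ofReal (gdens s p (fun x => l⁻¹ * u x) z) := by
  have hp := h.p_pos z.1 z.2
  have he := h.exponent_pos z.1 z.2
  unfold gdens kern
  rw [← mul_sub, abs_mul, abs_of_pos (inv_pos.2 hl), inv_mul_eq_div,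
    ENNReal.ofReal_rpow_of_nonneg (by positivity) hp.le,
    ENNReal.ofReal_rpow_of_nonneg dist_nonneg he.le]
  rcases eq_or_ne z.1 z.2 with h0 | h0
  · simp [h0, Real.zero_rpow (h.p_pos z.2 z.2).ne']
  · have hd : 0 < dist z.1 z.2 := dist_pos.2 h0
    rw [← div_eq_mul_inv, ENNReal.ofReal_div_of_pos (by positivity)]

/-- Members of `X₀` have finite modular on the whole space. -/
theorem Exponents.finMod_of_memX0 (h : Exponents s p s0 s1 p1 p2) (hΩ : MeasurableSet Ω)
    {β : RN N → ℝ} (hu : MemX0 Ω s p β u) : FinMod Ω s p u := by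
  obtain ⟨hm, -, ⟨l, hl, hfin⟩, hz⟩ := hu
  have hQ : MeasurableSet (Qset Ω) := MeasurableSet.univ.diff (hΩ.compl.prod hΩ.compl)
  have hl' : FinMod Ω s p fun x => l⁻¹ * u x := by
    refine ⟨hm.const_mul _, ?_, ?_⟩
    · filter_upwards [hz] with x hx hxΩ
      rw [hx hxΩ, mul_zero]
    · unfold gmodular at hfin
      simp only [h.gmodular_integrand hl] at hfin
      rw [← lintegral_indicator hQ] at hfin
      refine lt_of_le_of_lt (lintegral_mono_ae ?_) hfin
      filter_upwards [ae_prod_of_ae hz] with z hzz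
      by_cases hzQ : z ∈ Qset Ω
      · rw [indicator_of_mem hzQ]
      · have hmem : z.1 ∉ Ω ∧ z.2 ∉ Ω := by
          simpa [Qset] using hzQ
        simp [gdens, hzz.1 hmem.1, hzz.2 hmem.2, Real.zero_rpow (h.p_pos z.1 z.2).ne']
  have := h.finMod_const_mul hl' l
  simpa [mul_inv_cancel_left₀ hl.ne'] using this

/-- Conversely, functions of finite modular belong to `X₀`. -/
theorem Exponents.memX0_of_finMod (h : Exponents s p s0 s1 p1 p2)
    (hpow : PowerBounded Ω s p fun x => p x x) (hu : FinMod Ω s p u) :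
    MemX0 Ω s p (fun x => p x x) u := by
  refine ⟨hu.meas, ⟨hu.meas, 1, one_pos, ?_⟩, ⟨1, one_pos, ?_⟩, hu.zero⟩
  · obtain ⟨C, hC⟩ := hpow (gmod s p u).toReal
    have hi := (hC u hu (ENNReal.ofReal_toReal hu.fin.ne).ge).1
    have := hi.hasFiniteIntegral
    rw [hasFiniteIntegral_iff_ofReal (ae_of_all _ fun x => by positivity)] at this
    unfold lmodular
    simpa only [div_one, ENNReal.ofReal_rpow_of_nonneg (abs_nonneg _) (h.p_pos _ _).le] using this
  · unfold gmodular
    simp only [h.gmodular_integrand one_pos, inv_one, one_mul]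
    exact (setLIntegral_le_lintegral _ _).trans_lt hu.fin

end Membership

section Bump

variable {Ω : Set (RN N)} {s p : RN N → RN N → ℝ} {s0 s1 p1 p2 : ℝ}

/-- A translation invariant majorant of the energy density of Lipschitz bumps. -/
theorem Exponents.exists_lipschitz_majorant (h : Exponents s p s0 s1 p1 p2) :
    ∃ W : RN N → ℝ≥0∞, Measurable W ∧ ∫⁻ x, W x < ⊤ ∧ ∀ u : RN N → ℝ,
      (∀ x y, |u x - u y| ≤ dist x y) → (∀ x y, |u x - u y| ≤ 1) →
      ∀ z, ENNReal.ofReal (gdens s p u z) ≤ W (z.1 - z.2) := by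
  have hN := h.dim_pos'
  have hs1 := h.s1_lt
  have hs0 := h.s0_pos
  set m := (N : ℝ) - (1 - s1) with hm
  set W1 : RN N → ℝ≥0∞ := (Metric.ball 0 1).indicator fun x => ENNReal.ofReal (‖x‖ ^ (-m))
  set W2 : RN N → ℝ≥0∞ := fun x =>
    ENNReal.ofReal (2 ^ ((N : ℝ) + s0) * (1 + ‖x‖) ^ (-((N : ℝ) + s0)))
  have hW1m : Measurable W1 := Measurable.indicator (by fun_prop) measurableSet_ball
  have hW2m : Measurable W2 := by fun_prop
  have hW1 : ∫⁻ x, W1 x < ⊤ := by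
    rw [lintegral_indicator measurableSet_ball]
    have := (integrableOn_ball_norm_rpow h.dim_pos (m := m) (by rw [hm]; linarith)).hasFiniteIntegral
    rwa [hasFiniteIntegral_iff_ofReal (ae_of_all _ fun h => by positivity)] at this
  have hW2 : ∫⁻ x, W2 x < ⊤ := by
    have := (((integrable_one_add_norm (E := RN N) (μ := volume) (r := (N : ℝ) + s0)
      (by rw [finrank_euclideanSpace, Fintype.card_fin]; linarith)).const_mul
      (2 ^ ((N : ℝ) + s0)))).hasFiniteIntegral
    rwa [hasFiniteIntegral_iff_ofReal (ae_of_all _ fun h => by positivity)] at this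
  refine ⟨fun x => W1 x + W2 x, hW1m.add hW2m, ?_, fun u hu1 hu2 z => ?_⟩
  · rw [lintegral_add_left hW1m]
    exact ENNReal.add_lt_top.2 ⟨hW1, hW2⟩
  have hp := h.p_gt z.1 z.2
  have hsp := h.exponent_pos z.1 z.2
  rcases eq_or_ne z.1 z.2 with h0 | h0
  · have : gdens s p u z = 0 := by
      simp [gdens, h0, Real.zero_rpow (by have := h.p_pos z.2 z.2; linarith : p z.2 z.2 ≠ 0)]
    simp [this]
  have hd : 0 < dist z.1 z.2 := dist_pos.2 h0
  have hd' : dist z.1 z.2 = ‖z.1 - z.2‖ := dist_eq_norm _ _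
  have h1 := hu1 z.1 z.2
  have h2 := hu2 z.1 z.2
  unfold gdens kern
  rw [← Real.rpow_neg hd.le]
  by_cases hlt : dist z.1 z.2 < 1
  · refine le_add_right ?_
    have hmem : z.1 - z.2 ∈ Metric.ball (0 : RN N) 1 := by simpa [← hd'] using hlt
    simp only [W1]
    rw [indicator_of_mem hmem]
    refine ENNReal.ofReal_le_ofReal ?_
    rw [← hd']
    calc |u z.1 - u z.2| ^ p z.1 z.2 * dist z.1 z.2 ^ (-((N : ℝ) + s z.1 z.2 * p z.1 z.2))
        ≤ dist z.1 z.2 ^ p z.1 z.2 * dist z.1 z.2 ^ (-((N : ℝ) + s z.1 z.2 * p z.1 z.2)) := by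
          gcongr
      _ = dist z.1 z.2 ^ (p z.1 z.2 * (1 - s z.1 z.2) - N) := by
          rw [← Real.rpow_add hd]; congr 1; ring
      _ ≤ _ := by
          refine Real.rpow_le_rpow_of_exponent_ge hd hlt.le ?_
          have := h.le_s1 z.1 z.2
          rw [hm]
          nlinarith
  · refine le_add_left ?_
    simp only [W2]
    refine ENNReal.ofReal_le_ofReal ?_
    rw [← hd']
    have hd1 : 1 ≤ dist z.1 z.2 := not_lt.1 hlt
    calc |u z.1 - u z.2| ^ p z.1 z.2 * dist z.1 z.2 ^ (-((N : ℝ) + s z.1 z.2 * p z.1 z.2))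
        ≤ 1 * dist z.1 z.2 ^ (-((N : ℝ) + s0)) := by
          gcongr
          · exact Real.rpow_le_one (abs_nonneg _) h2 (by linarith)
          have := h.s0_le z.1 z.2
          nlinarith
      _ = 2 ^ ((N : ℝ) + s0) * (2 * dist z.1 z.2) ^ (-((N : ℝ) + s0)) := by
          rw [Real.mul_rpow (by norm_num) hd.le, ← mul_assoc, ← Real.rpow_add (by norm_num)]
          simp
      _ ≤ _ := by
          refine mul_le_mul_of_nonneg_left ?_ (by positivity)
          exact Real.rpow_le_rpow_of_nonpos (by positivity) (by linarith) (by linarith)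

/-- A nontrivial function of finite modular supported in a given open set. -/
theorem Exponents.exists_bump (h : Exponents s p s0 s1 p1 p2) (hΩ : IsOpen Ω)
    (hne : Ω.Nonempty) : ∃ e, FinMod Ω s p e ∧ ¬ (∀ᵐ x, e x = 0) := by
  obtain ⟨x0, hx0⟩ := hne
  obtain ⟨δ', hδ', hball'⟩ := Metric.isOpen_iff.1 hΩ x0 hx0
  obtain ⟨δ, hδ, hδ1, hball⟩ : ∃ δ, 0 < δ ∧ δ ≤ 1 ∧ Metric.ball x0 δ ⊆ Ω :=
    ⟨min δ' 1, lt_min hδ' one_pos, min_le_right _ _,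
      (Metric.ball_subset_ball (min_le_left _ _)).trans hball'⟩
  set e : RN N → ℝ := fun x => max 0 (δ - dist x x0) with he
  set B := Metric.ball x0 δ with hB
  have hem : Measurable e := by fun_prop
  have he0 : ∀ x, x ∉ B → e x = 0 := fun x hx => by
    rw [hB, Metric.mem_ball, not_lt] at hx
    exact max_eq_left (by linarith)
  have hepos : ∀ x, 0 ≤ e x := fun x => le_max_left _ _
  have hele : ∀ x, e x ≤ 1 := fun x => max_le zero_le_one (by
    have : 0 ≤ dist x x0 := dist_nonneg
    linarith)
  have hlip : ∀ x y, |e x - e y| ≤ dist x y := by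
    intro x y
    refine (abs_max_sub_max_le_max _ _ _ _).trans ?_
    rw [sub_self, abs_zero]
    refine max_le dist_nonneg ?_
    rw [show δ - dist x x0 - (δ - dist y x0) = dist y x0 - dist x x0 by ring, dist_comm x y]
    exact abs_dist_sub_le _ _ _
  have hone : ∀ x y, |e x - e y| ≤ 1 := fun x y =>
    abs_le.2 ⟨by linarith [hepos x, hele y], by linarith [hepos y, hele x]⟩
  obtain ⟨W, hWm, hWi, hW⟩ := h.exists_lipschitz_majorant
  refine ⟨e, ⟨hem, ae_of_all _ fun x hx => he0 x fun hxB => hx (hball hxB), ?_⟩, fun hae => ?_⟩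
  · have hBm : MeasurableSet B := measurableSet_ball
    set I : RN N → ℝ≥0∞ := B.indicator fun _ => 1 with hI
    have hIm : Measurable I := measurable_const.indicator hBm
    have hpt : ∀ z : RN N × RN N, ENNReal.ofReal (gdens s p e z) ≤
        I z.1 * W (z.1 - z.2) + I z.2 * W (z.1 - z.2) := by
      intro z
      by_cases h1 : z.1 ∈ B
      · refine le_add_right ?_
        rw [hI, indicator_of_mem h1, one_mul]
        exact hW e hlip hone z
      by_cases h2 : z.2 ∈ B
      · refine le_add_left ?_
        rw [hI, indicator_of_mem h2, one_mul]
        exact hW e hlip hone z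
      · simp [gdens, he0 _ h1, he0 _ h2, Real.zero_rpow (h.p_pos z.1 z.2).ne']
    have hIi : ∫⁻ x, I x = volume B := by rw [hI, lintegral_indicator hBm]; simp
    have hBfin : volume B < ⊤ := measure_ball_lt_top
    calc gmod s p e ≤ ∫⁻ z : RN N × RN N, (I z.1 * W (z.1 - z.2) + I z.2 * W (z.1 - z.2)) :=
          lintegral_mono hpt
      _ = volume B * (∫⁻ x, W x) + volume B * ∫⁻ x, W x := by
          rw [lintegral_add_left (by fun_prop), Measure.volume_eq_prod,
            lintegral_prod _ (by fun_prop), lintegral_prod_symm' _ (by fun_prop)]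
          have k1 : ∀ x, ∫⁻ y, I x * W (x - y) = I x * ∫⁻ y, W y := fun x => by
            rw [lintegral_const_mul _ (by fun_prop), lintegral_sub_left_eq_self]
          have k2 : ∀ y, ∫⁻ x, I y * W (x - y) = I y * ∫⁻ x, W x := fun y => by
            rw [lintegral_const_mul _ (by fun_prop), lintegral_sub_right_eq_self]
          simp only [k1, k2, lintegral_mul_const _ hIm, hIi]
      _ < ⊤ := by
          have := ENNReal.mul_lt_top hBfin hWi
          exact ENNReal.add_lt_top.2 ⟨this, this⟩
  · have : volume B = 0 := by
      refine measure_mono_null (fun x hx => ?_) (ae_iff.1 hae)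
      have hx' : dist x x0 < δ := hx
      have : 0 < e x := lt_max_of_lt_right (by linarith)
      exact this.ne'
    exact (Metric.measure_ball_pos volume x0 hδ).ne' this

end Bump

/-- The Choquard potential `∫_Ω ∫_Ω F(x,u(x)) F(y,u(y)) |x - y|^{-μ(x,y)} dx dy`. -/
def pot (Ω : Set (RN N)) (μ : RN N → RN N → ℝ) (f : RN N → ℝ → ℝ) (u : RN N → ℝ) : ℝ :=
  bil Ω μ (fun x => Fant f x (u x)) fun x => Fant f x (u x)

/-- Half of the directional derivative of the Choquard potential. -/
def dpot (Ω : Set (RN N)) (μ : RN N → RN N → ℝ) (f : RN N → ℝ → ℝ) (u w : RN N → ℝ) : ℝ :=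
  bil Ω μ (fun x => Fant f x (u x)) fun x => f x (u x) * w x

namespace Choquard

variable {Ω : Set (RN N)} {s p μ : RN N → RN N → ℝ} {f : RN N → ℝ → ℝ} {M Θ : ℝ}
  {r : RN N → ℝ} {b c K : ℝ} (H : Choquard Ω s p μ f M Θ r b c K)
include H

theorem integrableOn_Fant {u : RN N → ℝ} (hu : FinMod Ω s p u) :
    IntegrableOn (fun x => |Fant f x (u x)| ^ b) Ω := by
  obtain ⟨C, hC⟩ := H.exists_moment_bound (gmod s p u).toReal
  exact (hC u hu (ENNReal.ofReal_toReal hu.fin.ne).ge).1.1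

theorem integrableOn_mul {u w : RN N → ℝ} (hu : FinMod Ω s p u) (hw : FinMod Ω s p w) :
    IntegrableOn (fun x => |f x (u x) * w x| ^ b) Ω := by
  obtain ⟨C, hC⟩ := H.exists_moment_bound (max (gmod s p u).toReal (gmod s p w).toReal)
  refine ((hC u hu ?_).2 w hw ?_).1
  · exact (ENNReal.ofReal_toReal hu.fin.ne).ge.trans
      (ENNReal.ofReal_le_ofReal (le_max_left _ _))
  · exact (ENNReal.ofReal_toReal hw.fin.ne).ge.trans
      (ENNReal.ofReal_le_ofReal (le_max_right _ _))

theorem measurable_mul {u w : RN N → ℝ} (hu : FinMod Ω s p u) (hw : FinMod Ω s p w) :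
    Measurable fun x => f x (u x) * w x :=
  (H.car.measurable_comp hu.meas).mul hw.meas

theorem integrable_pot {u : RN N → ℝ} (hu : FinMod Ω s p u) :
    Integrable (fun z : RN N × RN N => Fant f z.1 (u z.1) * Fant f z.2 (u z.2) * riesz μ z)
      ((volume.restrict Ω).prod (volume.restrict Ω)) :=
  H.integrable (H.car.measurable_Fant_comp hu.meas) (H.car.measurable_Fant_comp hu.meas)
    (H.integrableOn_Fant hu) (H.integrableOn_Fant hu)

theorem integrable_dpot {u w : RN N → ℝ} (hu : FinMod Ω s p u) (hw : FinMod Ω s p w) :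
    Integrable (fun z : RN N × RN N => Fant f z.1 (u z.1) * (f z.2 (u z.2) * w z.2) * riesz μ z)
      ((volume.restrict Ω).prod (volume.restrict Ω)) :=
  H.integrable (H.car.measurable_Fant_comp hu.meas) (H.measurable_mul hu hw)
    (H.integrableOn_Fant hu) (H.integrableOn_mul hu hw)

theorem choquardRHS_eq {u w : RN N → ℝ} (hu : FinMod Ω s p u) (hw : FinMod Ω s p w) :
    choquardRHS Ω μ f u w = dpot Ω μ f u w := by
  have := H.isFiniteMeasure
  unfold dpot bil choquardRHS
  rw [integral_prod _ (H.integrable_dpot hu hw)]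
  simp only [riesz, div_eq_mul_inv, mul_assoc]

theorem ae_Fant_nonneg (u : RN N → ℝ) : ∀ᵐ x, x ∈ Ω → 0 ≤ Fant f x (u x) := by
  filter_upwards [H.ar.Fant_pos H.Θ_pos] with x hx hxΩ
  rcases eq_or_ne (u x) 0 with h | h
  · rw [h, Fant_zero]
  · exact (hx hxΩ _ h).le

theorem pot_nonneg (u : RN N → ℝ) : 0 ≤ pot Ω μ f u := by
  refine integral_nonneg_of_ae ?_
  filter_upwards [ae_restrict_prod_of_ae H.meas_dom (H.ae_Fant_nonneg u)] with z hz
  exact mul_nonneg (mul_nonneg hz.1 hz.2) (riesz_nonneg _ _)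

theorem pot_pos (hN : 0 < N) {u : RN N → ℝ} (hu : FinMod Ω s p u) (hne : ¬ ∀ᵐ x, u x = 0) :
    0 < pot Ω μ f u := by
  have := H.isFiniteMeasure
  refine (H.pot_nonneg u).lt_of_ne' fun h0 => hne ?_
  have h1 := (integral_eq_zero_iff_of_nonneg_ae ?_ (H.integrable_pot hu)).1 h0
  · have h2 : ∀ᵐ z : RN N × RN N ∂((volume.restrict Ω).prod (volume.restrict Ω)),
        u z.1 = 0 ∨ u z.2 = 0 ∨ z.1 = z.2 := by
      filter_upwards [h1, ae_restrict_prod_of_ae H.meas_dom (H.ar.Fant_pos H.Θ_pos)]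
        with z hz hF
      by_contra! hcon
      have hd : 0 < riesz μ z := by
        have := dist_pos.2 hcon.2.2
        unfold riesz
        positivity
      exact (mul_pos (mul_pos (hF.1 _ hcon.1) (hF.2 _ hcon.2.1)) hd).ne' hz
    have : Nonempty (Fin N) := ⟨⟨0, hN⟩⟩
    have h3 : ∀ᵐ x ∂(volume.restrict Ω), u x = 0 ∨ ∀ᵐ y ∂(volume.restrict Ω), u y = 0 := by
      filter_upwards [Measure.ae_ae_of_ae_prod h2] with x hx
      refine or_iff_not_imp_left.2 fun hux => ?_
      filter_upwards [hx, Measure.ae_ne (volume.restrict Ω) x] with y hy hyx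
      rcases hy with h | h | h
      · exact absurd h hux
      · exact h
      · exact absurd h.symm hyx
    have h4 : ∀ᵐ x ∂(volume.restrict Ω), u x = 0 := by
      by_cases h : ∀ᵐ y ∂(volume.restrict Ω), u y = 0
      · exact h
      · filter_upwards [h3] with x hx using hx.resolve_right h
    filter_upwards [hu.zero, (ae_restrict_iff' H.meas_dom).1 h4] with x hx hx'
    by_cases hxΩ : x ∈ Ω
    · exact hx' hxΩ
    · exact hx hxΩ
  · filter_upwards [ae_restrict_prod_of_ae H.meas_dom (H.ae_Fant_nonneg u)] with z hz
    exact mul_nonneg (mul_nonneg hz.1 hz.2) (riesz_nonneg _ _)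

theorem rpow_mul_pot_le {u : RN N → ℝ} {τ : ℝ} (hu : FinMod Ω s p u)
    (hτu : FinMod Ω s p fun x => τ * u x) (hτ : 1 ≤ τ) :
    τ ^ Θ * pot Ω μ f u ≤ pot Ω μ f fun x => τ * u x := by
  unfold pot bil
  rw [← integral_const_mul]
  refine integral_mono_ae ((H.integrable_pot hu).const_mul _) (H.integrable_pot hτu) ?_
  filter_upwards [ae_restrict_prod_of_ae H.meas_dom (H.ae_Fant_nonneg u),
    ae_restrict_prod_of_ae H.meas_dom (H.ar.rpow_mul_Fant_le H.car)] with z h0 hz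
  have h1 := hz.1 (u z.1) τ hτ
  have h2 := hz.2 (u z.2) τ hτ
  have hτ0 : 0 < τ := by linarith
  have hr := riesz_nonneg μ z
  have h3 : τ ^ Θ = τ ^ (Θ / 2) * τ ^ (Θ / 2) := by
    rw [← Real.rpow_add hτ0]; ring_nf
  have h01 := h0.1
  have h02 := h0.2
  calc τ ^ Θ * (Fant f z.1 (u z.1) * Fant f z.2 (u z.2) * riesz μ z)
      = (τ ^ (Θ / 2) * Fant f z.1 (u z.1)) * (τ ^ (Θ / 2) * Fant f z.2 (u z.2)) * riesz μ z := by
        rw [h3]; ring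
    _ ≤ _ := by
        gcongr
        exact (mul_nonneg (by positivity) h01).trans h1

theorem mul_pot_le_dpot_self {u : RN N → ℝ} (hu : FinMod Ω s p u) :
    Θ / 2 * pot Ω μ f u ≤ dpot Ω μ f u u := by
  unfold pot dpot bil
  rw [← integral_const_mul]
  refine integral_mono_ae ((H.integrable_pot hu).const_mul _) (H.integrable_dpot hu hu) ?_
  filter_upwards [ae_restrict_prod_of_ae H.meas_dom (H.ae_Fant_nonneg u),
    ae_restrict_prod_of_ae H.meas_dom H.ar] with z h0 hz
  have h1 : Θ / 2 * Fant f z.2 (u z.2) ≤ f z.2 (u z.2) * u z.2 := by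
    rcases eq_or_ne (u z.2) 0 with h | h
    · rw [h, Fant_zero]; simp
    · linarith [(hz.2 _ h).2]
  have := mul_le_mul_of_nonneg_left h1 (mul_nonneg h0.1 (riesz_nonneg μ z))
  linarith

theorem exists_pot_le (R : ℝ) : ∃ C, ∀ u, FinMod Ω s p u → gmod s p u ≤ ENNReal.ofReal R →
    pot Ω μ f u ≤ C := by
  have := H.isFiniteMeasure
  obtain ⟨C, hC⟩ := H.exists_moment_bound R
  refine ⟨((volume.restrict Ω).prod (volume.restrict Ω)).real univ +
    (K * (C + C) + C * C), fun u hu huR => ?_⟩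
  obtain ⟨hi, hle⟩ := (hC u hu huR).1
  have hm := H.car.measurable_Fant_comp hu.meas
  obtain ⟨k1, k2⟩ := H.hls _ _ hm hm hi hi
  have h0 : 0 ≤ ∫ x in Ω, |Fant f x (u x)| ^ b := integral_nonneg fun x => by positivity
  have hK := H.K_nonneg
  calc pot Ω μ f u ≤ ∫ z, (1 + |Fant f z.1 (u z.1) * Fant f z.2 (u z.2) * riesz μ z| ^ c)
        ∂((volume.restrict Ω).prod (volume.restrict Ω)) := by
        refine integral_mono (H.integrable_pot hu) ((integrable_const _).add k1) fun z => ?_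
        have := rpow_le_one_add_rpow
          (abs_nonneg (Fant f z.1 (u z.1) * Fant f z.2 (u z.2) * riesz μ z))
          zero_le_one H.c_gt.le
        rw [Real.rpow_one] at this
        exact (le_abs_self _).trans this
    _ = _ := integral_add (integrable_const _) k1
    _ ≤ _ := by
        rw [integral_const, smul_eq_mul, mul_one]
        refine add_le_add_right (k2.trans ?_) _
        gcongr
        exact h0.trans hle

/-- Continuity of the Choquard pairing along almost everywhere convergent sequences of bounded
energy. -/
theorem tendsto_dpot {R : ℝ} {u w : ℕ → RN N → ℝ} {v g : RN N → ℝ}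
    (hu : ∀ n, FinMod Ω s p (u n)) (hw : ∀ n, FinMod Ω s p (w n))
    (huR : ∀ n, gmod s p (u n) ≤ ENNReal.ofReal R) (hwR : ∀ n, gmod s p (w n) ≤ ENNReal.ofReal R)
    (hv : FinMod Ω s p v) (hg : FinMod Ω s p g)
    (huv : ∀ᵐ x, Tendsto (fun n => u n x) atTop (nhds (v x)))
    (hwg : ∀ᵐ x, Tendsto (fun n => w n x) atTop (nhds (g x))) :
    Tendsto (fun n => dpot Ω μ f (u n) (w n)) atTop (nhds (dpot Ω μ f v g)) := by
  obtain ⟨C, hC⟩ := H.exists_moment_bound R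
  refine H.tendsto_bil (C := C) (fun n => H.car.measurable_Fant_comp (hu n).meas)
    (fun n => H.measurable_mul (hu n) (hw n)) (fun n => (hC _ (hu n) (huR n)).1)
    (fun n => (hC _ (hu n) (huR n)).2 _ (hw n) (hwR n)) (H.car.measurable_Fant_comp hv.meas)
    (H.measurable_mul hv hg) (H.integrableOn_Fant hv) (H.integrableOn_mul hv hg) ?_ ?_
  · filter_upwards [huv] with x hx _
    exact ((H.car.continuous_Fant x).tendsto _).comp hx
  · filter_upwards [huv, hwg] with x hx hy _
    exact (((H.car.2 x).tendsto _).comp hx).mul hy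

end Choquard

section Combination

variable {κ : Type} [Fintype κ]

/-- The linear functional `ξ ↦ ∑ ξ_k c_k`. -/
def pairing (c : κ → ℝ) : EuclideanSpace ℝ κ →L[ℝ] ℝ :=
  ∑ k, c k • (EuclideanSpace.proj k : EuclideanSpace ℝ κ →L[ℝ] ℝ)

theorem pairing_apply (c : κ → ℝ) (ξ : EuclideanSpace ℝ κ) : pairing c ξ = ∑ k, ξ k * c k := by
  simp [pairing, mul_comm]

theorem abs_pairing_apply_le (c : κ → ℝ) (ξ : EuclideanSpace ℝ κ) :
    |pairing c ξ| ≤ (∑ k, |c k|) * ‖ξ‖ := by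
  rw [pairing_apply, Finset.sum_mul]
  refine (Finset.abs_sum_le_sum_abs _ _).trans (Finset.sum_le_sum fun k _ => ?_)
  rw [abs_mul, mul_comm]
  have : |ξ k| ≤ ‖ξ‖ := PiLp.norm_apply_le ξ k
  gcongr

theorem norm_pairing_le (c : κ → ℝ) : ‖pairing c‖ ≤ ∑ k, |c k| :=
  ContinuousLinearMap.opNorm_le_bound _ (Finset.sum_nonneg fun _ _ => abs_nonneg _)
    (abs_pairing_apply_le c)

theorem continuous_pairing : Continuous (pairing (κ := κ)) := by
  unfold pairing
  fun_prop

/-- The linear combination `∑ ξ_k e_k`. -/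
def comb (e : κ → RN N → ℝ) (ξ : EuclideanSpace ℝ κ) (x : RN N) : ℝ := ∑ k, ξ k * e k x

variable {e : κ → RN N → ℝ}

theorem comb_eq_pairing (ξ : EuclideanSpace ℝ κ) (x : RN N) :
    comb e ξ x = pairing (fun k => e k x) ξ := (pairing_apply _ _).symm

theorem comb_sub (ξ : EuclideanSpace ℝ κ) (x y : RN N) :
    comb e ξ x - comb e ξ y = pairing (fun k => e k x - e k y) ξ := by
  simp only [pairing_apply, comb, mul_sub, Finset.sum_sub_distrib]

theorem comb_smul (τ : ℝ) (ξ : EuclideanSpace ℝ κ) :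
    comb e (τ • ξ) = fun x => τ * comb e ξ x := by
  funext x
  simp [comb, Finset.mul_sum, mul_assoc]

theorem comb_zero : comb e 0 = fun _ => (0 : ℝ) := by
  funext x
  simp [comb]

variable {Ω : Set (RN N)} {s p : RN N → RN N → ℝ} {s0 s1 p1 p2 : ℝ}

theorem Exponents.finMod_comb (h : Exponents s p s0 s1 p1 p2) (he : ∀ k, FinMod Ω s p (e k))
    (ξ : EuclideanSpace ℝ κ) : FinMod Ω s p (comb e ξ) :=
  h.finMod_sum Finset.univ fun k => h.finMod_const_mul (he k) (ξ k)

/-- The energy is continuously differentiable along finite linear combinations. -/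
theorem Exponents.hasFDerivAt_energy_comb (h : Exponents s p s0 s1 p1 p2)
    (he : ∀ k, FinMod Ω s p (e k)) :
    ∃ A : EuclideanSpace ℝ κ → EuclideanSpace ℝ κ →L[ℝ] ℝ,
      (∀ ξ, HasFDerivAt (fun ξ => energy s p (comb e ξ)) (A ξ) ξ) ∧ Continuous A ∧
      ∀ ξ ζ, A ξ ζ = energyLHS s p (comb e ξ) (comb e ζ) := by
  set L : RN N × RN N → EuclideanSpace ℝ κ →L[ℝ] ℝ :=
    fun z => pairing fun k => e k z.1 - e k z.2
  set h' : EuclideanSpace ℝ κ → RN N × RN N → EuclideanSpace ℝ κ →L[ℝ] ℝ := fun ξ z =>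
    (|L z ξ| ^ (p z.1 z.2 - 2) * L z ξ * kern s p z) • L z
  have hem : ∀ k, Measurable (e k) := fun k => (he k).meas
  have hLm : StronglyMeasurable L := continuous_pairing.comp_stronglyMeasurable
    (Measurable.stronglyMeasurable (by fun_prop))
  have hpm := h.measurable_p
  have hkm := h.measurable_kern
  have hLξ : ∀ ξ, Measurable fun z => L z ξ := by
    intro ξ
    simp only [L, pairing_apply]
    fun_prop
  have hcoef : ∀ ξ, Measurable fun z => |L z ξ| ^ (p z.1 z.2 - 2) * L z ξ * kern s p z := by
    intro ξ
    have := hLξ ξ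
    fun_prop
  have hd : ∀ z ξ, HasFDerivAt (fun ξ => gdens s p (comb e ξ) z / p z.1 z.2) (h' ξ z) ξ := by
    intro z ξ
    have h1 := (hasDerivAt_abs_rpow_div (h.p_gt z.1 z.2) (L z ξ)).comp_hasFDerivAt ξ
      (L z).hasFDerivAt
    have h2 := h1.mul_const (kern s p z)
    refine (h2.congr_fderiv ?_).congr_of_eventuallyEq (Eventually.of_forall fun η => ?_)
    · simp only [h', smul_smul]
      congr 1; ring
    · simp only [gdens, comb_sub, L, Function.comp_apply]
      ring
  have hc : ∀ z, Continuous fun ξ => h' ξ z := by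
    intro z
    have := (continuous_abs_rpow_sub_two_mul (h.p_gt z.1 z.2)).comp (L z).continuous
    exact (this.mul continuous_const).smul continuous_const
  have hle : ∀ z R ξ, ‖ξ‖ ≤ R → ‖h' ξ z‖ ≤ (1 + R) ^ p2 *
      ((1 + Fintype.card κ : ℝ) ^ p2 * ∑ k, gdens s p (e k) z) := by
    intro z R ξ hξ
    have hp := h.p_gt z.1 z.2
    have hk := kern_nonneg (s := s) (p := p) z
    have hR : 0 ≤ R := (norm_nonneg _).trans hξ
    have hS : 0 ≤ ∑ k, |e k z.1 - e k z.2| := Finset.sum_nonneg fun _ _ => abs_nonneg _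
    set S := ∑ k, |e k z.1 - e k z.2|
    have hL : ‖L z‖ ≤ S := norm_pairing_le _
    have hLz : |L z ξ| ≤ S * (1 + R) :=
      (abs_pairing_apply_le _ ξ).trans (by gcongr; linarith)
    have hsum : S ^ p z.1 z.2 ≤ (1 + Fintype.card κ : ℝ) ^ p2 *
        ∑ k, |e k z.1 - e k z.2| ^ p z.1 z.2 := by
      refine (Real.rpow_sum_le_const_mul_sum_rpow Finset.univ _ hp.le).trans ?_
      rw [Finset.card_univ]
      have hc : (0 : ℝ) ≤ Fintype.card κ := Nat.cast_nonneg _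
      gcongr
      calc (Fintype.card κ : ℝ) ^ (p z.1 z.2 - 1) ≤ (1 + Fintype.card κ : ℝ) ^ (p z.1 z.2 - 1) := by
            gcongr; linarith
        _ ≤ _ := Real.rpow_le_rpow_of_exponent_le (by linarith) (by linarith [h.le_p2 z.1 z.2])
    calc ‖h' ξ z‖ = |L z ξ| ^ (p z.1 z.2 - 1) * kern s p z * ‖L z‖ := by
          simp only [h']
          rw [norm_smul, Real.norm_eq_abs, abs_rpow_sub_two_mul_self_mul hp, abs_of_nonneg hk]
      _ ≤ (S * (1 + R)) ^ (p z.1 z.2 - 1) * kern s p z * S := by gcongr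
      _ = (1 + R) ^ (p z.1 z.2 - 1) * (S ^ p z.1 z.2 * kern s p z) := by
          rw [Real.mul_rpow hS (by linarith)]
          have : S ^ p z.1 z.2 = S ^ (p z.1 z.2 - 1) * S := by
            rw [← Real.rpow_add_one' hS (by linarith)]; congr 1; ring
          rw [this]; ring
      _ ≤ (1 + R) ^ p2 * (((1 + Fintype.card κ : ℝ) ^ p2 *
          ∑ k, |e k z.1 - e k z.2| ^ p z.1 z.2) * kern s p z) := by
          gcongr
          · linarith
          · linarith [h.le_p2 z.1 z.2]
      _ = _ := by simp only [gdens, ← Finset.sum_mul]; ring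
  obtain ⟨hA, hAc, hAi⟩ := hasFDerivAt_integral_of_locally_dominated
    (ν := (volume : Measure (RN N × RN N)))
    (h := fun ξ z => gdens s p (comb e ξ) z / p z.1 z.2) (h' := h')
    (bound := fun R z => (1 + R) ^ p2 *
      ((1 + Fintype.card κ : ℝ) ^ p2 * ∑ k, gdens s p (e k) z))
    (fun ξ => (h.integrable_gdens_div (h.finMod_comb he ξ)).aestronglyMeasurable)
    (fun ξ => ((hcoef ξ).stronglyMeasurable.smul hLm).aestronglyMeasurable)
    (fun ξ => h.integrable_gdens_div (h.finMod_comb he ξ))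
    (ae_of_all _ hd) (ae_of_all _ hc)
    (fun R => ((integrable_finsetSum _ fun k _ => h.integrable_gdens (he k)).const_mul
      _).const_mul _) (ae_of_all _ hle)
  refine ⟨_, hA, hAc, fun ξ ζ => ?_⟩
  rw [ContinuousLinearMap.integral_apply (hAi ξ), energyLHS_eq]
  refine integral_congr_ae (ae_of_all _ fun z => ?_)
  simp only [h', L, pairDens, comb_sub, smul_eq_mul, _root_.smul_apply]
  ring

end Combination

section CombinationPotential

variable {κ : Type} [Fintype κ] {e : κ → RN N → ℝ} {Ω : Set (RN N)} {s p μ : RN N → RN N → ℝ}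
  {s0 s1 p1 p2 : ℝ} {f : RN N → ℝ → ℝ} {M Θ : ℝ} {r : RN N → ℝ} {b c K : ℝ}

theorem Choquard.hasFDerivAt_Fant_comb (H : Choquard Ω s p μ f M Θ r b c K) (x : RN N)
    (ξ : EuclideanSpace ℝ κ) :
    HasFDerivAt (fun ξ => Fant f x (comb e ξ x)) (f x (comb e ξ x) • pairing fun k => e k x) ξ := by
  simp only [comb_eq_pairing]
  exact (H.car.hasDerivAt_Fant x _).comp_hasFDerivAt ξ
    (pairing fun k => e k x).hasFDerivAt

/-- The Choquard potential is continuously differentiable along finite linear combinations. -/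
theorem Choquard.hasFDerivAt_pot_comb (h : Exponents s p s0 s1 p1 p2)
    (H : Choquard Ω s p μ f M Θ r b c K) (he : ∀ k, FinMod Ω s p (e k)) :
    ∃ B : EuclideanSpace ℝ κ → EuclideanSpace ℝ κ →L[ℝ] ℝ,
      (∀ ξ, HasFDerivAt (fun ξ => pot Ω μ f (comb e ξ)) (B ξ) ξ) ∧ Continuous B ∧
      ∀ ξ ζ, B ξ ζ = 2 * dpot Ω μ f (comb e ξ) (comb e ζ) := by
  set ℓ : RN N → EuclideanSpace ℝ κ →L[ℝ] ℝ := fun x => pairing fun k => e k x with hℓ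
  set h' : EuclideanSpace ℝ κ → RN N × RN N → EuclideanSpace ℝ κ →L[ℝ] ℝ := fun ξ z =>
    riesz μ z • (Fant f z.1 (comb e ξ z.1) • f z.2 (comb e ξ z.2) • ℓ z.2 +
      Fant f z.2 (comb e ξ z.2) • f z.1 (comb e ξ z.1) • ℓ z.1) with hh'
  set S : RN N → ℝ := fun x => ∑ k, |e k x| with hSdef
  have hS0 : ∀ x, 0 ≤ S x := fun x => Finset.sum_nonneg fun _ _ => abs_nonneg _
  have hS : FinMod Ω s p S := h.finMod_sum Finset.univ fun k => h.finMod_abs (he k)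
  have hem : ∀ k, Measurable (e k) := fun k => (he k).meas
  have hℓm : StronglyMeasurable ℓ := continuous_pairing.comp_stronglyMeasurable
    (Measurable.stronglyMeasurable (by fun_prop))
  have hum := fun ξ => (h.finMod_comb he ξ).meas
  have hFm := fun ξ => (H.car.measurable_Fant_comp (hum ξ)).stronglyMeasurable
  have hfm := fun ξ => (H.car.measurable_comp (hum ξ)).stronglyMeasurable
  have hrm := H.r_meas
  have hM := H.growth.1
  have hd : ∀ z ξ, HasFDerivAt (fun ξ => Fant f z.1 (comb e ξ z.1) * Fant f z.2 (comb e ξ z.2) *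
      riesz μ z) (h' ξ z) ξ := fun z ξ =>
    ((H.hasFDerivAt_Fant_comb z.1 ξ).mul (H.hasFDerivAt_Fant_comb z.2 ξ)).mul_const _
  have hccomb : ∀ x, Continuous fun ξ => comb e ξ x := by
    intro x
    simp only [comb_eq_pairing]
    exact (pairing _).continuous
  have hc : ∀ z, Continuous fun ξ => h' ξ z := by
    intro z
    have k1 := fun x => (H.car.continuous_Fant x).comp (hccomb x)
    have k2 := fun x => (H.car.2 x).comp (hccomb x)
    have k3 := ((k1 z.1).smul ((k2 z.2).smul (continuous_const (y := ℓ z.2)))).add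
      ((k1 z.2).smul ((k2 z.1).smul (continuous_const (y := ℓ z.1))))
    exact k3.const_smul (riesz μ z)
  have hb : ∀ R : ℝ, Integrable (fun z : RN N × RN N =>
      2 * ((M * |(1 + R) * S z.1| ^ r z.1) * (M * |(1 + R) * S z.2| ^ r z.2) * riesz μ z))
      ((volume.restrict Ω).prod (volume.restrict Ω)) := by
    intro R
    have hSR := h.finMod_const_mul hS (1 + R)
    have hSm := hSR.meas
    have hm : Measurable fun x => M * |(1 + R) * S x| ^ r x := by fun_prop
    obtain ⟨C, hC⟩ := H.power (gmod s p fun x => (1 + R) * S x).toReal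
    have h1 := (hC _ hSR (ENNReal.ofReal_toReal hSR.fin.ne).ge).1
    have h2 : IntegrableOn (fun x => |M * |(1 + R) * S x| ^ r x| ^ b) Ω := by
      refine (h1.const_mul (M ^ b)).congr (ae_of_all _ fun x => ?_)
      dsimp only
      rw [abs_of_nonneg (by positivity : 0 ≤ M * |(1 + R) * S x| ^ r x),
        Real.mul_rpow hM.le (by positivity), ← Real.rpow_mul (abs_nonneg _)]
    exact (H.integrable hm hm h2 h2).const_mul 2
  have hbound : ∀ R (ξ : EuclideanSpace ℝ κ), ‖ξ‖ ≤ R → ∀ x ∈ Ω,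
      |Fant f x (comb e ξ x)| ≤ M * |(1 + R) * S x| ^ r x ∧
        ‖f x (comb e ξ x) • ℓ x‖ ≤ M * |(1 + R) * S x| ^ r x := by
    intro R ξ hξ x hx
    have hR : 0 ≤ R := (norm_nonneg _).trans hξ
    have hr := H.r_gt x
    have hSx := hS0 x
    have k0 : |comb e ξ x| ≤ (1 + R) * S x := by
      rw [comb_eq_pairing]
      refine (abs_pairing_apply_le _ ξ).trans ?_
      rw [mul_comm]
      gcongr
      linarith
    have k1 : ‖ℓ x‖ ≤ (1 + R) * S x :=
      (norm_pairing_le _).trans (le_mul_of_one_le_left hSx (by linarith))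
    rw [abs_of_nonneg (by positivity : 0 ≤ (1 + R) * S x)]
    constructor
    · refine (H.growth.abs_Fant_le hx hr _).trans ?_
      gcongr
    · rw [norm_smul, Real.norm_eq_abs]
      calc |f x (comb e ξ x)| * ‖ℓ x‖ ≤ (M * |comb e ξ x| ^ (r x - 1)) * ‖ℓ x‖ := by
            gcongr; exact H.growth.2 x hx _
        _ ≤ (M * ((1 + R) * S x) ^ (r x - 1)) * ((1 + R) * S x) := by
            gcongr
        _ = _ := by
            rw [mul_assoc, ← Real.rpow_add_one' (by positivity) (by linarith)]; norm_num
  have hle : ∀ᵐ z ∂((volume.restrict Ω).prod (volume.restrict Ω)), ∀ R ξ, ‖ξ‖ ≤ R →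
      ‖h' ξ z‖ ≤ 2 * ((M * |(1 + R) * S z.1| ^ r z.1) * (M * |(1 + R) * S z.2| ^ r z.2) *
        riesz μ z) := by
    filter_upwards [ae_restrict_prod_of_ae H.meas_dom (ae_of_all _ fun x hx => hx)]
      with z hz R ξ hξ
    obtain ⟨a1, a2⟩ := hbound R ξ hξ z.1 hz.1
    obtain ⟨b1, b2⟩ := hbound R ξ hξ z.2 hz.2
    have hk := riesz_nonneg μ z
    simp only [hh']
    rw [norm_smul, Real.norm_eq_abs, abs_of_nonneg hk]
    have k1 : ‖Fant f z.1 (comb e ξ z.1) • f z.2 (comb e ξ z.2) • ℓ z.2‖ ≤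
        (M * |(1 + R) * S z.1| ^ r z.1) * (M * |(1 + R) * S z.2| ^ r z.2) := by
      rw [norm_smul, Real.norm_eq_abs]
      gcongr
    have k2 : ‖Fant f z.2 (comb e ξ z.2) • f z.1 (comb e ξ z.1) • ℓ z.1‖ ≤
        (M * |(1 + R) * S z.2| ^ r z.2) * (M * |(1 + R) * S z.1| ^ r z.1) := by
      rw [norm_smul, Real.norm_eq_abs]
      gcongr
    have k3 := mul_le_mul_of_nonneg_left ((norm_add_le _ _).trans (add_le_add k1 k2)) hk
    refine k3.trans_eq ?_
    ring
  have hm' : ∀ ξ, AEStronglyMeasurable (h' ξ) ((volume.restrict Ω).prod (volume.restrict Ω)) := by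
    intro ξ
    have e1 : StronglyMeasurable (riesz μ) := H.meas_riesz.stronglyMeasurable
    have q1 : ∀ {g : RN N → ℝ}, StronglyMeasurable g →
      StronglyMeasurable fun z : RN N × RN N => g z.1 := fun hg => hg.comp_measurable measurable_fst
    have q2 : ∀ {g : RN N → ℝ}, StronglyMeasurable g →
      StronglyMeasurable fun z : RN N × RN N => g z.2 := fun hg => hg.comp_measurable measurable_snd
    exact (e1.smul (((q1 (hFm ξ)).smul ((q2 (hfm ξ)).smul (hℓm.comp_measurable
      measurable_snd))).add ((q2 (hFm ξ)).smul ((q1 (hfm ξ)).smul (hℓm.comp_measurable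
      measurable_fst))))).aestronglyMeasurable
  obtain ⟨hB, hBc, hBi⟩ := hasFDerivAt_integral_of_locally_dominated
    (h := fun ξ z => Fant f z.1 (comb e ξ z.1) * Fant f z.2 (comb e ξ z.2) * riesz μ z)
    (fun ξ => (H.integrable_pot (h.finMod_comb he ξ)).aestronglyMeasurable) hm'
    (fun ξ => H.integrable_pot (h.finMod_comb he ξ)) (ae_of_all _ hd) (ae_of_all _ hc) hb hle
  refine ⟨_, hB, hBc, fun ξ ζ => ?_⟩
  rw [ContinuousLinearMap.integral_apply (hBi ξ), two_mul]
  have hu := h.finMod_comb he ξ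
  have hw := h.finMod_comb he ζ
  have hswap : dpot Ω μ f (comb e ξ) (comb e ζ) =
    bil Ω μ (fun x => f x (comb e ξ x) * comb e ζ x) fun x => Fant f x (comb e ξ x) :=
    H.bil_comm _ _
  have hi := H.integrable (H.measurable_mul hu hw) (H.car.measurable_Fant_comp hu.meas)
    (H.integrableOn_mul hu hw) (H.integrableOn_Fant hu)
  nth_rewrite 2 [hswap]
  unfold dpot bil
  rw [← integral_add (H.integrable_dpot hu hw) hi]
  refine integral_congr_ae (ae_of_all _ fun z => ?_)
  simp only [hh', hℓ, _root_.smul_apply, _root_.add_apply, smul_eq_mul, comb_eq_pairing]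
  ring

end CombinationPotential

section Galerkin

theorem exists_forall_rpow_sub_neg {a b A B : ℝ} (hab : a < b) (hB : 0 < B) :
    ∃ T, 1 ≤ T ∧ ∀ τ, T ≤ τ → A * τ ^ a - B * τ ^ b < 0 := by
  have h1 := (tendsto_rpow_atTop (sub_pos.2 hab)).const_mul_atTop hB
  obtain ⟨T, hT⟩ := eventually_atTop.1 (h1.eventually_gt_atTop A)
  refine ⟨max T 1, le_max_right _ _, fun τ hτ => ?_⟩
  have hτ0 : 0 < τ := one_pos.trans_le ((le_max_right _ _).trans hτ)
  have h2 := hT τ ((le_max_left _ _).trans hτ)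
  have h3 : τ ^ b = τ ^ (b - a) * τ ^ a := by rw [← Real.rpow_add hτ0]; congr 1; ring
  have h4 : 0 < τ ^ a := by positivity
  rw [h3]
  nlinarith

/-- A finite family of functions has a subfamily that is linearly independent modulo null sets and
spans the family modulo null sets. -/
theorem exists_ae_linearIndependent {α : Type*} [MeasurableSpace α] (ν : Measure α) {ι : Type}
    [Finite ι] (w : ι → α → ℝ) :
    ∃ (κ : Type) (_ : Fintype κ) (a : κ → ι),
      (∀ ξ : κ → ℝ, (∀ᵐ x ∂ν, ∑ k, ξ k * w (a k) x = 0) → ξ = 0) ∧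
      ∀ i, ∃ ξ : κ → ℝ, ∀ᵐ x ∂ν, w i x = ∑ k, ξ k * w (a k) x := by
  let Z : Submodule ℝ (α → ℝ) :=
    { carrier := {g | ∀ᵐ x ∂ν, g x = 0}
      add_mem' := fun {g g'} hg hg' => by
        have h : ∀ᵐ x ∂ν, (g + g') x = 0 := by
          filter_upwards [(hg : ∀ᵐ x ∂ν, g x = 0), (hg' : ∀ᵐ x ∂ν, g' x = 0)] with x h1 h2
          simp [h1, h2]
        exact h
      zero_mem' := ae_of_all _ fun _ => rfl
      smul_mem' := fun c g hg => by
        have h : ∀ᵐ x ∂ν, (c • g) x = 0 := by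
          filter_upwards [(hg : ∀ᵐ x ∂ν, g x = 0)] with x h1
          simp [h1]
        exact h }
  obtain ⟨κ, a, ha, hspan, hli⟩ := exists_linearIndependent' ℝ fun i => Z.mkQ (w i)
  have : Finite κ := Finite.of_injective a ha
  have : Fintype κ := Fintype.ofFinite κ
  have hcomb : ∀ ξ : κ → ℝ, ∑ k, ξ k • Z.mkQ (w (a k)) = Z.mkQ fun x => ∑ k, ξ k * w (a k) x := by
    intro ξ
    simp only [← map_smul, ← map_sum]
    congr 1
    funext x
    simp
  refine ⟨κ, this, a, fun ξ hξ => ?_, fun i => ?_⟩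
  · funext k
    refine Fintype.linearIndependent_iff.1 hli ξ ?_ k
    simp only [Function.comp_apply, hcomb]
    rw [Submodule.mkQ_apply, Submodule.Quotient.mk_eq_zero]
    exact hξ
  · have hi : Z.mkQ (w i) ∈ Submodule.span ℝ (Set.range ((fun i => Z.mkQ (w i)) ∘ a)) := by
      rw [hspan]
      exact Submodule.subset_span ⟨i, rfl⟩
    obtain ⟨ξ, hξ⟩ := (Submodule.mem_span_range_iff_exists_fun ℝ).1 hi
    simp only [Function.comp_apply, hcomb] at hξ
    rw [Submodule.mkQ_apply, Submodule.mkQ_apply, Submodule.Quotient.eq] at hξ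
    refine ⟨ξ, ?_⟩
    have hξ' : ∀ᵐ x ∂ν, ((fun x => ∑ k, ξ k * w (a k) x) - w i) x = 0 := hξ
    filter_upwards [hξ'] with x hx
    simp only [Pi.sub_apply] at hx
    linarith

variable {Ω : Set (RN N)} {s p μ : RN N → RN N → ℝ} {s0 s1 p1 p2 : ℝ} {f : RN N → ℝ → ℝ}
  {M Θ : ℝ} {r : RN N → ℝ} {b c K : ℝ} {u v w : RN N → ℝ}

theorem energy_congr (huv : ∀ᵐ x, u x = v x) : energy s p u = energy s p v := by
  refine integral_congr_ae ?_
  filter_upwards [ae_prod_of_ae huv] with z hz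
  simp only [gdens, hz.1, hz.2]

theorem energyLHS_congr_right (hvw : ∀ᵐ x, v x = w x) :
    energyLHS s p u v = energyLHS s p u w := by
  refine integral_congr_ae ?_
  filter_upwards [ae_prod_of_ae hvw] with z hz
  simp only [hz.1, hz.2]

theorem Choquard.pot_congr (H : Choquard Ω s p μ f M Θ r b c K) (huv : ∀ᵐ x, u x = v x) :
    pot Ω μ f u = pot Ω μ f v := by
  refine integral_congr_ae ?_
  filter_upwards [ae_restrict_prod_of_ae H.meas_dom (huv.mono fun _ hx _ => hx)] with z hz
  simp only [hz.1, hz.2]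

theorem Choquard.dpot_congr_right (H : Choquard Ω s p μ f M Θ r b c K)
    (hvw : ∀ᵐ x, v x = w x) : dpot Ω μ f u v = dpot Ω μ f u w := by
  refine integral_congr_ae ?_
  filter_upwards [ae_restrict_prod_of_ae H.meas_dom (hvw.mono fun _ hx _ => hx)] with z hz
  simp only [hz.2]

theorem Exponents.p2_pos (h : Exponents s p s0 s1 p1 p2) : 0 < p2 := one_pos.trans h.p2_gt

/-- Near the origin the Choquard potential is dominated by the energy. -/
theorem Choquard.exists_barrier (h : Exponents s p s0 s1 p1 p2)
    (H : Choquard Ω s p μ f M Θ r b c K) (hΘ : p2 < Θ) :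
    ∃ η, 0 < η ∧ ∀ u, FinMod Ω s p u → energy s p u ≤ η → pot Ω μ f u ≤ 2 * energy s p u := by
  obtain ⟨C, hC⟩ := H.exists_pot_le 1
  have hp2 := h.p2_pos
  obtain ⟨T, hT1, hT⟩ := exists_forall_rpow_sub_neg (a := -Θ) (b := -p2) (A := C)
    (neg_lt_neg hΘ) (by positivity : 0 < 2 / p2)
  have hT0 : 0 < T := by linarith
  refine ⟨T ^ (-p2) / p2, by positivity, fun u hu hle => ?_⟩
  have key : ∀ τ, T ≤ τ → p2 * energy s p u ≤ τ ^ (-p2) →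
      pot Ω μ f u ≤ 2 / p2 * τ ^ (-p2) := by
    intro τ hτ hτe
    have hτ1 : 1 ≤ τ := hT1.trans hτ
    have hτ0 : 0 < τ := by linarith
    have hτu := h.finMod_const_mul hu τ
    have h1 : gmod s p (fun x => τ * u x) ≤ ENNReal.ofReal 1 := by
      refine (h.gmod_const_mul_le hu.meas τ).trans
        ((mul_le_mul_right (h.gmod_le_energy hu) _).trans ?_)
      rw [abs_of_pos hτ0, max_eq_right (Real.one_le_rpow hτ1 hp2.le),
        ← ENNReal.ofReal_mul (by positivity)]
      refine ENNReal.ofReal_le_ofReal ?_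
      calc τ ^ p2 * (p2 * energy s p u) ≤ τ ^ p2 * τ ^ (-p2) := by gcongr
        _ = 1 := by rw [← Real.rpow_add hτ0]; simp
    have h2 := (H.rpow_mul_pot_le hu hτu hτ1).trans (hC _ hτu h1)
    have h3 : pot Ω μ f u ≤ C * τ ^ (-Θ) := by
      rw [Real.rpow_neg hτ0.le, ← div_eq_mul_inv, le_div_iff₀ (by positivity)]
      linarith
    linarith [hT τ hτ]
  rcases (h.energy_nonneg u).eq_or_lt with h0 | h0
  · rw [← h0, mul_zero]
    have h1 : Tendsto (fun τ : ℝ => 2 / p2 * τ ^ (-p2)) atTop (nhds (2 / p2 * 0)) :=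
      (tendsto_rpow_neg_atTop hp2).const_mul _
    rw [mul_zero] at h1
    refine ge_of_tendsto h1 ?_
    filter_upwards [eventually_ge_atTop T] with τ hτ
    refine key τ hτ ?_
    rw [← h0, mul_zero]
    have : 0 < τ := hT0.trans_le hτ
    positivity
  · have h1 : 0 < p2 * energy s p u := by positivity
    have h2 : ((p2 * energy s p u) ^ (-p2⁻¹)) ^ (-p2) = p2 * energy s p u := by
      rw [← Real.rpow_mul h1.le]
      field_simp
      simp
    have h3 := key ((p2 * energy s p u) ^ (-p2⁻¹)) ?_ h2.ge
    · rw [h2] at h3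
      refine h3.trans_eq ?_
      field_simp
    · rw [le_div_iff₀ hp2, mul_comm] at hle
      calc T = (T ^ (-p2)) ^ (-p2⁻¹) := by
            rw [← Real.rpow_mul hT0.le]
            field_simp
            simp
        _ ≤ _ := Real.rpow_le_rpow_of_nonpos h1 hle (by simpa using hp2.le)

/-- On a space of linear combinations that meets the null functions only at the origin, the
energy functional is nonnegative only on a bounded set. -/
theorem Choquard.isBounded_nonneg (h : Exponents s p s0 s1 p1 p2)
    (H : Choquard Ω s p μ f M Θ r b c K) (hΘ : p2 < Θ) {κ : Type} [Fintype κ]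
    {e : κ → RN N → ℝ} (he : ∀ k, FinMod Ω s p (e k))
    (hind : ∀ ξ : EuclideanSpace ℝ κ, (∀ᵐ x, comb e ξ x = 0) → ξ = 0) :
    Bornology.IsBounded {ξ : EuclideanSpace ℝ κ |
      0 ≤ energy s p (comb e ξ) - pot Ω μ f (comb e ξ) / 4} := by
  obtain ⟨A, hA, -, -⟩ := h.hasFDerivAt_energy_comb he
  obtain ⟨B, hB, -, -⟩ := H.hasFDerivAt_pot_comb h he
  have hAc : Continuous fun ξ => energy s p (comb e ξ) :=
    continuous_iff_continuousAt.2 fun ξ => (hA ξ).continuousAt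
  have hBc : Continuous fun ξ => pot Ω μ f (comb e ξ) :=
    continuous_iff_continuousAt.2 fun ξ => (hB ξ).continuousAt
  have hcomp := isCompact_sphere (0 : EuclideanSpace ℝ κ) 1
  obtain ⟨φ, hφ⟩ := hcomp.bddAbove_image hAc.continuousOn
  obtain ⟨ψ, hψ0, hψ⟩ := hcomp.exists_forall_le' hBc.continuousOn (a := 0) fun ξ hξ =>
    H.pot_pos h.dim_pos (h.finMod_comb he ξ) fun hz => by
      rw [hind ξ hz] at hξ
      simp at hξ
  obtain ⟨T, hT1, hT⟩ := exists_forall_rpow_sub_neg (A := φ) hΘ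
    (by positivity : 0 < ψ / 4)
  refine (Metric.isBounded_closedBall (x := (0 : EuclideanSpace ℝ κ)) (r := T)).subset
    fun ξ hξ => ?_
  rw [mem_closedBall_zero_iff]
  by_contra! hlt
  have hτ1 : 1 ≤ ‖ξ‖ := hT1.trans hlt.le
  have hτ0 : 0 < ‖ξ‖ := by linarith
  set θ : EuclideanSpace ℝ κ := ‖ξ‖⁻¹ • ξ
  have hθ : θ ∈ Metric.sphere (0 : EuclideanSpace ℝ κ) 1 := by
    rw [mem_sphere_zero_iff_norm, norm_smul, norm_inv, norm_norm, inv_mul_cancel₀ hτ0.ne']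
  have hξθ : comb e ξ = fun x => ‖ξ‖ * comb e θ x := by
    rw [← comb_smul, smul_inv_smul₀ hτ0.ne']
  have hθF := h.finMod_comb he θ
  have h1 : energy s p (comb e ξ) ≤ φ * ‖ξ‖ ^ p2 := by
    rw [hξθ]
    refine (h.energy_const_mul_le hθF _).trans ?_
    rw [abs_of_pos hτ0, max_eq_right (Real.one_le_rpow hτ1 h.p2_pos.le), mul_comm]
    gcongr
    exact hφ ⟨θ, hθ, rfl⟩
  have h2 : ψ * ‖ξ‖ ^ Θ ≤ pot Ω μ f (comb e ξ) := by
    rw [hξθ]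
    refine le_trans ?_ (H.rpow_mul_pot_le hθF (h.finMod_const_mul hθF _) hτ1)
    rw [mul_comm]
    gcongr
    exact hψ θ hθ
  have h3 := hT _ hlt.le
  have h4 : 0 ≤ energy s p (comb e ξ) - pot Ω μ f (comb e ξ) / 4 := hξ
  linarith

/-- Mountain pass solutions of the finite-dimensional problems, with energy levels independent of
the chosen test functions. -/
theorem Choquard.exists_galerkin (h : Exponents s p s0 s1 p1 p2)
    (H : Choquard Ω s p μ f M Θ r b c K) (hΘ : p2 < Θ) {g : RN N → ℝ} (hg : FinMod Ω s p g)
    (hg0 : ¬ ∀ᵐ x, g x = 0) :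
    ∃ a C : ℝ, 0 < a ∧ ∀ S : Finset {w : RN N → ℝ // FinMod Ω s p w}, ∃ u, FinMod Ω s p u ∧
      a ≤ energy s p u - pot Ω μ f u / 4 ∧ energy s p u - pot Ω μ f u / 4 ≤ C ∧
      energyLHS s p u u = dpot Ω μ f u u / 2 ∧
      ∀ w ∈ S, energyLHS s p u w.1 = dpot Ω μ f u w.1 / 2 := by
  classical
  obtain ⟨η, hη, hbar⟩ := H.exists_barrier h hΘ
  have hgpot := H.pot_pos h.dim_pos hg hg0
  obtain ⟨T, hT1, hT⟩ := exists_forall_rpow_sub_neg (A := energy s p g) hΘ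
    (by positivity : 0 < pot Ω μ f g / 4)
  have hT0 : 0 < T := by linarith
  refine ⟨η / 2 / 2, max 1 (T ^ p2) * energy s p g, by positivity, fun S => ?_⟩
  obtain ⟨κ, _, a, hind, hspan⟩ := exists_ae_linearIndependent (volume : Measure (RN N))
    (fun w : ↥(insert (⟨g, hg⟩ : {w : RN N → ℝ // FinMod Ω s p w}) S) => w.1.1)
  set e : κ → RN N → ℝ := fun k => (a k).1.1
  have he : ∀ k, FinMod Ω s p (e k) := fun k => (a k).1.2
  have hind' : ∀ ξ : EuclideanSpace ℝ κ, (∀ᵐ x, comb e ξ x = 0) → ξ = 0 := fun ξ hξ =>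
    PiLp.ext fun k => congrFun (hind (fun k => ξ k) hξ) k
  have hspan' : ∀ w ∈ insert (⟨g, hg⟩ : {w : RN N → ℝ // FinMod Ω s p w}) S,
      ∃ ξ : EuclideanSpace ℝ κ, ∀ᵐ x, w.1 x = comb e ξ x := fun w hw => by
    obtain ⟨ξ, hξ⟩ := hspan ⟨w, hw⟩
    exact ⟨WithLp.toLp 2 ξ, hξ⟩
  obtain ⟨A, hA, hAc, hAe⟩ := h.hasFDerivAt_energy_comb he
  obtain ⟨B, hB, hBc, hBe⟩ := H.hasFDerivAt_pot_comb h he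
  have hEc : Continuous fun ξ => energy s p (comb e ξ) :=
    continuous_iff_continuousAt.2 fun ξ => (hA ξ).continuousAt
  obtain ⟨ξ₀, hξ₀⟩ := hspan' ⟨g, hg⟩ (Finset.mem_insert_self _ _)
  have hray : ∀ t : ℝ, ∀ᵐ x, comb e (t • T • ξ₀) x = (t * T) * g x := fun t => by
    filter_upwards [hξ₀] with x hx
    rw [smul_smul, comb_smul, hx]
  have hend : energy s p (comb e (T • ξ₀)) - pot Ω μ f (comb e (T • ξ₀)) / 4 < 0 := by
    have h1 := hray 1
    simp only [one_smul, one_mul] at h1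
    rw [energy_congr h1, H.pot_congr h1]
    have h2 := h.energy_const_mul_le hg T
    rw [abs_of_pos hT0, max_eq_right (Real.one_le_rpow hT1 h.p2_pos.le)] at h2
    have h3 := H.rpow_mul_pot_le hg (h.finMod_const_mul hg T) hT1
    linarith [hT T le_rfl]
  have hE0 : energy s p (comb e 0) = 0 := by
    rw [comb_zero]
    simp only [energy, gdens, sub_self, abs_zero]
    refine integral_eq_zero_of_ae (ae_of_all _ fun z => ?_)
    simp [Real.zero_rpow (h.p_pos z.1 z.2).ne']
  obtain ⟨ξ, hξa, hξC, hξ0⟩ := finiteDimensional_mountain_pass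
    (j := fun ξ => energy s p (comb e ξ) - pot Ω μ f (comb e ξ) / 4)
    (j' := fun ξ => A ξ - (4 : ℝ)⁻¹ • B ξ) (a := η / 2) (C := max 1 (T ^ p2) * energy s p g)
    (e := T • ξ₀) (fun ξ => by
      have := (hA ξ).sub ((hB ξ).const_mul (4 : ℝ)⁻¹)
      refine this.congr_of_eventuallyEq (Eventually.of_forall fun η => ?_)
      simp [div_eq_inv_mul])
    (show Continuous fun ξ => A ξ - (4 : ℝ)⁻¹ • B ξ by fun_prop) (by positivity)
    (H.isBounded_nonneg h hΘ he hind') (by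
      have := H.pot_nonneg (comb e (0 : EuclideanSpace ℝ κ))
      rw [hE0]
      linarith) hend.le
    (fun t ht => by
      have h1 := H.pot_nonneg (comb e (t • T • ξ₀))
      have h2 := h.energy_const_mul_le hg (t * T)
      have h3 : max 1 (|t * T| ^ p2) * energy s p g ≤ max 1 (T ^ p2) * energy s p g := by
        have hE := h.energy_nonneg g
        have := h.p2_pos
        have h5 : |t * T| ≤ T := by
          rw [abs_of_nonneg (mul_nonneg ht.1 hT0.le)]
          exact mul_le_of_le_one_left hT0.le ht.2
        gcongr
      have h4 := energy_congr (s := s) (p := p) (hray t)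
      linarith)
    (fun γ hγ hγ0 hγ1 => by
      have hlast : η ≤ energy s p (comb e (γ 1)) := by
        rw [hγ1]
        by_contra! hlt
        have h1 := hbar _ (h.finMod_comb he (T • ξ₀)) hlt.le
        linarith [h.energy_nonneg (comb e (T • ξ₀))]
      obtain ⟨t, ht, hte⟩ := intermediate_value_Icc (zero_le_one (α := ℝ))
        (hEc.comp hγ).continuousOn (show η ∈ Icc _ _ from
          ⟨by simp only [Function.comp_apply, hγ0, hE0]; exact hη.le, hlast⟩)
      simp only [Function.comp_apply] at hte
      have h1 := hbar _ (h.finMod_comb he (γ t)) hte.le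
      exact ⟨t, ht, by linarith⟩)
  have hcrit : ∀ ζ, energyLHS s p (comb e ξ) (comb e ζ) = dpot Ω μ f (comb e ξ) (comb e ζ) / 2 := by
    intro ζ
    have h1 := congrArg (fun L : EuclideanSpace ℝ κ →L[ℝ] ℝ => L ζ) hξ0
    simp only [_root_.sub_apply, _root_.smul_apply, _root_.zero_apply, smul_eq_mul, hAe,
      hBe] at h1
    linarith
  refine ⟨comb e ξ, h.finMod_comb he ξ, hξa, hξC, hcrit ξ, fun w hw => ?_⟩
  obtain ⟨ζ, hζ⟩ := hspan' w (Finset.mem_insert_of_mem hw)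
  rw [energyLHS_congr_right hζ, H.dpot_congr_right hζ]
  exact hcrit ζ

end Galerkin

section Limit

variable {Ω : Set (RN N)} {s p μ : RN N → RN N → ℝ} {s0 s1 p1 p2 : ℝ} {f : RN N → ℝ → ℝ}
  {M Θ : ℝ} {r : RN N → ℝ} {b c K : ℝ}

/-- The Ambrosetti–Rabinowitz condition bounds the modular of a critical point by its level. -/
theorem Choquard.gmod_le_of_critical (h : Exponents s p s0 s1 p1 p2)
    (H : Choquard Ω s p μ f M Θ r b c K) (hΘ : p2 < Θ) {u : RN N → ℝ} {C : ℝ}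
    (hu : FinMod Ω s p u) (hC : energy s p u - pot Ω μ f u / 4 ≤ C)
    (hcrit : energyLHS s p u u = dpot Ω μ f u u / 2) :
    gmod s p u ≤ ENNReal.ofReal (C / (p2⁻¹ - Θ⁻¹)) := by
  have hp2 := h.p2_pos
  have hΘ0 := H.Θ_pos
  have hgap : 0 < p2⁻¹ - Θ⁻¹ := sub_pos.2 (inv_strictAnti₀ hp2 hΘ)
  rw [← h.integral_gdens hu]
  refine ENNReal.ofReal_le_ofReal ((le_div_iff₀ hgap).2 ?_)
  have h1 := h.integral_gdens_le hu
  have h2 := H.mul_pot_le_dpot_self hu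
  have h3 : energyLHS s p u u = ∫ z, gdens s p u z := by
    rw [energyLHS_eq]
    exact integral_congr_ae (ae_of_all _ (h.pairDens_self u))
  have h4 : p2⁻¹ * ∫ z, gdens s p u z ≤ energy s p u := by
    rwa [inv_mul_le_iff₀ hp2]
  have h5 : pot Ω μ f u / 4 ≤ Θ⁻¹ * ∫ z, gdens s p u z := by
    rw [← h3, hcrit, ← div_eq_inv_mul, le_div_iff₀ hΘ0]
    linarith
  linarith

/-- Existence of a nontrivial weak solution in terms of the Gagliardo modular. -/
theorem Choquard.exists_solution (h : Exponents s p s0 s1 p1 p2)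
    (H : Choquard Ω s p μ f M Θ r b c K) (hΘ : p2 < Θ) (hΩo : IsOpen Ω)
    (hΩb : Bornology.IsBounded Ω) (hΩne : Ω.Nonempty) :
    ∃ v, FinMod Ω s p v ∧ (¬ ∀ᵐ x, v x = 0) ∧
      ∀ w, FinMod Ω s p w → energyLHS s p v w = dpot Ω μ f v w / 2 := by
  classical
  obtain ⟨g, hg, hg0⟩ := h.exists_bump hΩo hΩne
  obtain ⟨a, C, ha, hgal⟩ := H.exists_galerkin h hΘ hg hg0
  choose u huF hua huC hucrit hutest using hgal
  obtain ⟨v, hv, hvR, hclus⟩ := h.exists_cluster H.meas_dom hΩb huF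
    (fun S => H.gmod_le_of_critical h hΘ (huF S) (huC S) (hucrit S))
  have key : ∀ w, FinMod Ω s p w →
      a ≤ energy s p v ∧ energyLHS s p v w = dpot Ω μ f v w / 2 := by
    intro w hw
    obtain ⟨j, hj, hlim⟩ := hclus fun _ => {⟨v, hv⟩, ⟨w, hw⟩}
    have hjv : ∀ n, (⟨v, hv⟩ : {w : RN N → ℝ // FinMod Ω s p w}) ∈ j n := fun n =>
      hj n (by simp)
    have hjw : ∀ n, (⟨w, hw⟩ : {w : RN N → ℝ // FinMod Ω s p w}) ∈ j n := fun n =>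
      hj n (by simp)
    set R := max (C / (p2⁻¹ - Θ⁻¹)) (gmod s p w).toReal
    have huR : ∀ n, gmod s p (u (j n)) ≤ ENNReal.ofReal R := fun n =>
      (H.gmod_le_of_critical h hΘ (huF _) (huC _) (hucrit _)).trans
        (ENNReal.ofReal_le_ofReal (le_max_left _ _))
    have hvR' : gmod s p v ≤ ENNReal.ofReal R :=
      hvR.trans (ENNReal.ofReal_le_ofReal (le_max_left _ _))
    have hwR : gmod s p w ≤ ENNReal.ofReal R := (ENNReal.ofReal_toReal hw.fin.ne).ge.trans
      (ENNReal.ofReal_le_ofReal (le_max_right _ _))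
    have hF := fun n => huF (j n)
    have hBu := H.tendsto_dpot hF hF huR huR hv hv hlim hlim
    have hBv := H.tendsto_dpot hF (fun _ => hv) huR (fun _ => hvR') hv hv hlim
      (ae_of_all _ fun _ => tendsto_const_nhds)
    have hBw := H.tendsto_dpot hF (fun _ => hw) huR (fun _ => hwR) hv hw hlim
      (ae_of_all _ fun _ => tendsto_const_nhds)
    have hε : Tendsto (fun n => energyLHS s p (u (j n)) (u (j n)) - energyLHS s p (u (j n)) v)
        atTop (nhds 0) := by
      have := (hBu.div_const 2).sub (hBv.div_const 2)
      rw [sub_self] at this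
      refine this.congr fun n => ?_
      rw [hucrit, hutest _ _ (hjv n)]
    obtain ⟨hE, hA⟩ := h.tendsto_energy hF hv hlim hε fun n => h.energy_le_add (hF n) hv
    refine ⟨ge_of_tendsto' hE fun n => ?_, ?_⟩
    · linarith [hua (j n), H.pot_nonneg (u (j n))]
    · refine tendsto_nhds_unique (hA w hw) ((hBw.div_const 2).congr fun n => ?_)
      exact (hutest _ _ (hjw n)).symm
  refine ⟨v, hv, fun h0 => ?_, fun w hw => (key w hw).2⟩
  have h1 := (key v hv).1
  have h3 : energy s p v = 0 := by
    rw [energy_congr h0]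
    refine integral_eq_zero_of_ae (ae_of_all _ fun z => ?_)
    simp [gdens, Real.zero_rpow (h.p_pos z.1 z.2).ne']
  linarith

end Limit

/-- Existence of a nontrivial weak solution (Theorem existence). -/
theorem statement1
    {N : ℕ} (hN : 2 ≤ N) (Ω : Set (RN N))
    (hΩo : IsOpen Ω) (hΩb : Bornology.IsBounded Ω) (hΩne : Ω.Nonempty)
    (s p μ q : RN N → RN N → ℝ) (f : RN N → ℝ → ℝ) (M Θ : ℝ) (r : RN N → ℝ)
    (hs : S1 s) (hp : P1 s p) (hμ : Mu1 μ) (hq : CPlus2 q)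
    (hqμ : ∀ x y, 2 / q x y + μ x y / (N : ℝ) = 2)
    (hf : Caratheodory f)
    (hr : CPlusOn univ r) (hrM : MemM s p q r) (hrp : sup2 p < infOn univ r)
    (hf1 : F1 Ω f M r) (hΘ : sup2 p < Θ) (hf2 : F2 Ω f Θ)
    :
    ∃ u : RN N → ℝ, MemX0 Ω s p (fun x => p x x) u ∧
      ¬ (u =ᵐ[volume] (fun _ => (0 : ℝ))) ∧
      ∀ w : RN N → ℝ, MemX0 Ω s p (fun x => p x x) w →
        energyLHS s p u w = (1 / 2) * choquardRHS Ω μ f u w := by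
  have hN0 : 0 < N := by omega
  have h : Exponents s p (inf2 s) (sup2 s) (inf2 p) (sup2 p) :=
    { dim_pos := hN0
      s_cont := hs.1
      p_cont := hp.1.1
      s0_pos := hs.2.2.2.1
      s0_le := inf2_le hs.2.2.2.1
      le_s1 := le_sup2 hs.2.2.1
      s1_lt := hs.2.2.2.2
      p1_gt := hp.1.2.1
      p1_le := inf2_le (one_pos.trans hp.1.2.1)
      le_p2 := le_sup2 hp.1.2.2
      sub := hp.2.2 }
  obtain ⟨b, c, K, H, hpow⟩ := h.exists_choquard hΩo hΩb hμ hq hqμ hf hr hrM hf1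
    (h.p2_pos.trans hΘ) hf2
  obtain ⟨u, hu, hu0, hcrit⟩ := H.exists_solution h hΘ hΩo hΩb hΩne
  refine ⟨u, h.memX0_of_finMod hpow hu, hu0, fun w hw => ?_⟩
  have hw' := h.finMod_of_memX0 hΩo.measurableSet hw
  rw [hcrit w hw', H.choquardRHS_eq hu hw', div_eq_inv_mul, one_div]

end VarOrderChoquard
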